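/- For every sufficiently small ε > 0, the vortex core A_ε = {x ∈ Ω : u_ε(x) > q(x) ln(1/ε)} is connected and simply connected, and lim_{ε→0} diam(A_ε)/dist(A_ε, ∂Ω) = 0; in particular diam(A_ε) → 0 as ε → 0. -/

import Mathlib

open MeasureTheory Real Filter Topology Set

noncomputable section

/-- The bilinear form `(K_H(x) a | b)` associated with the matrix
`K_H(x) = (k²+|x|²)⁻¹ [[k²+x₂², -x₁x₂],[-x₁x₂, k²+x₁²]]`. -/
def KHform (k : ℝ) (x a b : ℝ × ℝ) : ℝ :=
  (k ^ 2 + x.1 ^ 2 + x.2 ^ 2)⁻¹ *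
    ((k ^ 2 + x.2 ^ 2) * a.1 * b.1 - x.1 * x.2 * a.1 * b.2
      - x.1 * x.2 * a.2 * b.1 + (k ^ 2 + x.1 ^ 2) * a.2 * b.2)

/-- `K_H(x)` applied to a vector `a`. -/
def KHvec (k : ℝ) (x a : ℝ × ℝ) : ℝ × ℝ :=
  ((k ^ 2 + x.1 ^ 2 + x.2 ^ 2)⁻¹ * ((k ^ 2 + x.2 ^ 2) * a.1 - x.1 * x.2 * a.2),
   (k ^ 2 + x.1 ^ 2 + x.2 ^ 2)⁻¹ * (-(x.1 * x.2) * a.1 + (k ^ 2 + x.1 ^ 2) * a.2))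

/-- `det K_H(x) = k²/(k²+|x|²)`. -/
def detKH (k : ℝ) (x : ℝ × ℝ) : ℝ := k ^ 2 / (k ^ 2 + x.1 ^ 2 + x.2 ^ 2)

/-- Gradient of a scalar function on `ℝ²`. -/
def grad (u : ℝ × ℝ → ℝ) (x : ℝ × ℝ) : ℝ × ℝ :=
  (fderiv ℝ u x (1, 0), fderiv ℝ u x (0, 1))

/-- Divergence of a vector field on `ℝ²`. -/
def div2 (F : ℝ × ℝ → ℝ × ℝ) (x : ℝ × ℝ) : ℝ :=
  fderiv ℝ (fun y => (F y).1) x (1, 0) + fderiv ℝ (fun y => (F y).2) x (0, 1)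

/-- The operator `L_H u = -div (K_H(x) ∇u)`. -/
def LH (k : ℝ) (u : ℝ × ℝ → ℝ) (x : ℝ × ℝ) : ℝ :=
  - div2 (fun y => KHvec k y (grad u y)) x

/-- Positive part `t₊ = max (t, 0)`. -/
def pPart (t : ℝ) : ℝ := max t 0

/-- Clockwise rotation through `π/2`: `a^⊥`. -/
def perp2 (a : ℝ × ℝ) : ℝ × ℝ := (a.2, -a.1)

/-- Euclidean distance in the plane. -/
def dE (a b : ℝ × ℝ) : ℝ := Real.sqrt ((a.1 - b.1) ^ 2 + (a.2 - b.2) ^ 2)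

/-- Euclidean diameter of a planar set. -/
def diamE (S : Set (ℝ × ℝ)) : ℝ := sSup {d | ∃ a ∈ S, ∃ b ∈ S, d = dE a b}

/-- Euclidean distance between two planar sets. -/
def distE (A B : Set (ℝ × ℝ)) : ℝ := sInf {d | ∃ a ∈ A, ∃ b ∈ B, d = dE a b}

/-- The function `q² √(det K_H)`. -/
def Qfun (k : ℝ) (q : ℝ × ℝ → ℝ) (x : ℝ × ℝ) : ℝ := q x ^ 2 * Real.sqrt (detKH k x)

/-- Surrogate for membership in `H(Ω) = H¹₀(Ω)` (with equivalent norm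
`‖u‖² = ∫_Ω (K_H ∇u|∇u)`). -/
def MemH (k : ℝ) (Ω : Set (ℝ × ℝ)) (u : ℝ × ℝ → ℝ) : Prop :=
  ContinuousOn u (closure Ω) ∧ ContDiffOn ℝ 1 u Ω ∧ (∀ x ∈ frontier Ω, u x = 0) ∧
    IntegrableOn (fun x => KHform k x (grad u x) (grad u x)) Ω

/-- The energy functional `I_ε`. -/
def Ieps (k p ε : ℝ) (q : ℝ × ℝ → ℝ) (Ω : Set (ℝ × ℝ)) (u : ℝ × ℝ → ℝ) : ℝ :=
  (1 / 2) * (∫ x in Ω, KHform k x (grad u x) (grad u x))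
    - (1 / ((p + 1) * ε ^ 2)) * ∫ x in Ω, pPart (u x - q x * Real.log (1 / ε)) ^ (p + 1)

/-- The mountain pass value `c_ε = inf_{γ ∈ P_ε} max_{t ∈ [0,1]} I_ε(γ(t))`, where
`P_ε` is the collection of paths in `H(Ω)` (continuous for the `H`-norm) joining `0`
to a point with negative energy. -/
def ceps (k p : ℝ) (q : ℝ × ℝ → ℝ) (Ω : Set (ℝ × ℝ)) (ε : ℝ) : ℝ :=
  sInf {c | ∃ γ : ℝ → ℝ × ℝ → ℝ,
    (∀ t ∈ Icc (0:ℝ) 1, MemH k Ω (γ t)) ∧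
    (∀ t ∈ Icc (0:ℝ) 1, ∀ δ > 0, ∃ η > 0, ∀ s ∈ Icc (0:ℝ) 1, |s - t| < η →
      (∫ x in Ω, KHform k x (grad (fun y => γ s y - γ t y) x)
        (grad (fun y => γ s y - γ t y) x)) < δ) ∧
    γ 0 = (fun _ => 0) ∧ Ieps k p ε q Ω (γ 1) < 0 ∧
    c = sSup ((fun t => Ieps k p ε q Ω (γ t)) '' Icc (0:ℝ) 1)}

/-- The Nehari manifold `N_ε`. -/
def Nehari (k p ε : ℝ) (q : ℝ × ℝ → ℝ) (Ω : Set (ℝ × ℝ)) : Set (ℝ × ℝ → ℝ) :=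
  {u | MemH k Ω u ∧ ¬ Set.EqOn u 0 Ω ∧
    (∫ x in Ω, KHform k x (grad u x) (grad u x))
      = (1 / ε ^ 2) * ∫ x in Ω, pPart (u x - q x * Real.log (1 / ε)) ^ p * u x}

/-- `u` is a (classical) solution of `L_H u = ε⁻²(u - q ln(1/ε))₊ᵖ` in `Ω`, `u = 0` on `∂Ω`. -/
def IsSolution (k p ε : ℝ) (q : ℝ × ℝ → ℝ) (Ω : Set (ℝ × ℝ)) (u : ℝ × ℝ → ℝ) : Prop :=
  ContinuousOn u (closure Ω) ∧ ContDiffOn ℝ 2 u Ω ∧ (∀ x ∈ frontier Ω, u x = 0) ∧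
    ∀ x ∈ Ω, LH k u x = (1 / ε ^ 2) * pPart (u x - q x * Real.log (1 / ε)) ^ p

/-- `u` is a mountain pass solution: a solution at the mountain pass level `c_ε`. -/
def IsMPSolution (k p ε : ℝ) (q : ℝ × ℝ → ℝ) (Ω : Set (ℝ × ℝ)) (u : ℝ × ℝ → ℝ) : Prop :=
  IsSolution k p ε q Ω u ∧ MemH k Ω u ∧ Ieps k p ε q Ω u = ceps k p q Ω ε

/-- The vortex core `A_ε = {x ∈ Ω : u(x) > q(x) ln(1/ε)}`. -/
def vcore (q : ℝ × ℝ → ℝ) (Ω : Set (ℝ × ℝ)) (ε : ℝ) (u : ℝ × ℝ → ℝ) : Set (ℝ × ℝ) :=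
  {x ∈ Ω | q x * Real.log (1 / ε) < u x}


lemma exists_clog {A : Type*} [TopologicalSpace A] [SimplyConnectedSpace A]
    [LocallyPathConnectedSpace A] (f : C(A, ℂ)) (hf : ∀ a, f a ≠ 0) :
    ∃ g : C(A, ℂ), ∀ a, Complex.exp (g a) = f a := by
  have : PathConnectedSpace A := inferInstance
  obtain ⟨a0⟩ := this.nonempty
  obtain ⟨F, hF, -⟩ := Complex.isCoveringMapOn_exp.existsUnique_continuousMap_lifts f
    (a₀ := a0) (e₀ := Complex.log (f a0)) (Complex.exp_log (hf a0)) (fun a => hf a)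
  exact ⟨F, fun a => congrFun hF.2 a⟩

/-- a continuous function with values in `2πiℤ` on a preconnected space is constant -/
lemma const_of_exp_eq_one {A : Type*} [TopologicalSpace A] [PreconnectedSpace A] (d : A → ℂ)
    (hd : Continuous d) (h1 : ∀ a, Complex.exp (d a) = 1) (a b : A) : d a = d b := by
  choose n hn using fun a => Complex.exp_eq_one_iff.1 (h1 a)
  have hpi : (2 * (π:ℂ) * Complex.I) ≠ 0 := Complex.two_pi_I_ne_zero
  have hc : Continuous (fun a => ((n a : ℤ) : ℝ)) := by
    have : (fun a => ((n a : ℤ) : ℝ)) = fun a => (d a / (2 * (π:ℂ) * Complex.I)).re := by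
      funext a
      rw [hn a, mul_div_assoc, div_self hpi]
      simp
    rw [this]
    fun_prop
  have hc' : Continuous n := Int.isClosedEmbedding_coe_real.isInducing.continuous_iff.2 hc
  have := PreconnectedSpace.constant (inferInstance : PreconnectedSpace A) hc' (x := a) (y := b)
  rw [hn a, hn b, this]

lemma no_degree (Ψ : ℂ → ℂ) (hc : Continuous Ψ) (z0 : ℂ) (h0 : ∀ z, z ≠ z0 → Ψ z ≠ 0)
    (r R : ℝ) (hr : 0 < r) (hin : ∀ z, ‖z - z0‖ ≤ r → Ψ z = z - z0)
    (hout : ∀ z, R ≤ ‖z - z0‖ → Ψ z = 1) : False := by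
  let H : ℝ × ℝ → ℂ := fun x => z0 + r * Complex.exp ((x.1 : ℂ) + x.2 * Complex.I)
  have hH : Continuous H := by unfold H; fun_prop
  have hne : ∀ x, Ψ (H x) ≠ 0 := by
    intro x
    apply h0
    simp only [H, ne_eq, add_eq_left, mul_eq_zero, Complex.exp_ne_zero, or_false]
    exact_mod_cast hr.ne'
  obtain ⟨g, hg⟩ := exists_clog (⟨fun x => Ψ (H x), hc.comp hH⟩ : C(ℝ × ℝ, ℂ)) hne
  simp only [ContinuousMap.coe_mk] at hg
  have hper : ∀ t : ℝ, H (t, 2 * π) = H (t, 0) := by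
    intro t
    simp only [H]
    congr 2
    rw [Complex.exp_add, Complex.exp_add]
    push_cast
    rw [Complex.exp_two_pi_mul_I]
    simp
  have hD := const_of_exp_eq_one (fun t : ℝ => g (t, 2 * π) - g (t, 0)) (by fun_prop) (by
    intro t
    rw [Complex.exp_sub, hg, hg, hper, div_self (hne _)])
  have hnorm : ∀ t θ : ℝ, ‖H (t, θ) - z0‖ = r * Real.exp t := by
    intro t θ
    simp [H, Complex.norm_exp, abs_of_pos hr]
  -- at zero
  have e0 : g (0, 2 * π) - g (0, 0) = 2 * π * Complex.I := by
    have := const_of_exp_eq_one (fun θ : ℝ => g (0, θ) - θ * Complex.I - Real.log r) (by fun_prop)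
      (by
        intro θ
        rw [Complex.exp_sub, Complex.exp_sub, hg, hin _ (by rw [hnorm]; simp),
          ← Complex.ofReal_exp, Real.exp_log hr]
        simp only [H, Complex.ofReal_zero, zero_add, add_sub_cancel_left]
        have := Complex.exp_ne_zero (θ * Complex.I)
        have hr' : (r:ℂ) ≠ 0 := by exact_mod_cast hr.ne'
        field_simp) (2 * π) 0
    simp only [Complex.ofReal_zero] at this
    push_cast at this
    linear_combination this
  obtain ⟨t, ht⟩ : ∃ t : ℝ, R ≤ r * Real.exp t := by
    refine ⟨|R| / r, ?_⟩
    have := Real.add_one_le_exp (|R| / r)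
    calc R ≤ |R| := le_abs_self R
      _ = r * (|R| / r) := by field_simp
      _ ≤ r * Real.exp (|R| / r) := by gcongr; linarith
  have e1 : g (t, 2 * π) - g (t, 0) = 0 := by
    have := const_of_exp_eq_one (fun θ : ℝ => g (t, θ)) (by fun_prop)
      (by
        intro θ
        rw [hg, hout _ (by rw [hnorm]; exact ht)]) (2 * π) 0
    rw [this, sub_self]
  have := hD 0 t
  rw [e0, e1] at this
  exact Complex.two_pi_I_ne_zero this

lemma noHole_of_simplyConnected (Ω : Set (ℝ × ℝ)) (hΩ : IsOpen Ω) (hs : SimplyConnectedSpace ↥Ω)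
    (F : Set (ℝ × ℝ)) (hF : IsCompact F) (hd : Disjoint F Ω) (ho : IsOpen (Ω ∪ F)) : F = ∅ := by
  by_contra hne
  obtain ⟨z0, hz0⟩ := Set.nonempty_iff_ne_empty.2 hne
  have hFne : F.Nonempty := ⟨z0, hz0⟩
  have : LocallyPathConnectedSpace ↥Ω := hΩ.locallyPathConnectedSpace
  let c : ℝ × ℝ → ℂ := fun x => Complex.equivRealProdCLM.symm x
  have hcc : Continuous c := by unfold c; fun_prop
  have hcinj : ∀ x y, c x = c y → x = y := fun x y h => Complex.equivRealProdCLM.symm.injective h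
  obtain ⟨g, hg⟩ := exists_clog (A := ↥Ω)
    (⟨fun x => c x.1 - c z0, by fun_prop⟩ : C(↥Ω, ℂ)) (by
      intro a h
      simp only [ContinuousMap.coe_mk, sub_eq_zero] at h
      have := hcinj _ _ h
      exact Set.disjoint_left.1 hd hz0 (this ▸ a.2))
  simp only [ContinuousMap.coe_mk] at hg
  obtain ⟨ρ, hρ, hρs⟩ := hF.exists_cthickening_subset_open ho (subset_union_right)
  let χ : ℝ × ℝ → ℝ := fun x => max 0 (min 1 (2 - 3 * Metric.infDist x F / ρ))
  have hχc : Continuous χ := by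
    unfold χ
    have := Metric.continuous_infDist_pt F
    fun_prop
  have hχ1 : ∀ x, Metric.infDist x F < ρ / 3 → χ x = 1 := by
    intro x hx
    have : 3 * Metric.infDist x F / ρ ≤ 1 := by rw [div_le_one hρ]; linarith
    simp only [χ]
    rw [min_eq_left (by linarith), max_eq_right (by norm_num)]
  have hχ0 : ∀ x, 2 * ρ / 3 < Metric.infDist x F → χ x = 0 := by
    intro x hx
    have : 2 ≤ 3 * Metric.infDist x F / ρ := by rw [le_div_iff₀ hρ]; linarith
    simp only [χ]
    rw [max_eq_left]
    exact (min_le_right _ _).trans (by linarith)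
  have hthick : ∀ x, Metric.infDist x F ≤ ρ → x ∈ Ω ∪ F := by
    intro x hx
    apply hρs
    obtain ⟨y, hy, hxy⟩ := hF.exists_infDist_eq_dist hFne x
    exact Metric.mem_cthickening_of_dist_le x y ρ F hy (hxy ▸ hx)
  classical
  let Ψ : ℝ × ℝ → ℂ := fun x => if h : x ∈ Ω then
    (c x - c z0) * Complex.exp (-(1 - (χ x : ℂ)) * g ⟨x, h⟩) else
    if x ∈ F then c x - c z0 else 1
  have hΨ1 : ∀ x, Metric.infDist x F < ρ / 3 → Ψ x = c x - c z0 := by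
    intro x hx
    by_cases h : x ∈ Ω
    · simp [Ψ, h, hχ1 x hx]
    · have : x ∈ F := (hthick x (by linarith)).resolve_left h
      simp [Ψ, h, this]
  have hΨ0 : ∀ x, 2 * ρ / 3 < Metric.infDist x F → Ψ x = 1 := by
    intro x hx
    have hxF : x ∉ F := by
      intro h
      rw [Metric.infDist_zero_of_mem h] at hx
      linarith
    by_cases h : x ∈ Ω
    · simp only [Ψ, h, hχ0 x hx, dite_true]
      have := hg ⟨x, h⟩
      rw [← this, ← Complex.exp_add]
      simp
    · simp [Ψ, h, hxF]
  have hcont : Continuous Ψ := by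
    rw [continuous_iff_continuousAt]
    intro x
    by_cases h : x ∈ Ω
    · have h1 : ContinuousOn Ψ Ω := by
        rw [continuousOn_iff_continuous_domRestrict]
        have : Ω.domRestrict Ψ = fun x : ↥Ω => (c x.1 - c z0) *
            Complex.exp (-(1 - (χ x.1 : ℂ)) * g x) := by
          funext y
          have hy : y.1 ∈ Ω := y.2
          change Ψ y.1 = _
          simp [Ψ, hy]
        rw [this]
        fun_prop
      exact h1.continuousAt (hΩ.mem_nhds h)
    · by_cases h2 : x ∈ F
      · have : ∀ᶠ y in 𝓝 x, Ψ y = c y - c z0 := by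
          have : ∀ᶠ y in 𝓝 x, Metric.infDist y F < ρ / 3 := by
            apply (Metric.continuous_infDist_pt F).continuousAt.eventually_lt continuousAt_const
            rw [Metric.infDist_zero_of_mem h2]
            linarith
          exact this.mono hΨ1
        exact ContinuousAt.congr (by fun_prop) (this.mono fun y hy => hy.symm)
      · have : ∀ᶠ y in 𝓝 x, Ψ y = 1 := by
          have : ∀ᶠ y in 𝓝 x, 2 * ρ / 3 < Metric.infDist y F := by
            apply continuousAt_const.eventually_lt (Metric.continuous_infDist_pt F).continuousAt
            by_contra hcon
            exact (hthick x (by linarith)).elim h h2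
          exact this.mono hΨ0
        exact ContinuousAt.congr (continuousAt_const) (this.mono fun y hy => hy.symm)
  obtain ⟨B, hB⟩ := hF.isBounded.exists_norm_le
  have hci : ∀ z : ℂ, c (Complex.equivRealProdCLM z) = z := fun z =>
    Complex.equivRealProdCLM.symm_apply_apply z
  refine no_degree (fun z => Ψ (Complex.equivRealProdCLM z)) (by fun_prop) (c z0) ?_ (ρ / 6)
    (2 * (B + ρ + ‖z0‖) + 1) (by linarith) ?_ ?_
  · intro z hz
    have hz' : c (Complex.equivRealProdCLM z) - c z0 ≠ 0 := by
      rw [hci]; exact sub_ne_zero.2 hz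
    simp only [Ψ]
    split_ifs
    · exact mul_ne_zero hz' (Complex.exp_ne_zero _)
    · exact hz'
    · exact one_ne_zero
  · intro z hz
    rw [hΨ1, hci]
    have h1 : Metric.infDist (Complex.equivRealProdCLM z) F ≤ dist (Complex.equivRealProdCLM z) z0 :=
      Metric.infDist_le_dist_of_mem hz0
    have h2 : dist (Complex.equivRealProdCLM z) z0 ≤ ‖z - c z0‖ := by
      have : Complex.equivRealProdCLM z - z0 = Complex.equivRealProdCLM (z - c z0) := by
        rw [map_sub]; simp [c]
      rw [dist_eq_norm, this]
      exact Complex.equivRealProd_apply_le (z - c z0)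
    linarith
  · intro z hz
    apply hΨ0
    have h2 : ‖z - c z0‖ ≤ 2 * ‖Complex.equivRealProdCLM z - z0‖ := by
      have : Complex.equivRealProdCLM z - z0 = Complex.equivRealProdCLM (z - c z0) := by
        rw [map_sub]; simp [c]
      rw [this]
      have h3 := Complex.norm_le_abs_re_add_abs_im (z - c z0)
      have h4 : |(z - c z0).re| ≤ ‖Complex.equivRealProdCLM (z - c z0)‖ :=
        norm_fst_le (Complex.equivRealProdCLM (z - c z0))
      have h5 : |(z - c z0).im| ≤ ‖Complex.equivRealProdCLM (z - c z0)‖ :=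
        norm_snd_le (Complex.equivRealProdCLM (z - c z0))
      linarith
    have : ρ ≤ Metric.infDist (Complex.equivRealProdCLM z) F := by
      rw [Metric.le_infDist hFne]
      intro y hy
      rw [dist_eq_norm]
      have h6 := hB y hy
      have h7 : ‖Complex.equivRealProdCLM z - z0‖ ≤ ‖Complex.equivRealProdCLM z - y‖ + ‖y‖ + ‖z0‖ := by
        calc ‖Complex.equivRealProdCLM z - z0‖
            = ‖(Complex.equivRealProdCLM z - y) + y - z0‖ := by congr 1; abel
          _ ≤ ‖(Complex.equivRealProdCLM z - y) + y‖ + ‖z0‖ := norm_sub_le _ _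
          _ ≤ _ := by gcongr; exact norm_add_le _ _
      linarith
    linarith


abbrev PHQ {X : Type*} [TopologicalSpace X] (x y : X) := Path.Homotopic.Quotient x y

/-- straight segment path -/
def segPath (A : Set (ℝ × ℝ)) (x y : ↥A) (h : segment ℝ (x : ℝ × ℝ) y ⊆ A) : Path x y where
  toFun t := ⟨(AffineMap.lineMap (x : ℝ × ℝ) (y : ℝ × ℝ)) (t : ℝ), h (by
    rw [segment_eq_image_lineMap]; exact ⟨t, t.2, rfl⟩)⟩
  continuous_toFun := by
    refine Continuous.subtype_mk ?_ _
    exact (AffineMap.lineMap_continuous).comp continuous_subtype_val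
  source' := by ext1; simp
  target' := by ext1; simp

lemma homotopic_of_convex (A C : Set (ℝ × ℝ)) (hC : Convex ℝ C) (hCA : C ⊆ A) (x y : ↥A)
    (p r : Path x y) (hp : ∀ t, (p t : ℝ × ℝ) ∈ C) (hr : ∀ t, (r t : ℝ × ℝ) ∈ C) :
    p.Homotopic r := by
  have key : ∀ st : unitInterval × unitInterval,
      (1 - (st.1 : ℝ)) • (p st.2 : ℝ × ℝ) + (st.1 : ℝ) • (r st.2 : ℝ × ℝ) ∈ C := by
    intro st
    exact hC (hp _) (hr _) (by linarith [st.1.2.2]) st.1.2.1 (by ring)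
  refine ⟨⟨⟨⟨fun st => ⟨_, hCA (key st)⟩, ?_⟩, ?_, ?_⟩, ?_⟩⟩
  · refine Continuous.subtype_mk ?_ _
    have h1 : Continuous fun st : unitInterval × unitInterval => (p st.2 : ℝ × ℝ) :=
      continuous_subtype_val.comp (p.continuous.comp continuous_snd)
    have h2 : Continuous fun st : unitInterval × unitInterval => (r st.2 : ℝ × ℝ) :=
      continuous_subtype_val.comp (r.continuous.comp continuous_snd)
    have h3 : Continuous fun st : unitInterval × unitInterval => (st.1 : ℝ) :=
      continuous_subtype_val.comp continuous_fst
    exact ((continuous_const.sub h3).smul h1).add (h3.smul h2)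
  · intro t; ext1; simp
  · intro t; ext1; simp
  · intro s t ht
    rcases ht with rfl | ht
    · ext1; simp [← add_smul]
    · rw [Set.mem_singleton_iff] at ht; subst ht
      ext1; simp [← add_smul]

def sg (A : Set (ℝ × ℝ)) (x y : ↥A) (h : segment ℝ (x : ℝ × ℝ) y ⊆ A) : PHQ x y :=
  Path.Homotopic.Quotient.mk (segPath A x y h)

lemma segPath_mem (A : Set (ℝ × ℝ)) (x y : ↥A) (h : segment ℝ (x : ℝ × ℝ) y ⊆ A)
    (C : Set (ℝ × ℝ)) (hC : Convex ℝ C) (hx : (x : ℝ × ℝ) ∈ C) (hy : (y : ℝ × ℝ) ∈ C) (t) :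
    (segPath A x y h t : ℝ × ℝ) ∈ C := by
  apply hC.segment_subset hx hy
  rw [segment_eq_image_lineMap]; exact ⟨t, t.2, rfl⟩

lemma mk_eq_sg (A C : Set (ℝ × ℝ)) (hC : Convex ℝ C) (hCA : C ⊆ A) (x y : ↥A)
    (p : Path x y) (hp : ∀ t, (p t : ℝ × ℝ) ∈ C) (h : segment ℝ (x : ℝ × ℝ) y ⊆ A) :
    Path.Homotopic.Quotient.mk p = sg A x y h := by
  apply Path.Homotopic.Quotient.eq.2
  apply homotopic_of_convex A C hC hCA _ _ _ _ hp
  exact segPath_mem A x y h C hC (by simpa using hp 0) (by simpa using hp 1)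

lemma sg_trans (A C : Set (ℝ × ℝ)) (hC : Convex ℝ C) (hCA : C ⊆ A) (x y z : ↥A)
    (hx : (x : ℝ × ℝ) ∈ C) (hy : (y : ℝ × ℝ) ∈ C) (hz : (z : ℝ × ℝ) ∈ C)
    (h1 : segment ℝ (x : ℝ × ℝ) y ⊆ A) (h2 : segment ℝ (y : ℝ × ℝ) z ⊆ A)
    (h3 : segment ℝ (x : ℝ × ℝ) z ⊆ A) :
    (sg A x y h1).trans (sg A y z h2) = sg A x z h3 := by
  unfold sg
  rw [← Path.Homotopic.Quotient.mk_trans]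
  apply mk_eq_sg A C hC hCA
  intro t
  have := Path.trans_range (segPath A x y h1) (segPath A y z h2)
  have h4 : (segPath A x y h1).trans (segPath A y z h2) t ∈
    Set.range ((segPath A x y h1).trans (segPath A y z h2)) := ⟨t, rfl⟩
  rw [this] at h4
  rcases h4 with ⟨s, hs⟩ | ⟨s, hs⟩
  · rw [← hs]; exact segPath_mem A _ _ _ C hC hx hy _
  · rw [← hs]; exact segPath_mem A _ _ _ C hC hy hz _

lemma sg_self (A : Set (ℝ × ℝ)) (x : ↥A) (h : segment ℝ (x : ℝ × ℝ) x ⊆ A) :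
    sg A x x h = Path.Homotopic.Quotient.refl x := by
  rw [← Path.Homotopic.Quotient.mk_refl]
  symm
  apply mk_eq_sg A {(x : ℝ × ℝ)} (convex_singleton _) (by simp)
  intro t; simp

lemma sg_cancel (A : Set (ℝ × ℝ)) (x y : ↥A) (h : segment ℝ (x : ℝ × ℝ) y ⊆ A)
    (h' : segment ℝ (y : ℝ × ℝ) x ⊆ A) :
    (sg A x y h).trans (sg A y x h') = Path.Homotopic.Quotient.refl x := by
  rw [sg_trans A (segment ℝ (x : ℝ × ℝ) y) (convex_segment _ _) h x y x
    (left_mem_segment ..) (right_mem_segment ..) (left_mem_segment ..) _ _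
    (by simp), sg_self]

/-- the grid point -/
def gpt (h : ℝ) (P : ℤ × ℤ) : ℝ × ℝ := (h * P.1, h * P.2)

abbrev GV (A : Set (ℝ × ℝ)) (h : ℝ) := {P : ℤ × ℤ // gpt h P ∈ A}

def gp {A : Set (ℝ × ℝ)} {h : ℝ} (P : GV A h) : ↥A := ⟨gpt h P.1, P.2⟩

def unitNb (P Q : ℤ × ℤ) : Prop :=
  (P.1 = Q.1 ∧ (P.2 = Q.2 + 1 ∨ Q.2 = P.2 + 1)) ∨ (P.2 = Q.2 ∧ (P.1 = Q.1 + 1 ∨ Q.1 = P.1 + 1))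

def GG (A : Set (ℝ × ℝ)) (h : ℝ) : SimpleGraph (GV A h) where
  Adj P Q := unitNb P.1 Q.1 ∧ segment ℝ (gpt h P.1) (gpt h Q.1) ⊆ A
  symm := ⟨fun P Q h => by
    refine ⟨?_, by rw [segment_symm]; exact h.2⟩
    rcases h.1 with h | h
    · left; exact ⟨h.1.symm, h.2.symm⟩
    · right; exact ⟨h.1.symm, h.2.symm⟩⟩
  loopless := ⟨fun P h => by rcases h.1 with h | h <;> omega⟩

def TW {A : Set (ℝ × ℝ)} {h : ℝ} : ∀ {P Q : GV A h}, (GG A h).Walk P Q → PHQ (gp P) (gp Q)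
  | _, _, .nil => Path.Homotopic.Quotient.refl _
  | _, _, .cons (v := v) hd w => (sg A _ (gp v) hd.2).trans (TW w)

lemma TW_nil {A : Set (ℝ × ℝ)} {h : ℝ} (P : GV A h) :
    TW (SimpleGraph.Walk.nil : (GG A h).Walk P P) = Path.Homotopic.Quotient.refl _ := rfl

lemma TW_cons {A : Set (ℝ × ℝ)} {h : ℝ} {P Q R : GV A h} (hd : (GG A h).Adj P Q)
    (w : (GG A h).Walk Q R) :
    TW (SimpleGraph.Walk.cons hd w) = (sg A (gp P) (gp Q) hd.2).trans (TW w) := rfl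

lemma TW_append {A : Set (ℝ × ℝ)} {h : ℝ} {P Q R : GV A h} (w : (GG A h).Walk P Q)
    (v : (GG A h).Walk Q R) : TW (w.append v) = (TW w).trans (TW v) := by
  induction w with
  | nil => simp [TW_nil]
  | cons hd w ih => 
    rw [SimpleGraph.Walk.cons_append, TW_cons, TW_cons, ih, Path.Homotopic.Quotient.trans_assoc]

lemma TW_conj {A : Set (ℝ × ℝ)} {h : ℝ} {P Q : GV A h} (a : (GG A h).Walk P Q)
    (b : (GG A h).Walk Q P) (hh : TW (b.append a) = Path.Homotopic.Quotient.refl _) :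
    TW (a.append b) = Path.Homotopic.Quotient.refl _ := by
  rw [TW_append] at *
  have : TW a = (TW b).symm := by
    have h1 := congrArg (fun z => (TW b).symm.trans z) hh
    rw [← Path.Homotopic.Quotient.trans_assoc, Path.Homotopic.Quotient.symm_trans,
      Path.Homotopic.Quotient.refl_trans, Path.Homotopic.Quotient.trans_refl] at h1
    exact h1
  rw [this, Path.Homotopic.Quotient.symm_trans]



def WS {A : Set (ℝ × ℝ)} {h : ℝ} (f : ℤ × ℤ → ℤ × ℤ → ℤ) :
    ∀ {P Q : GV A h}, (GG A h).Walk P Q → ℤ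
  | _, _, .nil => 0
  | P, _, .cons (v := v) _ w => f P.1 v.1 + WS f w

lemma WS_append {A : Set (ℝ × ℝ)} {h : ℝ} (f : ℤ × ℤ → ℤ × ℤ → ℤ) {P Q R : GV A h}
    (w : (GG A h).Walk P Q) (v : (GG A h).Walk Q R) : WS f (w.append v) = WS f w + WS f v := by
  induction w with
  | nil => simp [WS]
  | cons hd w ih => simp only [SimpleGraph.Walk.cons_append, WS, ih]; ring

lemma WS_tel {A : Set (ℝ × ℝ)} {h : ℝ} (f₁ f₂ : ℤ × ℤ → ℤ × ℤ → ℤ) (g : ℤ × ℤ → ℤ)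
    (hfg : ∀ P Q : GV A h, (GG A h).Adj P Q → f₁ P.1 Q.1 = f₂ P.1 Q.1 + (g Q.1 - g P.1))
    {P Q : GV A h} (w : (GG A h).Walk P Q) : WS f₁ w = WS f₂ w + (g Q.1 - g P.1) := by
  induction w with
  | nil => simp [WS]
  | cons hd w ih => simp only [WS, ih, hfg _ _ hd]; ring

def cF (i j : ℤ) (P Q : ℤ × ℤ) : ℤ :=
  if P.2 = Q.2 ∧ j < P.2 then
    (if P.1 = i ∧ Q.1 = i + 1 then 1 else if Q.1 = i ∧ P.1 = i + 1 then -1 else 0) else 0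

lemma F_vert {A : Set (ℝ × ℝ)} {h : ℝ} (i j : ℤ)
    (hn : ¬ segment ℝ (gpt h (i, j)) (gpt h (i, j + 1)) ⊆ A) {P : GV A h}
    (w : (GG A h).Walk P P) : WS (cF (i - 1) j) w = WS (cF i j) w := by
  have := WS_tel (A := A) (h := h) (cF (i - 1) j) (cF i j)
    (fun P => if P.1 = i ∧ j < P.2 then 1 else 0) (fun P Q hPQ => ?_) w
  · rw [this]; ring
  · obtain ⟨h1, h2⟩ := hPQ
    obtain ⟨⟨a, b⟩, hP⟩ := P
    obtain ⟨⟨c, d⟩, hQ⟩ := Q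
    have e1 : ¬ (a = i ∧ b = j ∧ c = i ∧ d = j + 1) := by
      rintro ⟨rfl, rfl, rfl, rfl⟩; exact hn h2
    have e2 : ¬ (a = i ∧ b = j + 1 ∧ c = i ∧ d = j) := by
      rintro ⟨rfl, rfl, rfl, rfl⟩; rw [segment_symm] at h2; exact hn h2
    simp only [unitNb] at h1
    simp only [cF]
    split_ifs <;> omega

lemma F_horiz {A : Set (ℝ × ℝ)} {h : ℝ} (i j : ℤ)
    (hn : ¬ segment ℝ (gpt h (i, j + 1)) (gpt h (i + 1, j + 1)) ⊆ A) {P : GV A h}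
    (w : (GG A h).Walk P P) : WS (cF i j) w = WS (cF i (j + 1)) w := by
  have := WS_tel (A := A) (h := h) (cF i j) (cF i (j + 1))
    (fun P => 0) (fun P Q hPQ => ?_) w
  · rw [this]; ring
  · obtain ⟨h1, h2⟩ := hPQ
    obtain ⟨⟨a, b⟩, hP⟩ := P
    obtain ⟨⟨c, d⟩, hQ⟩ := Q
    have e1 : ¬ (a = i ∧ b = j + 1 ∧ c = i + 1 ∧ d = j + 1) := by
      rintro ⟨rfl, rfl, rfl, rfl⟩; exact hn h2
    have e2 : ¬ (a = i + 1 ∧ b = j + 1 ∧ c = i ∧ d = j + 1) := by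
      rintro ⟨rfl, rfl, rfl, rfl⟩; rw [segment_symm] at h2; exact hn h2
    simp only [unitNb] at h1
    simp only [cF]
    split_ifs <;> omega

lemma F_far {A : Set (ℝ × ℝ)} {h : ℝ} (N : ℤ)
    (hN : ∀ P : GV A h, -N ≤ P.1.1 ∧ P.1.1 ≤ N ∧ -N ≤ P.1.2 ∧ P.1.2 ≤ N) (i j : ℤ)
    (hij : i < -N - 1 ∨ N < i ∨ j < -N - 1 ∨ N < j) {P : GV A h}
    (w : (GG A h).Walk P P) : WS (cF i j) w = 0 := by
  have h0 : WS (A := A) (h := h) (fun _ _ => 0) w = 0 := by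
    have := WS_tel (A := A) (h := h) (fun _ _ => (1:ℤ)) (fun _ _ => 1)
      (fun P => 0) (fun P Q hPQ => by simp) w
    clear this
    have : ∀ {P Q : GV A h} (w : (GG A h).Walk P Q), WS (A := A) (h := h) (fun _ _ => 0) w = 0 := by
      intro P Q w
      induction w with
      | nil => rfl
      | cons hd w ih => simp [WS, ih]
    exact this w
  have := WS_tel (A := A) (h := h) (cF i j) (fun _ _ => 0)
    (fun P => if j < -N - 1 ∧ i < P.1 then 1 else 0) (fun P Q hPQ => ?_) w
  · rw [this, h0]; ring
  · obtain ⟨h1, h2⟩ := hPQ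
    have hP' := hN P
    have hQ' := hN Q
    obtain ⟨⟨a, b⟩, hP⟩ := P
    obtain ⟨⟨c, d⟩, hQ⟩ := Q
    simp only [unitNb] at h1
    simp only at hP' hQ'
    simp only [cF]
    split_ifs <;> omega

lemma mem_seg_vert (h : ℝ) (hh : 0 < h) (i j : ℤ) (z : ℝ × ℝ) (h1 : z.1 = h * i)
    (h2 : h * j ≤ z.2) (h3 : z.2 ≤ h * (j + 1)) :
    z ∈ segment ℝ (gpt h (i, j)) (gpt h (i, j + 1)) := by
  rw [segment_eq_image_lineMap]
  refine ⟨z.2 / h - j, ⟨?_, ?_⟩, ?_⟩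
  · rw [sub_nonneg, le_div_iff₀ hh]; linarith
  · rw [sub_le_iff_le_add, div_le_iff₀ hh]; linarith
  · ext
    · simp [AffineMap.lineMap_apply, gpt, h1]
    · simp [AffineMap.lineMap_apply, gpt]; field_simp; ring

lemma mem_seg_horiz (h : ℝ) (hh : 0 < h) (i j : ℤ) (z : ℝ × ℝ) (h1 : z.2 = h * j)
    (h2 : h * i ≤ z.1) (h3 : z.1 ≤ h * (i + 1)) :
    z ∈ segment ℝ (gpt h (i, j)) (gpt h (i + 1, j)) := by
  rw [segment_eq_image_lineMap]
  refine ⟨z.1 / h - i, ⟨?_, ?_⟩, ?_⟩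
  · rw [sub_nonneg, le_div_iff₀ hh]; linarith
  · rw [sub_le_iff_le_add, div_le_iff₀ hh]; linarith
  · ext
    · simp [AffineMap.lineMap_apply, gpt]; field_simp; ring
    · simp [AffineMap.lineMap_apply, gpt, h1]

def NN {A : Set (ℝ × ℝ)} {h : ℝ} {P : GV A h} (w : (GG A h).Walk P P) (z : ℝ × ℝ) : ℤ :=
  WS (cF ⌊z.1 / h⌋ ⌊z.2 / h⌋) w

lemma NN_sq {A : Set (ℝ × ℝ)} {h : ℝ} (hh : 0 < h) {P : GV A h} (w : (GG A h).Walk P P)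
    (z : ℝ × ℝ) (hz : z ∉ A) (i j : ℤ) (h1 : h * i ≤ z.1) (h2 : z.1 ≤ h * (i + 1))
    (h3 : h * j ≤ z.2) (h4 : z.2 ≤ h * (j + 1)) : WS (cF i j) w = NN w z := by
  have a1 : (⌊z.1 / h⌋ : ℝ) ≤ z.1 / h := Int.floor_le _
  have a2 : z.1 / h < ⌊z.1 / h⌋ + 1 := Int.lt_floor_add_one _
  have b1 : (⌊z.2 / h⌋ : ℝ) ≤ z.2 / h := Int.floor_le _
  have b2 : z.2 / h < ⌊z.2 / h⌋ + 1 := Int.lt_floor_add_one _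
  unfold NN
  generalize ⌊z.1 / h⌋ = I at *
  generalize ⌊z.2 / h⌋ = J at *
  rw [le_div_iff₀ hh] at a1 b1
  rw [div_lt_iff₀ hh] at a2 b2
  have c1 : i < I + 1 := by
    have : (i : ℝ) < I + 1 := by
      have : h * i < h * (I + 1) := by linarith
      exact lt_of_mul_lt_mul_left this hh.le
    exact_mod_cast this
  have c2 : I ≤ i + 1 := by
    have : (I : ℝ) ≤ i + 1 := by
      have : h * I ≤ h * (i + 1) := by linarith
      exact le_of_mul_le_mul_left this hh
    exact_mod_cast this
  have d1 : j < J + 1 := by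
    have : (j : ℝ) < J + 1 := by
      have : h * j < h * (J + 1) := by linarith
      exact lt_of_mul_lt_mul_left this hh.le
    exact_mod_cast this
  have d2 : J ≤ j + 1 := by
    have : (J : ℝ) ≤ j + 1 := by
      have : h * J ≤ h * (j + 1) := by linarith
      exact le_of_mul_le_mul_left this hh
    exact_mod_cast this
  have step1 : WS (cF i j) w = WS (cF I j) w := by
    rcases (by omega : I = i ∨ I = i + 1) with rfl | rfl
    · rfl
    · have := F_vert (A := A) (h := h) (i + 1) j (fun hs => hz (hs ?_)) w
      · simpa using this
      · apply mem_seg_vert h hh _ _ _ _ h3 h4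
        push_cast at a1 ⊢; linarith
  rw [step1]
  rcases (by omega : J = j ∨ J = j + 1) with rfl | rfl
  · rfl
  · apply F_horiz
    intro hs
    apply hz (hs _)
    apply mem_seg_horiz h hh _ _ _ _ (by linarith) (by linarith)
    push_cast at b1 ⊢; linarith

lemma floor_near (h : ℝ) (hh : 0 < h) (x : ℝ) : ∀ᶠ y in 𝓝 x,
    h * ⌊y / h⌋ ≤ x ∧ x ≤ h * (⌊y / h⌋ + 1) := by
  have h1 : ∀ᶠ y in 𝓝 x, y / h < ⌊x / h⌋ + 1 :=
    (by fun_prop : Continuous fun y : ℝ => y / h).continuousAt.eventually_lt_const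
      (Int.lt_floor_add_one _)
  have h2 : ∀ᶠ y in 𝓝 x, ((⌈x / h⌉ : ℝ) - 1) < y / h :=
    (by fun_prop : Continuous fun y : ℝ => y / h).continuousAt.eventually_const_lt
      (by linarith [Int.ceil_lt_add_one (x / h)])
  filter_upwards [h1, h2] with y e1 e2
  have f1 : ⌊y / h⌋ ≤ ⌊x / h⌋ := by
    have : ⌊y / h⌋ < ⌊x / h⌋ + 1 := by rw [Int.floor_lt]; push_cast; exact e1
    omega
  have f2 : ⌈x / h⌉ - 1 ≤ ⌊y / h⌋ := by
    rw [Int.le_floor]; push_cast; exact e2.le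
  constructor
  · have : (⌊y / h⌋ : ℝ) ≤ x / h := (Int.cast_le.2 f1).trans (Int.floor_le _)
    rw [le_div_iff₀ hh] at this; linarith
  · have : x / h ≤ ⌊y / h⌋ + 1 := (Int.le_ceil _).trans (by exact_mod_cast (by omega : ⌈x / h⌉ ≤ ⌊y / h⌋ + 1))
    rw [div_le_iff₀ hh] at this; linarith

def NoHole (A : Set (ℝ × ℝ)) : Prop :=
  ∀ F : Set (ℝ × ℝ), IsCompact F → Disjoint F A → IsOpen (A ∪ F) → F = ∅

lemma square_sub {A : Set (ℝ × ℝ)} (hA : IsOpen A) (hAb : Bornology.IsBounded A)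
    (hN : NoHole A) {h : ℝ} (hh : 0 < h) {P : GV A h} (w : (GG A h).Walk P P)
    (i j : ℤ) (hij : WS (cF i j) w ≠ 0) (z : ℝ × ℝ) 
    (h1 : h * i ≤ z.1) (h2 : z.1 ≤ h * (i + 1))
    (h3 : h * j ≤ z.2) (h4 : z.2 ≤ h * (j + 1)) : z ∈ A := by
  by_contra hz
  set F0 : Set (ℝ × ℝ) := {z | z ∉ A ∧ NN w z ≠ 0} with hF0
  have hzF : z ∈ F0 := ⟨hz, by rwa [← NN_sq hh w z hz i j h1 h2 h3 h4]⟩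
  have hloc : ∀ z ∉ A, ∀ᶠ y in 𝓝 z, y ∉ A → NN w y = NN w z := by
    intro z hz
    have e1 := (continuous_fst.tendsto z).eventually (floor_near h hh z.1)
    have e2 := (continuous_snd.tendsto z).eventually (floor_near h hh z.2)
    filter_upwards [e1, e2] with y e1 e2 hy
    exact NN_sq hh w z hz _ _ e1.1 e1.2 e2.1 e2.2
  have hclosed : IsClosed F0 := by
    rw [← isOpen_compl_iff, isOpen_iff_eventually]
    intro y hy
    by_cases hyA : y ∈ A
    · filter_upwards [hA.mem_nhds hyA] with x hx hx'
      exact hx'.1 hx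
    · have hy0 : NN w y = 0 := by by_contra hne; exact hy ⟨hyA, hne⟩
      filter_upwards [hloc y hyA] with x hx hx'
      exact hx'.2 ((hx hx'.1).trans hy0)
  have hopen : IsOpen (A ∪ F0) := by
    rw [isOpen_iff_eventually]
    rintro y (hy | hy)
    · filter_upwards [hA.mem_nhds hy] with x hx using Or.inl hx
    · filter_upwards [hloc y hy.1] with x hx
      by_cases hxA : x ∈ A
      · exact Or.inl hxA
      · right; exact ⟨hxA, by rw [hx hxA]; exact hy.2⟩
  have hbd : Bornology.IsBounded F0 := by
    obtain ⟨R, hR⟩ := hAb.exists_norm_le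
    set N : ℤ := ⌈R / h⌉ + 1
    have hRN : R < h * N := by
      have : R / h < N := by
        have := Int.le_ceil (R / h); simp only [N]; push_cast; linarith
      rw [div_lt_iff₀ hh] at this; linarith
    have hNb : ∀ P : GV A h, -N ≤ P.1.1 ∧ P.1.1 ≤ N ∧ -N ≤ P.1.2 ∧ P.1.2 ≤ N := by
      intro P
      have := hR _ P.2
      rw [Prod.norm_def, sup_le_iff, Real.norm_eq_abs, Real.norm_eq_abs, abs_le, abs_le] at this
      simp only [gpt] at this
      have conv : ∀ n m : ℤ, h * n < h * m → n ≤ m := by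
        intro n m hnm
        have : (n : ℝ) < m := lt_of_mul_lt_mul_left hnm hh.le
        exact_mod_cast this.le
      refine ⟨conv _ _ ?_, conv _ _ ?_, conv _ _ ?_, conv _ _ ?_⟩ <;> push_cast <;> linarith
    rw [isBounded_iff_forall_norm_le]
    refine ⟨h * (N + 2), fun y hy => ?_⟩
    by_contra hlt
    apply hy.2
    apply F_far N hNb
    by_contra hcon
    push Not at hcon
    apply hlt
    have a1 : (⌊y.1 / h⌋ : ℝ) ≤ y.1 / h := Int.floor_le _
    have a2 : y.1 / h < ⌊y.1 / h⌋ + 1 := Int.lt_floor_add_one _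
    have b1 : (⌊y.2 / h⌋ : ℝ) ≤ y.2 / h := Int.floor_le _
    have b2 : y.2 / h < ⌊y.2 / h⌋ + 1 := Int.lt_floor_add_one _
    obtain ⟨c1, c2, c3, c4⟩ := hcon
    have c1' : (-N - 1 : ℝ) ≤ ⌊y.1 / h⌋ := by exact_mod_cast c1
    have c2' : (⌊y.1 / h⌋ : ℝ) ≤ N := by exact_mod_cast c2
    have c3' : (-N - 1 : ℝ) ≤ ⌊y.2 / h⌋ := by exact_mod_cast c3
    have c4' : (⌊y.2 / h⌋ : ℝ) ≤ N := by exact_mod_cast c4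
    have f1 : -(N+2) ≤ y.1 / h := by linarith
    have f2 : y.1 / h ≤ (N+2) := by linarith
    have f3 : -(N+2) ≤ y.2 / h := by linarith
    have f4 : y.2 / h ≤ (N+2) := by linarith
    rw [le_div_iff₀ hh] at f1 f3
    rw [div_le_iff₀ hh] at f2 f4
    rw [Prod.norm_def, sup_le_iff, Real.norm_eq_abs, Real.norm_eq_abs, abs_le, abs_le]
    refine ⟨⟨?_, ?_⟩, ?_, ?_⟩ <;> linarith
  have hemp := hN F0 (Metric.isCompact_of_isClosed_isBounded hclosed hbd)
    (Set.disjoint_left.2 fun x hx => hx.1) hopen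
  rw [hemp] at hzF
  exact hzF


def lexle (P Q : ℤ × ℤ) : Prop := P.2 < Q.2 ∨ (P.2 = Q.2 ∧ P.1 ≤ Q.1)

lemma exists_lexmax {α : Type*} (s : Finset α) (f : α → ℤ × ℤ) (hs : s.Nonempty) :
    ∃ v ∈ s, ∀ x ∈ s, lexle (f x) (f v) := by
  obtain ⟨v, hv, hm⟩ := s.exists_max_image (fun x => toLex ((f x).2, (f x).1)) hs
  refine ⟨v, hv, fun x hx => ?_⟩
  have := hm x hx
  rw [Prod.Lex.toLex_le_toLex] at this
  exact this

lemma WS_zero_of_lex {A : Set (ℝ × ℝ)} {h : ℝ} (v : GV A h) {P Q : GV A h}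
    (r : (GG A h).Walk P Q) (h1 : ∀ x ∈ r.support, lexle x.1 v.1) (h2 : v ∉ r.support) :
    WS (cF (v.1.1 - 1) (v.1.2 - 1)) r = 0 := by
  induction r with
  | nil => rfl
  | @cons P R Q hd r ih =>
    have hR : R ∈ r.support := r.start_mem_support
    simp only [SimpleGraph.Walk.support_cons, List.mem_cons, not_or] at h1 h2
    rw [WS, ih (fun x hx => h1 x (Or.inr hx)) h2.2, add_zero]
    have e1 := h1 P (Or.inl rfl)
    have e2 := h1 R (Or.inr hR)
    have n1 : ¬ (v.1.1 = P.1.1 ∧ v.1.2 = P.1.2) := fun hh => h2.1 (Subtype.ext (Prod.ext hh.1 hh.2))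
    have n2 : ¬ (v.1.1 = R.1.1 ∧ v.1.2 = R.1.2) := fun hh => by
      have : v = R := Subtype.ext (Prod.ext hh.1 hh.2)
      exact h2.2 (this ▸ hR)
    simp only [lexle] at e1 e2
    simp only [cF]
    split_ifs <;> omega

lemma gpt_sq_mem (h : ℝ) (hh : 0 < h) (i j : ℤ) (P : ℤ × ℤ) (h1 : i ≤ P.1) (h2 : P.1 ≤ i + 1)
    (h3 : j ≤ P.2) (h4 : P.2 ≤ j + 1) :
    gpt h P ∈ Icc (h * i) (h * (i + 1)) ×ˢ Icc (h * j) (h * (j + 1)) := by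
  have a1 : (i : ℝ) ≤ P.1 := by exact_mod_cast h1
  have a2 : (P.1 : ℝ) ≤ i + 1 := by exact_mod_cast h2
  have a3 : (j : ℝ) ≤ P.2 := by exact_mod_cast h3
  have a4 : (P.2 : ℝ) ≤ j + 1 := by exact_mod_cast h4
  simp only [gpt, Set.mem_prod, Set.mem_Icc]
  exact ⟨⟨by gcongr, by gcongr⟩, by gcongr, by gcongr⟩

lemma TW_closed {A : Set (ℝ × ℝ)} (hA : IsOpen A) (hAb : Bornology.IsBounded A)
    (hN : NoHole A) {h : ℝ} (hh : 0 < h) : ∀ (n : ℕ) (P : GV A h) (w : (GG A h).Walk P P),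
    w.length = n → TW w = Path.Homotopic.Quotient.refl _ := by
  obtain ⟨N, hNb⟩ : ∃ N : ℤ, ∀ P : GV A h, -N ≤ P.1.1 ∧ -N ≤ P.1.2 := by
    obtain ⟨R, hR⟩ := hAb.exists_norm_le
    set N : ℤ := ⌈R / h⌉ + 1
    have hRN : R < h * N := by
      have : R / h < N := by
        have := Int.le_ceil (R / h); simp only [N]; push_cast; linarith
      rw [div_lt_iff₀ hh] at this; linarith
    refine ⟨N, fun P => ?_⟩
    have := hR _ P.2
    rw [Prod.norm_def, sup_le_iff, Real.norm_eq_abs, Real.norm_eq_abs, abs_le, abs_le] at this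
    simp only [gpt] at this
    have conv : ∀ n m : ℤ, h * n < h * m → n ≤ m := by
      intro n m hnm
      have : (n : ℝ) < m := lt_of_mul_lt_mul_left hnm hh.le
      exact_mod_cast this.le
    refine ⟨conv _ _ ?_, conv _ _ ?_⟩ <;> push_cast <;> linarith
  set wt : ℤ × ℤ → ℤ × ℤ → ℤ := fun P _ => P.1 + P.2 + 2 * N with hwt
  have wt_nonneg : ∀ {P Q : GV A h} (w : (GG A h).Walk P Q), 0 ≤ WS wt w := by
    intro P Q w
    induction w with
    | nil => exact le_rfl
    | @cons P R Q hd w ih =>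
      have := hNb P
      simp only [WS, hwt] at ih ⊢
      linarith [this.1, this.2]
  intro n
  induction n using Nat.strong_induction_on with
  | _ n IH =>
  suffices H : ∀ (m : ℕ) (P : GV A h) (w : (GG A h).Walk P P), w.length = n →
      (WS wt w).toNat = m → TW w = Path.Homotopic.Quotient.refl _ from
    fun P w hw => H _ P w hw rfl
  intro m
  induction m using Nat.strong_induction_on with
  | _ m IH2 =>
  intro P w hw hm
  rcases Nat.eq_zero_or_pos n with hn0 | hn0
  · have : w.length = 0 := hw.trans hn0
    cases w with
    | nil => rfl
    | cons hd w => simp at this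
  obtain ⟨v, hv, hmax⟩ := exists_lexmax w.support.toFinset (fun x : GV A h => x.1)
    ⟨P, by simp⟩
  rw [List.mem_toFinset] at hv
  have hmax' : ∀ x ∈ w.support, lexle x.1 v.1 := fun x hx => hmax x (List.mem_toFinset.2 hx)
  clear hmax
  set a := w.takeUntil v hv with ha
  set b := w.dropUntil v hv with hb
  have hab : a.append b = w := w.take_spec hv
  rw [← hab]
  apply TW_conj
  obtain ⟨w', hw'⟩ : ∃ w' : (GG A h).Walk v v, w' = b.append a := ⟨_, rfl⟩
  rw [← hw']
  have hlen : w'.length = n := by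
    rw [hw', SimpleGraph.Walk.length_append, ← hw, ← hab, SimpleGraph.Walk.length_append, add_comm]
  have hms : (WS wt w').toNat = m := by
    rw [hw', WS_append, ← hm, ← hab, WS_append, add_comm]
  have hsup : ∀ x ∈ w'.support, lexle x.1 v.1 := by
    intro x hx
    apply hmax'
    rw [← hab]
    rw [hw', SimpleGraph.Walk.mem_support_append_iff] at hx
    rw [SimpleGraph.Walk.mem_support_append_iff]
    exact hx.symm
  clear_value a b
  clear hw' hab ha hb hm hmax' hw hv a b w
  cases w' with
  | nil => rfl
  | @cons _ d _ hd p =>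
  cases p with
  | nil => exact absurd hd (GG A h).irrefl
  | @cons _ e _ he p' =>
  obtain ⟨l, r, hl, hr⟩ := SimpleGraph.Walk.exists_cons_eq_concat he p'
  rw [hr] at hlen hms hsup ⊢
  clear hr p' he e
  rw [SimpleGraph.Walk.concat_eq_append] at *
  simp only [SimpleGraph.Walk.length_cons, SimpleGraph.Walk.length_append,
    SimpleGraph.Walk.length_nil] at hlen
  have hT : TW (SimpleGraph.Walk.cons hd (r.append (SimpleGraph.Walk.cons hl SimpleGraph.Walk.nil)))
      = (sg A (gp v) (gp d) hd.2).trans ((TW r).trans (sg A (gp l) (gp v) hl.2)) := by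
    rw [TW_cons, TW_append, TW_cons, TW_nil, Path.Homotopic.Quotient.trans_refl]
  have hsup' : ∀ x ∈ r.support, lexle x.1 v.1 := by
    intro x hx
    apply hsup
    simp only [SimpleGraph.Walk.support_cons, List.mem_cons,
      SimpleGraph.Walk.mem_support_append_iff]
    tauto
  by_cases hvr : v ∈ r.support
  · set r1 := r.takeUntil v hvr
    set r2 := r.dropUntil v hvr
    have h12 : r1.append r2 = r := r.take_spec hvr
    have hl12 : r1.length + r2.length = r.length := by
      rw [← h12, SimpleGraph.Walk.length_append]
    have t1 := IH (r1.length + 1) (by omega) v (SimpleGraph.Walk.cons hd r1) (by simp)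
    have t2 := IH (r2.length + 1) (by omega) v
      (r2.append (SimpleGraph.Walk.cons hl SimpleGraph.Walk.nil)) (by simp)
    have : SimpleGraph.Walk.cons hd (r.append (SimpleGraph.Walk.cons hl SimpleGraph.Walk.nil))
      = (SimpleGraph.Walk.cons hd r1).append
        (r2.append (SimpleGraph.Walk.cons hl SimpleGraph.Walk.nil)) := by
      rw [← h12, SimpleGraph.Walk.cons_append, SimpleGraph.Walk.append_assoc]
    rw [this, TW_append, t1, t2, Path.Homotopic.Quotient.trans_refl]
  have hdl := hsup' d r.start_mem_support
  have hll := hsup' l r.end_mem_support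
  by_cases hld : l = d
  · subst hld
    rw [hT, IH r.length (by omega) l r rfl, Path.Homotopic.Quotient.refl_trans]
    exact sg_cancel _ _ _ _ _
  have hnb1 := hd.1
  have hnb2 := hl.1
  have hld' : ¬ (l.1.1 = d.1.1 ∧ l.1.2 = d.1.2) := fun hh => hld (Subtype.ext (Prod.ext hh.1 hh.2))
  simp only [lexle, unitNb] at hdl hll hnb1 hnb2
  set i := v.1.1 - 1 with hi
  set j := v.1.2 - 1 with hj
  have hF : WS (cF i j) (SimpleGraph.Walk.cons hd
      (r.append (SimpleGraph.Walk.cons hl SimpleGraph.Walk.nil))) ≠ 0 := by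
    have hr0 : WS (cF i j) r = 0 := WS_zero_of_lex v r hsup' hvr
    simp only [WS, WS_append, hr0]
    simp only [cF]
    split_ifs <;> omega
  set C : Set (ℝ × ℝ) := Icc (h * i) (h * (i + 1)) ×ˢ Icc (h * j) (h * (j + 1)) with hC
  have hCc : Convex ℝ C := (convex_Icc _ _).prod (convex_Icc _ _)
  have hCA : C ⊆ A := by
    rintro z ⟨⟨h1, h2⟩, h3, h4⟩
    exact square_sub hA hAb hN hh _ i j hF z h1 h2 h3 h4
  have hv'C : gpt h (i, j) ∈ C := gpt_sq_mem h hh i j _ (by simp) (by simp) (by simp) (by simp)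
  set v' : GV A h := ⟨(i, j), hCA hv'C⟩ with hv'
  have hvC : gpt h v.1 ∈ C := gpt_sq_mem h hh i j _ (by omega) (by omega) (by omega) (by omega)
  have hdC : gpt h d.1 ∈ C := gpt_sq_mem h hh i j _ (by omega) (by omega) (by omega) (by omega)
  have hlC : gpt h l.1 ∈ C := gpt_sq_mem h hh i j _ (by omega) (by omega) (by omega) (by omega)
  have hseg : ∀ x ∈ C, ∀ y ∈ C, segment ℝ x y ⊆ A := fun x hx y hy =>
    (hCc.segment_subset hx hy).trans hCA
  have hd' : (GG A h).Adj v' d := by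
    refine ⟨?_, hseg _ hv'C _ hdC⟩
    simp only [unitNb, hv']; omega
  have hl' : (GG A h).Adj l v' := by
    refine ⟨?_, hseg _ hlC _ hv'C⟩
    simp only [unitNb, hv']; omega
  have t := IH2 _ (by
      rw [← hms]
      refine (Int.toNat_lt_toNat (n := WS wt (SimpleGraph.Walk.cons hd' (r.append (SimpleGraph.Walk.cons hl' SimpleGraph.Walk.nil)))) ?_).2 ?_
      · have p0 := wt_nonneg r
        have p1 := hNb v'
        have p2 := hNb l
        simp only [WS, WS_append, hwt, hv'] at p0 p1 p2 ⊢
        omega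
      · simp only [WS, WS_append, hwt, hv']
        omega) v'
    (SimpleGraph.Walk.cons hd' (r.append (SimpleGraph.Walk.cons hl' SimpleGraph.Walk.nil)))
    (by simp; omega) rfl
  have hT' : TW (SimpleGraph.Walk.cons hd' (r.append (SimpleGraph.Walk.cons hl' SimpleGraph.Walk.nil)))
      = (sg A (gp v') (gp d) hd'.2).trans ((TW r).trans (sg A (gp l) (gp v') hl'.2)) := by
    rw [TW_cons, TW_append, TW_cons, TW_nil, Path.Homotopic.Quotient.trans_refl]
  rw [hT'] at t
  have e1 := (sg_trans A C hCc hCA (gp v) (gp v') (gp d) hvC hv'C hdC (hseg _ hvC _ hv'C) hd'.2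
    hd.2).symm
  have e2 := (sg_trans A C hCc hCA (gp l) (gp v') (gp v) hlC hv'C hvC hl'.2 (hseg _ hv'C _ hvC)
    hl.2).symm
  have this : ∀ {X : Type} [TopologicalSpace X] {x1 x2 x3 x4 x5 x6 : X} (p1 : PHQ x1 x2) (p2 : PHQ x2 x3)
      (p3 : PHQ x3 x4) (p4 : PHQ x4 x5) (p5 : PHQ x5 x6),
      (p1.trans p2).trans (p3.trans (p4.trans p5)) = p1.trans ((p2.trans (p3.trans p4)).trans p5) := by
    intros; simp only [Path.Homotopic.Quotient.trans_assoc]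
  have main : ∀ (s1 : PHQ (gp v) (gp d)) (s2 : PHQ (gp l) (gp v)),
      s1 = (sg A (gp v) (gp v') (hseg _ hvC _ hv'C)).trans (sg A (gp v') (gp d) hd'.2) →
      s2 = (sg A (gp l) (gp v') hl'.2).trans (sg A (gp v') (gp v) (hseg _ hv'C _ hvC)) →
      s1.trans ((TW r).trans s2) = Path.Homotopic.Quotient.refl _ := by
    rintro _ _ rfl rfl
    rw [this, t, Path.Homotopic.Quotient.refl_trans]
    exact sg_cancel _ _ _ _ _
  exact hT.trans (main _ _ e1 e2)


def vtx (h : ℝ) (z : ℝ × ℝ) : ℤ × ℤ := (⌊z.1 / h⌋, ⌊z.2 / h⌋)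

lemma walk_one {A : Set (ℝ × ℝ)} {h : ℝ} (P Q : GV A h) (hPQ : P.1 = Q.1 ∨ unitNb P.1 Q.1)
    (hs : segment ℝ (gpt h P.1) (gpt h Q.1) ⊆ A) :
    ∃ w : (GG A h).Walk P Q, TW w = sg A (gp P) (gp Q) hs := by
  rcases hPQ with hPQ | hPQ
  · have : P = Q := Subtype.ext hPQ
    subst this
    exact ⟨.nil, (sg_self A (gp P) hs).symm⟩
  · have hadj : (GG A h).Adj P Q := ⟨hPQ, hs⟩
    exact ⟨.cons hadj .nil, Path.Homotopic.Quotient.trans_refl _⟩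

lemma floor_bd (h : ℝ) (hh : 0 < h) (x : ℝ) : x - h < h * ⌊x / h⌋ ∧ h * ⌊x / h⌋ ≤ x := by
  have a1 : (⌊x / h⌋ : ℝ) ≤ x / h := Int.floor_le _
  have a2 : x / h < ⌊x / h⌋ + 1 := Int.lt_floor_add_one _
  rw [le_div_iff₀ hh] at a1
  rw [div_lt_iff₀ hh] at a2
  constructor <;> linarith

lemma floor_close (h : ℝ) (hh : 0 < h) (x y : ℝ) (hxy : |x - y| < h) :
    ⌊x / h⌋ ≤ ⌊y / h⌋ + 1 ∧ ⌊y / h⌋ ≤ ⌊x / h⌋ + 1 := by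
  have hx := floor_bd h hh x
  have hy := floor_bd h hh y
  rw [abs_lt] at hxy
  have conv : ∀ n m : ℤ, h * n < h * m → n < m := by
    intro n m hnm
    have : (n : ℝ) < m := lt_of_mul_lt_mul_left hnm hh.le
    exact_mod_cast this
  constructor
  · have := conv ⌊x / h⌋ (⌊y / h⌋ + 2) (by push_cast; linarith)
    omega
  · have := conv ⌊y / h⌋ (⌊x / h⌋ + 2) (by push_cast; linarith)
    omega

lemma walk_step {A : Set (ℝ × ℝ)} {h : ℝ} (hh : 0 < h) (z z' : ℝ × ℝ) (hzz : dist z z' < h)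
    (hz : Metric.ball z (4 * h) ⊆ A) (hP : gpt h (vtx h z) ∈ A) (hQ : gpt h (vtx h z') ∈ A)
    (hs : segment ℝ (gpt h (vtx h z)) (gpt h (vtx h z')) ⊆ A) :
    gpt h (vtx h z) ∈ Metric.ball z (4 * h) ∧ gpt h (vtx h z') ∈ Metric.ball z (4 * h) ∧
    ∃ w : (GG A h).Walk ⟨vtx h z, hP⟩ ⟨vtx h z', hQ⟩,
      TW w = sg A (gp ⟨vtx h z, hP⟩) (gp ⟨vtx h z', hQ⟩) hs := by
  rw [Prod.dist_eq, max_lt_iff, Real.dist_eq, Real.dist_eq] at hzz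
  obtain ⟨d1, d2⟩ := hzz
  have f1 := floor_close h hh _ _ d1
  have f2 := floor_close h hh _ _ d2
  have p1 := floor_bd h hh z.1
  have p2 := floor_bd h hh z.2
  have q1 := floor_bd h hh z'.1
  have q2 := floor_bd h hh z'.2
  rw [abs_lt] at d1 d2
  have mem : ∀ a b : ℤ, |h * a - z.1| < 4 * h → |h * b - z.2| < 4 * h →
      gpt h (a, b) ∈ Metric.ball z (4 * h) := by
    intro a b ha hb
    rw [Metric.mem_ball, Prod.dist_eq, max_lt_iff, Real.dist_eq, Real.dist_eq]
    exact ⟨ha, hb⟩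
  have m1 : gpt h (vtx h z) ∈ Metric.ball z (4 * h) := by
    apply mem <;> rw [abs_lt] <;> constructor <;> linarith
  have m2 : gpt h (vtx h z') ∈ Metric.ball z (4 * h) := by
    apply mem <;> rw [abs_lt] <;> constructor <;> linarith
  have m3 : gpt h ((vtx h z').1, (vtx h z).2) ∈ Metric.ball z (4 * h) := by
    apply mem <;> rw [abs_lt] <;> constructor <;> simp only [vtx] <;> linarith
  refine ⟨m1, m2, ?_⟩
  have hC := convex_ball z (4 * h)
  have hseg : ∀ x ∈ Metric.ball z (4 * h), ∀ y ∈ Metric.ball z (4 * h), segment ℝ x y ⊆ A :=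
    fun x hx y hy => (hC.segment_subset hx hy).trans hz
  obtain ⟨w1, hw1⟩ := walk_one (A := A) (h := h) ⟨vtx h z, hP⟩ ⟨((vtx h z').1, (vtx h z).2), hz m3⟩
    (by simp only [vtx, unitNb, Prod.mk.injEq]; simp; omega) (hseg _ m1 _ m3)
  obtain ⟨w2, hw2⟩ := walk_one (A := A) (h := h) ⟨((vtx h z').1, (vtx h z).2), hz m3⟩ ⟨vtx h z', hQ⟩ 
    (by simp only [vtx, unitNb, Prod.mk.injEq]; simp; omega) (hseg _ m3 _ m2)
  refine ⟨w1.append w2, ?_⟩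
  rw [TW_append, hw1, hw2]
  exact sg_trans A _ hC hz _ _ _ m1 m3 m2 _ _ _

def RR (A : Set (ℝ × ℝ)) (h : ℝ) {x y : ↥A} (c : PHQ x y) : Prop :=
  ∃ (hP : gpt h (vtx h x) ∈ A) (hQ : gpt h (vtx h y) ∈ A)
    (h1 : segment ℝ (x : ℝ × ℝ) (gpt h (vtx h x)) ⊆ A)
    (h2 : segment ℝ (gpt h (vtx h y)) (y : ℝ × ℝ) ⊆ A)
    (w : (GG A h).Walk ⟨vtx h x, hP⟩ ⟨vtx h y, hQ⟩),
    c = (sg A x (gp ⟨vtx h x, hP⟩) h1).trans ((TW w).trans (sg A (gp ⟨vtx h y, hQ⟩) y h2))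

lemma RR_trans {A : Set (ℝ × ℝ)} {h : ℝ} {x y z : ↥A} (c : PHQ x y) (d : PHQ y z)
    (hc : RR A h c) (hd : RR A h d) : RR A h (c.trans d) := by
  obtain ⟨hP, hQ, h1, h2, w, rfl⟩ := hc
  obtain ⟨hP', hQ', h1', h2', w', rfl⟩ := hd
  refine ⟨hP, hQ', h1, h2', w.append w', ?_⟩
  rw [TW_append]
  have this : ∀ {X : Type} [TopologicalSpace X] {x1 x2 x3 x4 x5 x6 : X} (p1 : PHQ x1 x2) (p2 : PHQ x2 x3)
      (p3 : PHQ x3 x4) (p3' : PHQ x4 x3) (p4 : PHQ x3 x5) (p5 : PHQ x5 x6), p3.trans p3' = .refl _ →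
      (p1.trans (p2.trans p3)).trans (p3'.trans (p4.trans p5)) = p1.trans ((p2.trans p4).trans p5) := by
    intro X _ x1 x2 x3 x4 x5 x6 p1 p2 p3 p3' p4 p5 h
    have : (p1.trans (p2.trans p3)).trans (p3'.trans (p4.trans p5)) =
      p1.trans (p2.trans ((p3.trans p3').trans (p4.trans p5))) := by
      simp only [Path.Homotopic.Quotient.trans_assoc]
    rw [this, h, Path.Homotopic.Quotient.refl_trans]
    simp only [Path.Homotopic.Quotient.trans_assoc]
  apply this
  exact sg_cancel _ _ _ _ _

lemma RR_small {A : Set (ℝ × ℝ)} {h : ℝ} (hh : 0 < h) {x y : ↥A} 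
    (hx : Metric.ball (x : ℝ × ℝ) (4 * h) ⊆ A) (p : Path x y)
    (hp : ∀ t, dist (x : ℝ × ℝ) (p t) < h) : RR A h (Path.Homotopic.Quotient.mk p) := by
  have hzz : dist (x : ℝ × ℝ) y < h := by simpa using hp 1
  have hC := convex_ball (x : ℝ × ℝ) (4 * h)
  have hpC : ∀ t, (p t : ℝ × ℝ) ∈ Metric.ball (x : ℝ × ℝ) (4 * h) := by
    intro t; rw [Metric.mem_ball, dist_comm]; linarith [hp t]
  have hxC : (x : ℝ × ℝ) ∈ Metric.ball (x : ℝ × ℝ) (4 * h) := by simpa using hpC 0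
  have hyC : (y : ℝ × ℝ) ∈ Metric.ball (x : ℝ × ℝ) (4 * h) := by simpa using hpC 1
  have p1 := floor_bd h hh (x : ℝ × ℝ).1
  have p2 := floor_bd h hh (x : ℝ × ℝ).2
  have q1 := floor_bd h hh (y : ℝ × ℝ).1
  have q2 := floor_bd h hh (y : ℝ × ℝ).2
  have m : gpt h (vtx h x) ∈ Metric.ball (x : ℝ × ℝ) (4 * h) ∧
     gpt h (vtx h y) ∈ Metric.ball (x : ℝ × ℝ) (4 * h) := by
    rw [Prod.dist_eq, max_lt_iff, Real.dist_eq, Real.dist_eq, abs_lt, abs_lt] at hzz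
    constructor <;> rw [Metric.mem_ball, Prod.dist_eq, max_lt_iff, Real.dist_eq, Real.dist_eq,
      abs_lt, abs_lt] <;> simp only [gpt, vtx] <;> refine ⟨⟨?_, ?_⟩, ?_, ?_⟩ <;> linarith
  have hseg : ∀ a ∈ Metric.ball (x : ℝ × ℝ) (4 * h), ∀ b ∈ Metric.ball (x : ℝ × ℝ) (4 * h),
    segment ℝ a b ⊆ A := fun a ha b hb => (hC.segment_subset ha hb).trans hx
  obtain ⟨m1, m2, w, hw⟩ := walk_step hh x y hzz hx (hx m.1) (hx m.2) (hseg _ m.1 _ m.2)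
  refine ⟨hx m.1, hx m.2, hseg _ hxC _ m1, hseg _ m2 _ hyC, w, ?_⟩
  rw [hw, mk_eq_sg A _ hC hx x y p hpC (hseg _ hxC _ hyC)]
  have e1 := sg_trans A _ hC hx (gp ⟨vtx h x, hx m.1⟩) (gp ⟨vtx h y, hx m.2⟩) y m1 m2 hyC
    (hseg _ m1 _ m2) (hseg _ m2 _ hyC) (hseg _ m1 _ hyC)
  have e2 := sg_trans A _ hC hx x (gp ⟨vtx h x, hx m.1⟩) y hxC m1 hyC
    (hseg _ hxC _ m1) (hseg _ m1 _ hyC) (hseg _ hxC _ hyC)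
  exact e2.symm.trans (congrArg _ e1.symm)

lemma RR_path {A : Set (ℝ × ℝ)} {h : ℝ} (hh : 0 < h) {x y : ↥A} (γ : Path x y)
    (hγ : ∀ t, Metric.ball (γ t : ℝ × ℝ) (4 * h) ⊆ A) : RR A h (Path.Homotopic.Quotient.mk γ) := by
  have hloc : ∀ t : unitInterval, ∀ᶠ s in 𝓝 t,
      RR A h (Path.Homotopic.Quotient.mk (γ.subpath t s)) ∧
      RR A h (Path.Homotopic.Quotient.mk (γ.subpath s t)) := by
    intro t
    have hcont : Continuous fun s => (γ s : ℝ × ℝ) := continuous_subtype_val.comp γ.continuous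
    obtain ⟨δ, hδ, hball⟩ := Metric.continuousAt_iff.1 (hcont.continuousAt (x := t)) (h / 2) (by linarith)
    filter_upwards [Metric.ball_mem_nhds t hδ] with s hs
    have hsub : ∀ r ∈ uIcc t s, dist (γ r : ℝ × ℝ) (γ t) < h / 2 := by
      intro r hr
      apply hball
      rw [Metric.mem_ball] at hs
      refine lt_of_le_of_lt ?_ hs
      rw [Subtype.dist_eq, Subtype.dist_eq, Real.dist_eq, Real.dist_eq]
      rw [Set.mem_uIcc] at hr
      rcases hr with hr | hr
      · have a1 : (t : ℝ) ≤ r := hr.1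
        have a2 : (r : ℝ) ≤ s := hr.2
        rw [abs_of_nonneg (by linarith), abs_of_nonneg (by linarith)]; linarith
      · have a1 : (s : ℝ) ≤ r := hr.1
        have a2 : (r : ℝ) ≤ t := hr.2
        rw [abs_of_nonpos (by linarith), abs_of_nonpos (by linarith)]; linarith
    constructor
    · apply RR_small hh (hγ t)
      intro r
      have : γ.subpath t s r ∈ γ '' (uIcc t s) := by rw [← Path.range_subpath]; exact ⟨r, rfl⟩
      obtain ⟨r', hr', he⟩ := this
      rw [← he, dist_comm]; linarith [hsub r' hr']
    · apply RR_small hh (hγ s)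
      intro r
      have : γ.subpath s t r ∈ γ '' (uIcc s t) := by rw [← Path.range_subpath]; exact ⟨r, rfl⟩
      obtain ⟨r', hr', he⟩ := this
      rw [uIcc_comm] at hr'
      rw [← he]
      have h1 := hsub r' hr'
      have h2 := hsub s right_mem_uIcc
      have h3 := dist_triangle_right (γ s : ℝ × ℝ) (γ r') (γ t)
      linarith
  set S : Set unitInterval := {t | RR A h (Path.Homotopic.Quotient.mk (γ.subpath 0 t))} with hS
  have hstep : ∀ s t : unitInterval, RR A h (Path.Homotopic.Quotient.mk (γ.subpath s t)) →
      s ∈ S → t ∈ S := by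
    intro s t h1 h2
    have := RR_trans _ _ h2 h1
    rw [← Path.Homotopic.Quotient.mk_trans,
      Path.Homotopic.Quotient.eq.2 ⟨Path.Homotopy.subpathTransSubpath γ 0 s t⟩] at this
    exact this
  have hclopen : IsClopen S := by
    constructor
    · rw [← isOpen_compl_iff, isOpen_iff_eventually]
      intro t ht
      filter_upwards [hloc t] with s hs hsS
      exact ht (hstep s t hs.2 hsS)
    · rw [isOpen_iff_eventually]
      intro t ht
      filter_upwards [hloc t] with s hs
      exact hstep t s hs.1 ht
  have h0 : (0 : unitInterval) ∈ S := (hloc 0).self_of_nhds.1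
  have huniv : S = univ := (isClopen_iff.1 hclopen).resolve_left (by
    intro he; rw [he] at h0; exact h0)
  have h1 : (1 : unitInterval) ∈ S := huniv ▸ mem_univ _
  have h1' : RR A h (Path.Homotopic.Quotient.mk (γ.subpath 0 1)) := h1
  rw [Path.subpath_zero_one] at h1'
  have gen : ∀ (a b : ↥A) (ha : a = x) (hb : b = y),
      RR A h (Path.Homotopic.Quotient.mk (γ.cast ha hb)) → RR A h (Path.Homotopic.Quotient.mk γ) := by
    rintro a b rfl rfl h; exact h
  exact gen _ _ _ _ h1'

lemma simplyConnected_of_noHole (A : Set (ℝ × ℝ)) (hA : IsOpen A) (hAb : Bornology.IsBounded A)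
    (hAc : IsConnected A) (hN : NoHole A) : SimplyConnectedSpace ↥A := by
  rw [simply_connected_iff_loops_nullhomotopic]
  refine ⟨isPathConnected_iff_pathConnectedSpace.1 (hA.isConnected_iff_isPathConnected.1 hAc), ?_⟩
  intro x γ
  have hK : IsCompact (Set.range fun t => (γ t : ℝ × ℝ)) :=
    isCompact_range (continuous_subtype_val.comp γ.continuous)
  obtain ⟨ρ, hρ, hsub⟩ := hK.exists_thickening_subset_open hA (by
    rintro _ ⟨t, rfl⟩; exact (γ t).2)
  set h := ρ / 4 with hh
  have hpos : 0 < h := by positivity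
  have := RR_path hpos γ (by
    intro t z hz
    apply hsub
    rw [Metric.mem_thickening_iff]
    exact ⟨_, ⟨t, rfl⟩, by rw [Metric.mem_ball] at hz; rw [hh] at hz; linarith⟩)
  obtain ⟨hP, hQ, h1, h2, w, hw⟩ := this
  rw [← Path.Homotopic.Quotient.eq, hw, TW_closed hA hAb hN hpos _ _ w rfl,
    Path.Homotopic.Quotient.refl_trans, Path.Homotopic.Quotient.mk_refl]
  exact sg_cancel _ _ _ _ _


def sqn (a : ℝ × ℝ) : ℝ := a.1 ^ 2 + a.2 ^ 2

lemma sqn_nonneg (a : ℝ × ℝ) : 0 ≤ sqn a := by unfold sqn; positivity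

lemma KH_self (k : ℝ) (x a : ℝ × ℝ) : KHform k x a a =
    (k ^ 2 + x.1 ^ 2 + x.2 ^ 2)⁻¹ * (k ^ 2 * sqn a + (x.2 * a.1 - x.1 * a.2) ^ 2) := by
  unfold KHform sqn; ring

lemma KH_den_pos {k : ℝ} (hk : 0 < k) (x : ℝ × ℝ) : 0 < k ^ 2 + x.1 ^ 2 + x.2 ^ 2 := by positivity

lemma KH_nonneg {k : ℝ} (x a : ℝ × ℝ) : 0 ≤ KHform k x a a := by
  rw [KH_self]
  have := sqn_nonneg a
  positivity

lemma KH_le {k : ℝ} (hk : 0 < k) (x a : ℝ × ℝ) : KHform k x a a ≤ sqn a := by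
  rw [KH_self, inv_mul_le_iff₀ (KH_den_pos hk x)]
  unfold sqn
  nlinarith [sq_nonneg (x.1 * a.1 + x.2 * a.2)]

lemma KH_ge {k : ℝ} (hk : 0 < k) (x a : ℝ × ℝ) (R : ℝ) (hR : x.1 ^ 2 + x.2 ^ 2 ≤ R) :
    k ^ 2 / (k ^ 2 + R) * sqn a ≤ KHform k x a a := by
  rw [KH_self, div_eq_inv_mul, mul_assoc]
  have h1 := KH_den_pos hk x
  have h2 : (k ^ 2 + R)⁻¹ ≤ (k ^ 2 + x.1 ^ 2 + x.2 ^ 2)⁻¹ := by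
    apply inv_anti₀ h1; linarith
  have := sqn_nonneg a
  apply mul_le_mul h2 _ (by positivity) (by positivity)
  nlinarith [sq_nonneg (x.2 * a.1 - x.1 * a.2)]

lemma KH_symm (k : ℝ) (x a b : ℝ × ℝ) : KHform k x a b = KHform k x b a := by
  unfold KHform; ring

lemma KH_add_left (k : ℝ) (x a b c : ℝ × ℝ) :
    KHform k x (a + b) c = KHform k x a c + KHform k x b c := by
  unfold KHform; simp only [Prod.fst_add, Prod.snd_add]; ring

lemma KH_sub_left (k : ℝ) (x a b c : ℝ × ℝ) :
    KHform k x (a - b) c = KHform k x a c - KHform k x b c := by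
  unfold KHform; simp only [Prod.fst_sub, Prod.snd_sub]; ring

lemma KH_smul_left (k : ℝ) (x : ℝ × ℝ) (s : ℝ) (a c : ℝ × ℝ) :
    KHform k x (s • a) c = s * KHform k x a c := by
  unfold KHform; simp only [Prod.smul_fst, Prod.smul_snd, smul_eq_mul]; ring

lemma KH_add_right (k : ℝ) (x a b c : ℝ × ℝ) :
    KHform k x c (a + b) = KHform k x c a + KHform k x c b := by
  rw [KH_symm, KH_add_left, KH_symm k x a, KH_symm k x b]

lemma KH_sub_right (k : ℝ) (x a b c : ℝ × ℝ) :
    KHform k x c (a - b) = KHform k x c a - KHform k x c b := by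
  rw [KH_symm, KH_sub_left, KH_symm k x a, KH_symm k x b]

lemma KH_smul_right (k : ℝ) (x : ℝ × ℝ) (s : ℝ) (a c : ℝ × ℝ) :
    KHform k x c (s • a) = s * KHform k x c a := by
  rw [KH_symm, KH_smul_left, KH_symm]

lemma KH_zero_left (k : ℝ) (x a : ℝ × ℝ) : KHform k x 0 a = 0 := by simp [KHform]
lemma KH_zero_right (k : ℝ) (x a : ℝ × ℝ) : KHform k x a 0 = 0 := by simp [KHform]

/-- Cauchy-Schwarz in AM-GM form -/
lemma KH_amgm {k : ℝ} (x a b : ℝ × ℝ) (s : ℝ) (hs : 0 < s) :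
    2 * |KHform k x a b| ≤ s * KHform k x a a + s⁻¹ * KHform k x b b := by
  have h1 := KH_nonneg (k := k) x (s • a + b)
  have h2 := KH_nonneg (k := k) x (s • a - b)
  simp only [KH_add_left, KH_sub_left, KH_add_right, KH_sub_right, KH_smul_left,
    KH_smul_right, KH_symm k x b a] at h1 h2
  have h3 : s * (s * KHform k x a a + s⁻¹ * KHform k x b b) = s * (s * KHform k x a a) + KHform k x b b := by
    field_simp
  have : s * (2 * |KHform k x a b|) ≤ s * (s * KHform k x a a + s⁻¹ * KHform k x b b) := by
    rw [h3]
    rcases abs_cases (KHform k x a b) with ⟨h, _⟩ | ⟨h, _⟩ <;> rw [h] <;> nlinarith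
  exact le_of_mul_le_mul_left this hs

lemma KH_cont {k : ℝ} (hk : 0 < k) {S : Set (ℝ × ℝ)} {a b : ℝ × ℝ → ℝ × ℝ} (ha : ContinuousOn a S)
    (hb : ContinuousOn b S) : ContinuousOn (fun x => KHform k x (a x) (b x)) S := by
  unfold KHform
  have a1 : ContinuousOn (fun x => (a x).1) S := continuous_fst.comp_continuousOn ha
  have a2 : ContinuousOn (fun x => (a x).2) S := continuous_snd.comp_continuousOn ha
  have b1 : ContinuousOn (fun x => (b x).1) S := continuous_fst.comp_continuousOn hb
  have b2 : ContinuousOn (fun x => (b x).2) S := continuous_snd.comp_continuousOn hb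
  have : ContinuousOn (fun x : ℝ × ℝ => (k ^ 2 + x.1 ^ 2 + x.2 ^ 2)⁻¹) S := by
    apply ContinuousOn.inv₀ (by fun_prop)
    intro x _; exact (KH_den_pos hk x).ne'
  fun_prop

/-! cutoff -/

def th (δ t : ℝ) : ℝ := if t ≤ δ then 0 else (t - δ) ^ 2 / t
def th' (δ t : ℝ) : ℝ := 1 - (δ / max t δ) ^ 2

lemma th_hasDeriv {δ : ℝ} (hδ : 0 < δ) (t : ℝ) : HasDerivAt (th δ) (th' δ t) t := by
  rcases lt_trichotomy t δ with h | h | h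
  · have : th δ =ᶠ[𝓝 t] fun _ => 0 := by
      filter_upwards [Iio_mem_nhds h] with s hs
      simp [th, (show s ≤ δ from le_of_lt hs)]
    have e : th' δ t = 0 := by simp [th', max_eq_right h.le, hδ.ne']
    rw [e]
    exact (hasDerivAt_const t (0:ℝ)).congr_of_eventuallyEq this
  · subst h
    have e : th' t t = 0 := by simp [th', hδ.ne']
    rw [e, hasDerivAt_iff_isLittleO]
    have hb : ∀ s : ℝ, |th t s| ≤ t⁻¹ * |s - t| ^ 2 := by
      intro s
      unfold th
      split_ifs with hs
      · simp; positivity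
      · push Not at hs
        rw [abs_div, abs_pow, sq_abs, abs_of_pos (by linarith : 0 < s), div_eq_inv_mul]
        gcongr
    have h0 : th t t = 0 := by simp [th]
    refine Asymptotics.IsBigO.trans_isLittleO (g := fun s => (s - t) ^ 2) ?_ ?_
    · refine Asymptotics.IsBigO.of_bound t⁻¹ (Eventually.of_forall fun s => ?_)
      simpa [h0] using hb s
    · have : (fun s => (s - t) ^ 2) = fun s : ℝ => (s - t) * (s - t) := by ext; ring
      rw [this]
      have h1 : (fun s : ℝ => s - t) =o[𝓝 t] fun _ => (1:ℝ) := by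
        rw [Asymptotics.isLittleO_one_iff]
        have : Continuous fun s : ℝ => s - t := by fun_prop
        simpa using this.tendsto t
      simpa using h1.mul_isBigO (Asymptotics.isBigO_refl (fun s : ℝ => s - t) (𝓝 t))
  · have ht : 0 < t := by linarith
    have : th δ =ᶠ[𝓝 t] fun s => (s - δ) ^ 2 / s := by
      filter_upwards [Ioi_mem_nhds h] with s hs
      simp [th, not_le.2 (show δ < s from hs)]
    refine HasDerivAt.congr_of_eventuallyEq ?_ this
    have h1 := (((hasDerivAt_id t).sub_const δ).pow 2).div (hasDerivAt_id t) ht.ne'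
    convert! h1 using 1
    simp [th', max_eq_left h.le]
    field_simp
    ring

lemma th'_cont {δ : ℝ} (hδ : 0 < δ) : Continuous (th' δ) := by
  unfold th'
  have : Continuous fun t : ℝ => δ / max t δ := by
    apply Continuous.div continuous_const (by fun_prop)
    intro t; exact (lt_of_lt_of_le hδ (le_max_right _ _)).ne'
  fun_prop

lemma th_contDiff {δ : ℝ} (hδ : 0 < δ) : ContDiff ℝ 1 (th δ) := by
  rw [contDiff_one_iff_deriv]
  refine ⟨fun t => (th_hasDeriv hδ t).differentiableAt, ?_⟩
  have : deriv (th δ) = th' δ := by ext t; exact (th_hasDeriv hδ t).deriv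
  rw [this]; exact th'_cont hδ

lemma th'_nonneg {δ : ℝ} (hδ : 0 < δ) (t : ℝ) : 0 ≤ th' δ t := by
  unfold th'
  have h1 : δ / max t δ ≤ 1 := by
    rw [div_le_one (lt_of_lt_of_le hδ (le_max_right _ _))]; exact le_max_right _ _
  have h0 : 0 ≤ δ / max t δ := div_nonneg hδ.le (hδ.le.trans (le_max_right _ _))
  nlinarith

lemma th'_le_one {δ : ℝ} (t : ℝ) : th' δ t ≤ 1 := by
  unfold th'; nlinarith [sq_nonneg (δ / max t δ)]

lemma th'_zero {δ : ℝ} (hδ : 0 < δ) {t : ℝ} (ht : t ≤ δ) : th' δ t = 0 := by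
  simp [th', max_eq_right ht, hδ.ne']

lemma th'_pos {δ : ℝ} (hδ : 0 < δ) {t : ℝ} (ht : δ < t) : 0 < th' δ t := by
  unfold th'
  rw [max_eq_left ht.le]
  have h1 : δ / t < 1 := by rw [div_lt_one (by linarith)]; exact ht
  have h0 : 0 ≤ δ / t := div_nonneg hδ.le (by linarith)
  nlinarith

lemma th_zero {δ t : ℝ} (ht : t ≤ δ) : th δ t = 0 := by simp [th, ht]

lemma th_nonneg {δ : ℝ} (hδ : 0 < δ) (t : ℝ) : 0 ≤ th δ t := by
  unfold th; split_ifs with h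
  · exact le_rfl
  · push Not at h; have : 0 < t := by linarith
    positivity

lemma th_pos {δ : ℝ} (hδ : 0 < δ) {t : ℝ} (ht : δ < t) : 0 < th δ t := by
  unfold th; rw [if_neg (not_le.2 ht)]
  have : 0 < t := by linarith
  have : 0 < t - δ := by linarith
  positivity

lemma th_le {δ : ℝ} (hδ : 0 < δ) (t : ℝ) : th δ t ≤ pPart t := by
  unfold th pPart; split_ifs with h
  · exact le_max_right _ _
  · push Not at h; have : 0 < t := by linarith
    refine le_trans ?_ (le_max_left _ _)
    rw [div_le_iff₀ this]; nlinarith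

lemma th_ge {δ : ℝ} (hδ : 0 < δ) (t : ℝ) : t - 2 * δ ≤ th δ t := by
  unfold th; split_ifs with h
  · linarith
  · push Not at h; have : 0 < t := by linarith
    rw [le_div_iff₀ this]; nlinarith

lemma th_lip {δ : ℝ} (hδ : 0 < δ) (t : ℝ) : pPart t - th δ t ≤ 2 * δ := by
  unfold pPart
  rcases le_total t 0 with h | h
  · rw [max_eq_right h]; linarith [th_nonneg hδ t]
  · rw [max_eq_left h]; linarith [th_ge hδ t]

/-! gradients -/

lemma grad_congr {f g : ℝ × ℝ → ℝ} {x : ℝ × ℝ} (h : f =ᶠ[𝓝 x] g) : grad f x = grad g x := by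
  unfold grad; rw [h.fderiv_eq]

lemma grad_const (c : ℝ) (x : ℝ × ℝ) : grad (fun _ => c) x = 0 := by
  simp [grad]

lemma grad_add {f g : ℝ × ℝ → ℝ} {x : ℝ × ℝ} (hf : DifferentiableAt ℝ f x)
    (hg : DifferentiableAt ℝ g x) : grad (fun y => f y + g y) x = grad f x + grad g x := by
  unfold grad; rw [fderiv_fun_add hf hg]; rfl

lemma grad_sub {f g : ℝ × ℝ → ℝ} {x : ℝ × ℝ} (hf : DifferentiableAt ℝ f x)
    (hg : DifferentiableAt ℝ g x) : grad (fun y => f y - g y) x = grad f x - grad g x := by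
  unfold grad; rw [fderiv_fun_sub hf hg]; rfl

lemma grad_smul {f : ℝ × ℝ → ℝ} {x : ℝ × ℝ} (hf : DifferentiableAt ℝ f x) (c : ℝ) :
    grad (fun y => c * f y) x = c • grad f x := by
  unfold grad; rw [fderiv_const_mul hf]; rfl

lemma grad_mul_const {f : ℝ × ℝ → ℝ} {x : ℝ × ℝ} (hf : DifferentiableAt ℝ f x) (c : ℝ) :
    grad (fun y => f y * c) x = c • grad f x := by
  rw [← grad_smul hf]; simp only [mul_comm]

lemma grad_neg {f : ℝ × ℝ → ℝ} {x : ℝ × ℝ} : grad (fun y => - f y) x = - grad f x := by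
  unfold grad; rw [fderiv_fun_neg]; rfl

lemma grad_mul {f g : ℝ × ℝ → ℝ} {x : ℝ × ℝ} (hf : DifferentiableAt ℝ f x)
    (hg : DifferentiableAt ℝ g x) :
    grad (fun y => f y * g y) x = f x • grad g x + g x • grad f x := by
  unfold grad; rw [fderiv_fun_mul hf hg]; rfl

lemma grad_comp {φ : ℝ → ℝ} {φ' : ℝ} {f : ℝ × ℝ → ℝ} {x : ℝ × ℝ} (hφ : HasDerivAt φ φ' (f x))
    (hf : DifferentiableAt ℝ f x) : grad (fun y => φ (f y)) x = φ' • grad f x := by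
  have := hφ.comp_hasFDerivAt x hf.hasFDerivAt
  unfold grad
  rw [show (fun y => φ (f y)) = φ ∘ f from rfl, this.fderiv]; rfl

lemma diffAt_of {U : Set (ℝ × ℝ)} (hU : IsOpen U) {f : ℝ × ℝ → ℝ} (hf : ContDiffOn ℝ 1 f U)
    {x : ℝ × ℝ} (hx : x ∈ U) : DifferentiableAt ℝ f x :=
  (hf.contDiffAt (hU.mem_nhds hx)).differentiableAt (by norm_num)

lemma grad_cont {U : Set (ℝ × ℝ)} (hU : IsOpen U) {f : ℝ × ℝ → ℝ} (hf : ContDiffOn ℝ 1 f U) :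
    ContinuousOn (grad f) U := by
  have h := hf.continuousOn_fderiv_of_isOpen hU le_rfl
  exact ContinuousOn.prodMk (h.clm_apply continuousOn_const) (h.clm_apply continuousOn_const)

/-- compactly supported test functions -/
def CT (Ω : Set (ℝ × ℝ)) (f : ℝ × ℝ → ℝ) : Prop :=
  ContDiff ℝ 1 f ∧ ∃ C ⊆ Ω, IsCompact C ∧ ∀ x ∉ C, f x = 0

lemma zext_contDiff {U C : Set (ℝ × ℝ)} (hU : IsOpen U) (hC : IsCompact C)
    {g : ℝ × ℝ → ℝ} (hg : ContDiffOn ℝ 1 g U) (h0 : ∀ x ∈ U, x ∉ C → g x = 0) (hCU : C ⊆ U) :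
    ContDiff ℝ 1 (U.indicator g) ∧ (∀ x ∉ C, U.indicator g x = 0) ∧
      ∀ x, grad (U.indicator g) x = U.indicator (grad g) x := by
  have hz : ∀ x ∉ C, U.indicator g x = 0 := by
    intro x hx
    by_cases hxU : x ∈ U
    · rw [indicator_of_mem hxU]; exact h0 x hxU hx
    · exact indicator_of_notMem hxU _
  have e1 : ∀ x ∈ U, U.indicator g =ᶠ[𝓝 x] g := by
    intro x hx
    filter_upwards [hU.mem_nhds hx] with y hy using indicator_of_mem hy _
  have e2 : ∀ x ∉ C, U.indicator g =ᶠ[𝓝 x] fun _ => 0 := by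
    intro x hx
    filter_upwards [hC.isClosed.isOpen_compl.mem_nhds hx] with y hy using hz y hy
  refine ⟨?_, hz, ?_⟩
  · rw [contDiff_iff_contDiffAt]
    intro x
    by_cases hx : x ∈ U
    · exact (hg.contDiffAt (hU.mem_nhds hx)).congr_of_eventuallyEq (e1 x hx)
    · exact contDiffAt_const.congr_of_eventuallyEq (e2 x (fun h => hx (hCU h)))
  · intro x
    by_cases hx : x ∈ U
    · rw [indicator_of_mem hx, grad_congr (e1 x hx)]
    · rw [indicator_of_notMem hx, grad_congr (e2 x (fun h => hx (hCU h))), grad_const]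

lemma zext_th {Ω U C : Set (ℝ × ℝ)} (hU : IsOpen U) (hUΩ : U ⊆ Ω) (hC : IsCompact C)
    {w : ℝ × ℝ → ℝ} (hw : ContDiffOn ℝ 1 w U) {δ : ℝ} (hδ : 0 < δ)
    (h0 : ∀ x ∈ U, x ∉ C → w x ≤ δ) (hCU : C ⊆ U) :
    CT Ω (U.indicator fun x => th δ (w x)) ∧
      ∀ x, grad (U.indicator fun x => th δ (w x)) x
        = U.indicator (fun x => th' δ (w x) • grad w x) x := by
  have hg : ContDiffOn ℝ 1 (fun x => th δ (w x)) U := (th_contDiff hδ).comp_contDiffOn hw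
  obtain ⟨h1, h2, h3⟩ := zext_contDiff hU hC hg (fun x hx hxC => th_zero (h0 x hx hxC)) hCU
  refine ⟨⟨h1, C, hCU.trans hUΩ, hC, h2⟩, fun x => ?_⟩
  rw [h3]
  by_cases hx : x ∈ U
  · rw [indicator_of_mem hx, indicator_of_mem hx]
    exact grad_comp (th_hasDeriv hδ _) (diffAt_of hU hw hx)
  · rw [indicator_of_notMem hx, indicator_of_notMem hx]

lemma CT_cont {Ω : Set (ℝ × ℝ)} {f : ℝ × ℝ → ℝ} (h : CT Ω f) : Continuous f := h.1.continuous

lemma CT_grad_cont {Ω : Set (ℝ × ℝ)} {f : ℝ × ℝ → ℝ} (h : CT Ω f) : Continuous (grad f) := by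
  have h := h.1.continuous_fderiv (by norm_num)
  exact Continuous.prodMk (h.clm_apply continuous_const) (h.clm_apply continuous_const)

lemma CT_grad_zero {Ω : Set (ℝ × ℝ)} {f : ℝ × ℝ → ℝ} (h : CT Ω f) :
    ∃ C ⊆ Ω, IsCompact C ∧ (∀ x ∉ C, f x = 0) ∧ ∀ x ∉ C, grad f x = 0 := by
  obtain ⟨h1, C, hCΩ, hC, h0⟩ := h
  refine ⟨C, hCΩ, hC, h0, fun x hx => ?_⟩
  have : f =ᶠ[𝓝 x] fun _ => 0 := by
    filter_upwards [hC.isClosed.isOpen_compl.mem_nhds hx] with y hy using h0 y hy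
  rw [grad_congr this, grad_const]



lemma cs_of_zero {G : ℝ × ℝ → ℝ} {C : Set (ℝ × ℝ)} (hC : IsCompact C)
    (h0 : ∀ x ∉ C, G x = 0) : HasCompactSupport G :=
  HasCompactSupport.intro hC h0

lemma int_fderiv_zero {G : ℝ × ℝ → ℝ} (hG : ContDiff ℝ 1 G) {C : Set (ℝ × ℝ)} (hC : IsCompact C)
    (h0 : ∀ x ∉ C, G x = 0) (v : ℝ × ℝ) : ∫ x, fderiv ℝ G x v = 0 := by
  have hs := cs_of_zero hC h0
  have hGi : Integrable G := hG.continuous.integrable_of_hasCompactSupport hs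
  have hc : Continuous fun x => fderiv ℝ G x v :=
    (hG.continuous_fderiv (by norm_num)).clm_apply continuous_const
  have hs2 : HasCompactSupport fun x => fderiv ℝ G x v := hs.fderiv_apply ℝ v
  have hDi : Integrable fun x => fderiv ℝ G x v := hc.integrable_of_hasCompactSupport hs2
  have := integral_mul_fderiv_eq_neg_fderiv_mul_of_integrable (μ := (volume : Measure (ℝ × ℝ)))
    (f := fun _ : ℝ × ℝ => (1:ℝ)) (g := G) (v := v) (by simp) (by simpa using hDi)
    (by simpa using hGi) (by fun_prop) (fun x _ => hG.differentiable (by norm_num) x)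
  simpa using this

lemma div_form (k : ℝ) (x a b : ℝ × ℝ) :
    KHform k x a b = (KHvec k x a).1 * b.1 + (KHvec k x a).2 * b.2 := by
  unfold KHform KHvec; ring

lemma KHvec_contDiffOn {k : ℝ} (hk : 0 < k) {Ω : Set (ℝ × ℝ)} (hΩ : IsOpen Ω) {v : ℝ × ℝ → ℝ}
    (hv : ContDiffOn ℝ 2 v Ω) : ContDiffOn ℝ 1 (fun x => (KHvec k x (grad v x)).1) Ω ∧
    ContDiffOn ℝ 1 (fun x => (KHvec k x (grad v x)).2) Ω := by
  have h := hv.fderiv_of_isOpen (m := 1) hΩ (by norm_num)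
  have h1 : ContDiffOn ℝ 1 (fun x => (grad v x).1) Ω := h.clm_apply contDiffOn_const
  have h2 : ContDiffOn ℝ 1 (fun x => (grad v x).2) Ω := h.clm_apply contDiffOn_const
  have hi : ContDiff ℝ 1 (fun x : ℝ × ℝ => (k ^ 2 + x.1 ^ 2 + x.2 ^ 2)⁻¹) := by
    apply ContDiff.inv (by fun_prop)
    intro x; exact (KH_den_pos hk x).ne'
  have p1 : ContDiff ℝ 1 (fun x : ℝ × ℝ => k ^ 2 + x.2 ^ 2) := by fun_prop
  have p2 : ContDiff ℝ 1 (fun x : ℝ × ℝ => k ^ 2 + x.1 ^ 2) := by fun_prop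
  have p3 : ContDiff ℝ 1 (fun x : ℝ × ℝ => x.1 * x.2) := by fun_prop
  refine ⟨?_, ?_⟩
  · exact hi.contDiffOn.mul ((p1.contDiffOn.mul h1).sub (p3.contDiffOn.mul h2))
  · exact hi.contDiffOn.mul ((p3.contDiffOn.neg.mul h1).add (p2.contDiffOn.mul h2))

lemma ct_mul_ext {Ω : Set (ℝ × ℝ)} (hΩ : IsOpen Ω) {ψ F : ℝ × ℝ → ℝ} (hψ : CT Ω ψ)
    (hF : ContDiffOn ℝ 1 F Ω) (v : ℝ × ℝ) :
    ∫ x in Ω, (ψ x * fderiv ℝ F x v + F x * fderiv ℝ ψ x v) = 0 ∧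
    IntegrableOn (fun x => ψ x * fderiv ℝ F x v) Ω ∧
    IntegrableOn (fun x => F x * fderiv ℝ ψ x v) Ω := by
  obtain ⟨C, hCΩ, hC, h0, h0'⟩ := CT_grad_zero hψ
  have h0f : ∀ x ∉ C, fderiv ℝ ψ x v = 0 := by
    intro x hx
    have : ψ =ᶠ[𝓝 x] fun _ => 0 := by
      filter_upwards [hC.isClosed.isOpen_compl.mem_nhds hx] with y hy using h0 y hy
    rw [this.fderiv_eq]; simp
  have hg : ContDiffOn ℝ 1 (fun x => ψ x * F x) Ω := hψ.1.contDiffOn.mul hF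
  have hz : ∀ x ∈ Ω, x ∉ C → ψ x * F x = 0 := by
    intro x _ hx; rw [h0 x hx, zero_mul]
  obtain ⟨e1, e2, e3⟩ := zext_contDiff hΩ hC hg hz hCΩ
  have hInt := int_fderiv_zero e1 hC e2 v
  have hpt : ∀ x ∈ Ω, fderiv ℝ (Ω.indicator fun x => ψ x * F x) x v =
      ψ x * fderiv ℝ F x v + F x * fderiv ℝ ψ x v := by
    intro x hx
    have : (Ω.indicator fun x => ψ x * F x) =ᶠ[𝓝 x] fun x => ψ x * F x := by
      filter_upwards [hΩ.mem_nhds hx] with y hy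
      simp [hy]
    rw [this.fderiv_eq, fderiv_fun_mul (hψ.1.differentiable (by norm_num) x) (diffAt_of hΩ hF hx)]
    rfl
  have hcF := hF.continuousOn_fderiv_of_isOpen hΩ le_rfl
  have cF : ContinuousOn (fun x => fderiv ℝ F x v) Ω := hcF.clm_apply continuousOn_const
  have cψ : Continuous (fun x => fderiv ℝ ψ x v) :=
    (hψ.1.continuous_fderiv (by norm_num)).clm_apply continuous_const
  have key : ∀ g : ℝ × ℝ → ℝ, ContinuousOn g Ω → (∀ x ∈ Ω, x ∉ C → g x = 0) → IntegrableOn g Ω := by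
    intro g hg h0
    have : IntegrableOn g C := (hg.mono hCΩ).integrableOn_compact hC
    refine this.of_forall_sdiff_eq_zero hΩ.measurableSet ?_
    intro x hx; exact h0 x hx.1 hx.2
  refine ⟨?_, ?_, ?_⟩
  · rw [← hInt, ← integral_indicator hΩ.measurableSet]
    congr 1
    ext x
    by_cases hx : x ∈ Ω
    · rw [indicator_of_mem hx, hpt x hx]
    · rw [indicator_of_notMem hx]
      have hxC : x ∉ C := fun h => hx (hCΩ h)
      have : (Ω.indicator fun x => ψ x * F x) =ᶠ[𝓝 x] fun _ => 0 := by
        filter_upwards [hC.isClosed.isOpen_compl.mem_nhds hxC] with y hy using e2 y hy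
      rw [this.fderiv_eq]; simp
  · exact key _ (hψ.1.continuous.continuousOn.mul cF) (fun x _ hx => by rw [h0 x hx, zero_mul])
  · exact key _ (hF.continuousOn.mul cψ.continuousOn) (fun x _ hx => by rw [h0f x hx, mul_zero])

lemma ibp {k : ℝ} (hk : 0 < k) {Ω : Set (ℝ × ℝ)} (hΩ : IsOpen Ω) {v ψ : ℝ × ℝ → ℝ}
    (hv : ContDiffOn ℝ 2 v Ω) (hψ : CT Ω ψ) :
    ∫ x in Ω, KHform k x (grad v x) (grad ψ x) = ∫ x in Ω, LH k v x * ψ x := by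
  obtain ⟨c1, c2⟩ := KHvec_contDiffOn hk hΩ hv
  obtain ⟨a1, a2, a3⟩ := ct_mul_ext hΩ hψ c1 (1, 0)
  obtain ⟨b1, b2, b3⟩ := ct_mul_ext hΩ hψ c2 (0, 1)
  have hA : ∫ x in Ω, KHform k x (grad v x) (grad ψ x) =
      (∫ x in Ω, (KHvec k x (grad v x)).1 * fderiv ℝ ψ x (1,0)) +
      ∫ x in Ω, (KHvec k x (grad v x)).2 * fderiv ℝ ψ x (0,1) := by
    rw [← integral_add a3 b3]
    congr 1; ext x; rw [div_form]; rfl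
  have hB : ∫ x in Ω, LH k v x * ψ x =
      -((∫ x in Ω, ψ x * fderiv ℝ (fun x => (KHvec k x (grad v x)).1) x (1,0)) +
      ∫ x in Ω, ψ x * fderiv ℝ (fun x => (KHvec k x (grad v x)).2) x (0,1)) := by
    rw [← integral_add a2 b2, ← integral_neg]
    congr 1; ext x; unfold LH div2; ring
  rw [integral_add a2 a3] at a1
  rw [integral_add b2 b3] at b1
  rw [hA, hB]; linarith


/-- Standing data -/
structure Dat (k p : ℝ) (Ω : Set (ℝ × ℝ)) (q : ℝ × ℝ → ℝ) : Prop where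
  hk : 0 < k
  hp : 1 < p
  ho : IsOpen Ω
  hc : IsConnected Ω
  hb : Bornology.IsBounded Ω
  hsc : SimplyConnectedSpace ↥Ω
  hq1 : ContDiffOn ℝ 2 q Ω
  hqc : ContinuousOn q (closure Ω)
  hq3 : ∀ x ∈ closure Ω, 0 < q x
  hq4 : ∀ x ∈ Ω, LH k q x = 0

def Bi (k : ℝ) (Ω : Set (ℝ × ℝ)) (f g : ℝ × ℝ → ℝ) : ℝ :=
  ∫ x in Ω, KHform k x (grad f x) (grad g x)

def Nl (p ε : ℝ) (q : ℝ × ℝ → ℝ) (Ω : Set (ℝ × ℝ)) (u : ℝ × ℝ → ℝ) : ℝ :=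
  ∫ x in Ω, pPart (u x - q x * Real.log (1 / ε)) ^ (p + 1)

lemma Ieps_eq (k p ε : ℝ) (q : ℝ × ℝ → ℝ) (Ω : Set (ℝ × ℝ)) (u : ℝ × ℝ → ℝ) :
    Ieps k p ε q Ω u = (1 / 2) * Bi k Ω u u - (1 / ((p + 1) * ε ^ 2)) * Nl p ε q Ω u := rfl

lemma pPart_nonneg (t : ℝ) : 0 ≤ pPart t := le_max_right _ _
lemma pPart_cont : Continuous pPart := by unfold pPart; fun_prop
lemma pPart_mono {s t : ℝ} (h : s ≤ t) : pPart s ≤ pPart t := max_le_max_right 0 h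

lemma Nl_nonneg (p ε : ℝ) (q : ℝ × ℝ → ℝ) (Ω : Set (ℝ × ℝ)) (u : ℝ × ℝ → ℝ) :
    0 ≤ Nl p ε q Ω u :=
  integral_nonneg fun _ => Real.rpow_nonneg (pPart_nonneg _) _

lemma Bi_self_nonneg (k : ℝ) (Ω : Set (ℝ × ℝ)) (f : ℝ × ℝ → ℝ) : 0 ≤ Bi k Ω f f :=
  integral_nonneg fun _ => KH_nonneg _ _

lemma Bi_symm (k : ℝ) (Ω : Set (ℝ × ℝ)) (f g : ℝ × ℝ → ℝ) : Bi k Ω f g = Bi k Ω g f := by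
  unfold Bi; congr 1; ext x; rw [KH_symm]

section
variable {k p : ℝ} {Ω : Set (ℝ × ℝ)} {q : ℝ × ℝ → ℝ}

lemma Dat.cpt (D : Dat k p Ω q) : IsCompact (closure Ω) := D.hb.isCompact_closure

lemma Dat.q1 (D : Dat k p Ω q) : ContDiffOn ℝ 1 q Ω := D.hq1.of_le (by norm_num)

lemma Dat.int_of_cont (D : Dat k p Ω q) {f : ℝ × ℝ → ℝ} (hf : ContinuousOn f (closure Ω)) :
    IntegrableOn f Ω := (hf.integrableOn_compact D.cpt).mono_set subset_closure

lemma Dat.pw_cont (D : Dat k p Ω q) {f : ℝ × ℝ → ℝ} (hf : ContinuousOn f (closure Ω)) (ε : ℝ) {s : ℝ}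
    (hs : 0 ≤ s) : ContinuousOn (fun x => pPart (f x - q x * Real.log (1 / ε)) ^ s) (closure Ω) :=
  (pPart_cont.comp_continuousOn (hf.sub (D.hqc.mul continuousOn_const))).rpow_const
    (fun _ _ => Or.inr hs)

lemma Dat.memH_CT (D : Dat k p Ω q) {f : ℝ × ℝ → ℝ} (hf : CT Ω f) : MemH k Ω f := by
  obtain ⟨C, hCΩ, hC, h0, h0'⟩ := CT_grad_zero hf
  refine ⟨hf.1.continuous.continuousOn, hf.1.contDiffOn, ?_, ?_⟩
  · intro x hx
    apply h0; intro hxC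
    rw [D.ho.frontier_eq] at hx
    exact hx.2 (hCΩ hxC)
  · apply D.int_of_cont
    exact KH_cont D.hk (CT_grad_cont hf).continuousOn (CT_grad_cont hf).continuousOn

lemma Dat.int_KH (D : Dat k p Ω q) {f g : ℝ × ℝ → ℝ} (hf : MemH k Ω f) (hg : MemH k Ω g) :
    IntegrableOn (fun x => KHform k x (grad f x) (grad g x)) Ω := by
  refine Integrable.mono' (hf.2.2.2.add hg.2.2.2) ?_ ?_
  · exact (KH_cont D.hk (grad_cont D.ho hf.2.1) (grad_cont D.ho hg.2.1)).aestronglyMeasurable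
      D.ho.measurableSet
  · refine ae_of_all _ fun x => ?_
    have := KH_amgm (k := k) x (grad f x) (grad g x) 1 one_pos
    have h1 := KH_nonneg (k := k) x (grad f x)
    have h2 := KH_nonneg (k := k) x (grad g x)
    simp only [inv_one, one_mul, Pi.add_apply, Real.norm_eq_abs] at *
    linarith [abs_nonneg (KHform k x (grad f x) (grad g x))]

lemma Dat.int_KH_CT (D : Dat k p Ω q) {f g : ℝ × ℝ → ℝ} (hf : ContDiffOn ℝ 1 f Ω) (hg : CT Ω g) :
    IntegrableOn (fun x => KHform k x (grad f x) (grad g x)) Ω := by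
  obtain ⟨C, hCΩ, hC, h0, h0'⟩ := CT_grad_zero hg
  have hcont := KH_cont D.hk (grad_cont D.ho hf) (CT_grad_cont hg).continuousOn
  have : IntegrableOn (fun x => KHform k x (grad f x) (grad g x)) C :=
    (hcont.mono hCΩ).integrableOn_compact hC
  refine this.of_forall_sdiff_eq_zero D.ho.measurableSet ?_
  intro x hx; rw [h0' x hx.2, KH_zero_right]

lemma Dat.grad_lin (D : Dat k p Ω q) {f g : ℝ × ℝ → ℝ} (hf : ContDiffOn ℝ 1 f Ω)
    (hg : ContDiffOn ℝ 1 g Ω) (a b : ℝ) {x : ℝ × ℝ} (hx : x ∈ Ω) :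
    grad (fun y => a * f y + b * g y) x = a • grad f x + b • grad g x := by
  have h1 := diffAt_of D.ho hf hx
  have h2 := diffAt_of D.ho hg hx
  rw [grad_add (h1.const_mul a) (h2.const_mul b), grad_smul h1, grad_smul h2]

lemma Dat.KH_lin (D : Dat k p Ω q) {f g : ℝ × ℝ → ℝ} (hf : ContDiffOn ℝ 1 f Ω)
    (hg : ContDiffOn ℝ 1 g Ω) (a b : ℝ) {x : ℝ × ℝ} (hx : x ∈ Ω) :
    KHform k x (grad (fun y => a * f y + b * g y) x) (grad (fun y => a * f y + b * g y) x)
    = a ^ 2 * KHform k x (grad f x) (grad f x) + 2 * a * b * KHform k x (grad f x) (grad g x)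
      + b ^ 2 * KHform k x (grad g x) (grad g x) := by
  rw [D.grad_lin hf hg a b hx]
  simp only [KH_add_left, KH_add_right, KH_smul_left, KH_smul_right]
  rw [KH_symm k x (grad g x) (grad f x)]; ring

lemma Dat.memH_lin (D : Dat k p Ω q) {f g : ℝ × ℝ → ℝ} (hf : MemH k Ω f) (hg : MemH k Ω g)
    (a b : ℝ) : MemH k Ω (fun y => a * f y + b * g y) := by
  refine ⟨(continuousOn_const.mul hf.1).add (continuousOn_const.mul hg.1),
    (contDiffOn_const.mul hf.2.1).add (contDiffOn_const.mul hg.2.1), ?_, ?_⟩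
  · intro x hx; simp [hf.2.2.1 x hx, hg.2.2.1 x hx]
  · have : IntegrableOn (fun x => a ^ 2 * KHform k x (grad f x) (grad f x)
      + 2 * a * b * KHform k x (grad f x) (grad g x)
      + b ^ 2 * KHform k x (grad g x) (grad g x)) Ω :=
      ((hf.2.2.2.const_mul _).add ((D.int_KH hf hg).const_mul _)).add (hg.2.2.2.const_mul _)
    refine this.congr_fun ?_ D.ho.measurableSet
    intro x hx
    exact (D.KH_lin hf.2.1 hg.2.1 a b hx).symm

lemma Dat.Bi_lin (D : Dat k p Ω q) {f g : ℝ × ℝ → ℝ} (hf : MemH k Ω f) (hg : MemH k Ω g)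
    (a b : ℝ) : Bi k Ω (fun y => a * f y + b * g y) (fun y => a * f y + b * g y)
      = a ^ 2 * Bi k Ω f f + 2 * a * b * Bi k Ω f g + b ^ 2 * Bi k Ω g g := by
  unfold Bi
  rw [setIntegral_congr_fun D.ho.measurableSet (fun x hx => D.KH_lin hf.2.1 hg.2.1 a b hx)]
  have i1 := hf.2.2.2.const_mul (a ^ 2)
  have i2 := (D.int_KH hf hg).const_mul (2 * a * b)
  have i3 := hg.2.2.2.const_mul (b ^ 2)
  have e1 := integral_add (i1.add i2) i3
  have e2 := integral_add i1 i2
  simp only [Pi.add_apply] at e1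
  rw [e1, e2, integral_const_mul, integral_const_mul, integral_const_mul]

lemma Dat.Bi_lin_le (D : Dat k p Ω q) {f g : ℝ × ℝ → ℝ} (hf : MemH k Ω f) (hg : MemH k Ω g)
    (a b : ℝ) : Bi k Ω (fun y => a * f y + b * g y) (fun y => a * f y + b * g y)
      ≤ 2 * a ^ 2 * Bi k Ω f f + 2 * b ^ 2 * Bi k Ω g g := by
  have h1 := D.Bi_lin hf hg a b
  have h2 := D.Bi_lin hf hg a (-b)
  have h3 := Bi_self_nonneg k Ω (fun y => a * f y + (-b) * g y)
  rw [h2] at h3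
  rw [h1]; nlinarith

lemma Dat.I_zero (D : Dat k p Ω q) {ε : ℝ} (hL : 0 ≤ Real.log (1 / ε)) :
    Ieps k p ε q Ω (fun _ => 0) = 0 := by
  rw [Ieps_eq]
  have h1 : Bi k Ω (fun _ => 0) (fun _ => 0) = 0 := by
    unfold Bi; simp [grad_const, KH_zero_left]
  have h2 : Nl p ε q Ω (fun _ => 0) = 0 := by
    unfold Nl
    rw [setIntegral_congr_fun (g := fun _ => (0:ℝ)) D.ho.measurableSet]
    · simp
    · intro x hx
      have := D.hq3 x (subset_closure hx)
      have h : pPart (0 - q x * Real.log (1 / ε)) = 0 := by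
        unfold pPart; apply max_eq_right
        nlinarith [mul_nonneg this.le hL]
      simp only [h]
      exact Real.zero_rpow (by linarith [D.hp])
  rw [h1, h2]; simp

lemma Dat.path (D : Dat k p Ω q) {ε : ℝ} (hL : 0 ≤ Real.log (1 / ε)) {v0 v1 : ℝ × ℝ → ℝ}
    (hv0 : MemH k Ω v0) (hv1 : MemH k Ω v1) {S M : ℝ} (hS : 0 ≤ S)
    (h0 : ∀ τ ∈ Icc (0:ℝ) 1, Ieps k p ε q Ω (fun y => τ * v0 y) ≤ M)
    (h1 : ∀ s ∈ Icc (0:ℝ) S, Ieps k p ε q Ω (fun y => v0 y + s * v1 y) ≤ M)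
    (h2 : Ieps k p ε q Ω (fun y => v0 y + S * v1 y) < 0) : ceps k p q Ω ε ≤ M := by
  set γ : ℝ → ℝ × ℝ → ℝ := fun t y => min (2 * t) 1 * v0 y + (max (2 * t - 1) 0 * S) * v1 y with hγ
  have hI : ∀ t ∈ Icc (0:ℝ) 1, Ieps k p ε q Ω (γ t) ≤ M := by
    intro t ht
    rcases le_total (2 * t) 1 with h | h
    · have : γ t = fun y => (2 * t) * v0 y := by
        ext y; simp only [hγ]; rw [min_eq_left h, max_eq_right (by linarith)]; ring
      rw [this]; exact h0 _ ⟨by linarith [ht.1], h⟩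
    · have : γ t = fun y => v0 y + ((2 * t - 1) * S) * v1 y := by
        ext y; simp only [hγ]; rw [min_eq_right h, max_eq_left (by linarith)]; ring
      rw [this]
      apply h1
      constructor
      · apply mul_nonneg (by linarith) hS
      · have := ht.2; nlinarith
  have hle : ceps k p q Ω ε ≤ sSup ((fun t => Ieps k p ε q Ω (γ t)) '' Icc (0:ℝ) 1) := by
    unfold ceps
    apply csInf_le
    · refine ⟨0, ?_⟩
      rintro c ⟨g, _, _, g0, _, rfl⟩
      apply Real.sSup_nonneg'
      refine ⟨_, ⟨0, by simp, rfl⟩, ?_⟩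
      simp only
      rw [g0, D.I_zero hL]
    · refine ⟨γ, fun t _ => D.memH_lin hv0 hv1 _ _, ?_, ?_, ?_, rfl⟩
      · intro t ht δ hδ
        set C : ℝ := 8 * Bi k Ω v0 v0 + 8 * S ^ 2 * Bi k Ω v1 v1 with hC
        have e0 := Bi_self_nonneg k Ω v0
        have e1 := Bi_self_nonneg k Ω v1
        have hC0 : 0 ≤ C := by positivity
        refine ⟨min 1 (δ / (C + 1)), by positivity, ?_⟩
        intro s hs hst
        have hst1 := lt_of_lt_of_le hst (min_le_left _ _)
        have hst2 := lt_of_lt_of_le hst (min_le_right _ _)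
        rw [lt_div_iff₀ (by linarith)] at hst2
        set a := min (2 * s) 1 - min (2 * t) 1 with ha
        set b := (max (2 * s - 1) 0 - max (2 * t - 1) 0) with hb
        have haa : |a| ≤ 2 * |s - t| := by
          have := abs_min_sub_min_le_max (2 * s) 1 (2 * t) 1
          rw [sub_self, abs_zero, max_eq_left (abs_nonneg _), ← mul_sub, abs_mul] at this
          simpa using this
        have hbb : |b| ≤ 2 * |s - t| := by
          have := abs_max_sub_max_le_max (2 * s - 1) 0 (2 * t - 1) 0
          rw [sub_self, abs_zero, max_eq_left (abs_nonneg (2 * s - 1 - (2 * t - 1))),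
            show 2 * s - 1 - (2 * t - 1) = 2 * (s - t) by ring, abs_mul] at this
          simpa using this
        have e : (fun y => γ s y - γ t y) = fun y => a * v0 y + (b * S) * v1 y := by
          ext y; simp only [hγ, ha, hb]; ring
        have := D.Bi_lin_le hv0 hv1 a (b * S)
        rw [e]
        refine lt_of_le_of_lt this ?_
        have ha2 : a ^ 2 ≤ 4 * |s - t| := by
          rw [← sq_abs]; nlinarith [abs_nonneg a, abs_nonneg (s - t)]
        have hb2 : b ^ 2 ≤ 4 * |s - t| := by
          rw [← sq_abs]; nlinarith [abs_nonneg b, abs_nonneg (s - t)]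
        have hb3 : (b * S) ^ 2 ≤ 4 * |s - t| * S ^ 2 := by
          rw [mul_pow]; exact mul_le_mul_of_nonneg_right hb2 (sq_nonneg _)
        have k1 := mul_le_mul_of_nonneg_right ha2 e0
        have k2 := mul_le_mul_of_nonneg_right hb3 e1
        have := abs_nonneg (s - t)
        nlinarith
      · ext y; simp [hγ]
      · have : γ 1 = fun y => v0 y + S * v1 y := by
          ext y; simp only [hγ]; norm_num
        rw [this]; exact h2
  refine hle.trans (csSup_le ?_ ?_)
  · exact ⟨_, ⟨0, by simp, rfl⟩⟩
  · rintro _ ⟨t, ht, rfl⟩; exact hI t ht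

/-- test identity -/
lemma Dat.test (D : Dat k p Ω q) {ε : ℝ} {u : ℝ × ℝ → ℝ} (hu : IsSolution k p ε q Ω u)
    {ψ : ℝ × ℝ → ℝ} (hψ : CT Ω ψ) :
    (∫ x in Ω, KHform k x (grad u x) (grad ψ x) =
      ∫ x in Ω, (1 / ε ^ 2) * pPart (u x - q x * Real.log (1 / ε)) ^ p * ψ x) ∧
    (∫ x in Ω, KHform k x (grad (fun y => u y - q y * Real.log (1 / ε)) x) (grad ψ x) =
      ∫ x in Ω, (1 / ε ^ 2) * pPart (u x - q x * Real.log (1 / ε)) ^ p * ψ x) := by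
  have hu1 : ContDiffOn ℝ 1 u Ω := hu.2.1.of_le (by norm_num)
  have e1 : ∫ x in Ω, KHform k x (grad u x) (grad ψ x) =
      ∫ x in Ω, (1 / ε ^ 2) * pPart (u x - q x * Real.log (1 / ε)) ^ p * ψ x := by
    rw [ibp D.hk D.ho hu.2.1 hψ]
    refine setIntegral_congr_fun D.ho.measurableSet fun x hx => ?_
    simp only [hu.2.2.2 x hx]
  have e2 : ∫ x in Ω, KHform k x (grad q x) (grad ψ x) = 0 := by
    rw [ibp D.hk D.ho D.hq1 hψ, setIntegral_congr_fun (g := fun _ => (0:ℝ)) D.ho.measurableSet]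
    · simp
    · intro x hx; simp [D.hq4 x hx]
  refine ⟨e1, ?_⟩
  rw [← e1]
  have : ∀ x ∈ Ω, KHform k x (grad (fun y => u y - q y * Real.log (1 / ε)) x) (grad ψ x) =
      KHform k x (grad u x) (grad ψ x) - Real.log (1 / ε) * KHform k x (grad q x) (grad ψ x) := by
    intro x hx
    have h1 := diffAt_of D.ho hu1 hx
    have h2 := diffAt_of D.ho D.q1 hx
    rw [grad_sub h1 (h2.mul_const _), grad_mul_const h2, KH_sub_left, KH_smul_left]
  rw [setIntegral_congr_fun D.ho.measurableSet this, integral_sub (D.int_KH_CT hu1 hψ)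
    ((D.int_KH_CT D.q1 hψ).const_mul _), integral_const_mul, e2]
  simp
end


lemma fderiv_norm_sq_le (ψ : ℝ × ℝ → ℝ) (x : ℝ × ℝ) : ‖fderiv ℝ ψ x‖ ^ 2 ≤ 2 * sqn (grad ψ x) := by
  have h : ‖fderiv ℝ ψ x‖ ≤ |(grad ψ x).1| + |(grad ψ x).2| := by
    apply ContinuousLinearMap.opNorm_le_bound _ (by positivity)
    intro y
    have e : fderiv ℝ ψ x y = y.1 * (grad ψ x).1 + y.2 * (grad ψ x).2 := by
      have : y = y.1 • ((1:ℝ), (0:ℝ)) + y.2 • ((0:ℝ), (1:ℝ)) := by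
        ext <;> simp
      conv_lhs => rw [this]
      rw [map_add, map_smul, map_smul]; rfl
    rw [e]
    have h1 := norm_fst_le y
    have h2 := norm_snd_le y
    rw [Real.norm_eq_abs] at h1 h2 ⊢
    calc _ ≤ |y.1 * (grad ψ x).1| + |y.2 * (grad ψ x).2| := abs_add_le _ _
      _ = |y.1| * |(grad ψ x).1| + |y.2| * |(grad ψ x).2| := by rw [abs_mul, abs_mul]
      _ ≤ ‖y‖ * |(grad ψ x).1| + ‖y‖ * |(grad ψ x).2| := by gcongr
      _ = _ := by ring
  have h0 := norm_nonneg (fderiv ℝ ψ x)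
  unfold sqn
  rw [← sq_abs (grad ψ x).1, ← sq_abs (grad ψ x).2]
  nlinarith [sq_nonneg (|(grad ψ x).1| - |(grad ψ x).2|)]

lemma sqn_int {Ω : Set (ℝ × ℝ)} {ψ : ℝ × ℝ → ℝ} (hψ : CT Ω ψ) :
    Integrable (fun x => sqn (grad ψ x)) := by
  obtain ⟨C, hCΩ, hC, h0, h0'⟩ := CT_grad_zero hψ
  have hg := CT_grad_cont hψ
  apply Continuous.integrable_of_hasCompactSupport
  · unfold sqn
    exact ((continuous_fst.comp hg).pow 2).add ((continuous_snd.comp hg).pow 2)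
  · refine HasCompactSupport.intro hC fun x hx => ?_
    simp [h0' x hx, sqn]

lemma sob {Ω : Set (ℝ × ℝ)} (hΩ : IsOpen Ω) (hb : Bornology.IsBounded Ω) {Q : ℝ} (hQ : 2 < Q) :
    ∃ K : ℝ, 0 ≤ K ∧ ∀ ψ, CT Ω ψ →
      ∫ x, |ψ x| ^ Q ≤ K * (∫ x in Ω, sqn (grad ψ x)) ^ (Q / 2) := by
  have hQ0 : 0 < Q := by linarith
  obtain ⟨Qn, hQn⟩ : ∃ Qn : NNReal, (Qn : ℝ) = Q := ⟨Real.toNNReal Q, Real.coe_toNNReal _ hQ0.le⟩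
  have hp0 : 0 ≤ 2 * Q / (Q + 2) := by positivity
  obtain ⟨Pn, hPn⟩ : ∃ Pn : NNReal, (Pn : ℝ) = 2 * Q / (Q + 2) := ⟨Real.toNNReal _, Real.coe_toNNReal _ hp0⟩
  set c := eLpNormLESNormFDerivOfLeConst ℝ (volume : Measure (ℝ × ℝ)) Ω Pn Qn with hc
  set V : ENNReal := (volume.restrict Ω) Set.univ ^ (1 / (Pn : ENNReal).toReal - 1 / (2:ENNReal).toReal)
    with hV
  have hVt : V ≠ ⊤ := by
    apply ENNReal.rpow_ne_top_of_nonneg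
    · simp only [ENNReal.coe_toReal, hPn, ENNReal.toReal_ofNat]
      rw [one_div_div, div_sub_div _ _ (by positivity) (by norm_num)]
      apply div_nonneg <;> nlinarith
    · rw [Measure.restrict_apply_univ]; exact hb.measure_lt_top.ne
  set K1 : ℝ := c * V.toReal with hK1
  have hK1n : 0 ≤ K1 := by positivity
  refine ⟨(K1 * 2 ^ (1 / 2 : ℝ)) ^ Q, by positivity, ?_⟩
  intro ψ hψ
  obtain ⟨C, hCΩ, hC, h0, h0'⟩ := CT_grad_zero hψ
  have hsup : ψ.support ⊆ Ω := by
    intro x hx; by_contra h; exact hx (h0 x fun h' => h (hCΩ h'))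
  have hcsψ : HasCompactSupport ψ := HasCompactSupport.intro hC h0
  have hfr : Module.finrank ℝ (ℝ × ℝ) = 2 := by simp
  have hgns := eLpNorm_le_eLpNorm_fderiv_of_le (μ := (volume : Measure (ℝ × ℝ))) (F := ℝ)
    (u := ψ) (s := Ω) hψ.1 hsup (p := Pn) (q := Qn)
    (by rw [← NNReal.coe_le_coe]; simp only [hPn, NNReal.coe_one]
        rw [le_div_iff₀ (by positivity)]; linarith)
    (by rw [hfr, ← NNReal.coe_lt_coe]
        simp only [hPn, Nat.cast_ofNat, NNReal.coe_ofNat]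
        rw [div_lt_iff₀ (by positivity)]; linarith)
    (by rw [hfr, NNReal.coe_inv]; simp only [hPn, hQn, Nat.cast_ofNat]
        apply le_of_eq; field_simp; ring) hb
  have hfz : ∀ x ∉ Ω, fderiv ℝ ψ x = 0 := by
    intro x hx
    have : ψ =ᶠ[𝓝 x] fun _ => 0 := by
      filter_upwards [hC.isClosed.isOpen_compl.mem_nhds (fun h => hx (hCΩ h))] with y hy using h0 y hy
    rw [this.fderiv_eq]; simp
  have hfs : Function.support (fderiv ℝ ψ) ⊆ Ω := by
    intro x hx; by_contra h; exact hx (hfz x h)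
  have hfc : Continuous (fderiv ℝ ψ) := hψ.1.continuous_fderiv (by norm_num)
  have hcsf : HasCompactSupport (fderiv ℝ ψ) := hcsψ.fderiv ℝ
  have h2 : eLpNorm (fderiv ℝ ψ) Pn volume ≤ eLpNorm (fderiv ℝ ψ) 2 (volume.restrict Ω) * V := by
    rw [← eLpNorm_restrict_eq_of_support_subset (f := fderiv ℝ ψ) (by exact hfs)]
    apply eLpNorm_le_eLpNorm_mul_rpow_measure_univ
    · rw [show (2:ENNReal) = ((2:NNReal) : ENNReal) by rfl, ENNReal.coe_le_coe, ← NNReal.coe_le_coe]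
      simp only [hPn, NNReal.coe_ofNat]
      rw [div_le_iff₀ (by positivity)]; linarith
    · exact hfc.aestronglyMeasurable
  have m1 : MemLp ψ Qn volume := hψ.1.continuous.memLp_of_hasCompactSupport hcsψ
  have m2 : MemLp (fderiv ℝ ψ) 2 (volume.restrict Ω) :=
    (hfc.memLp_of_hasCompactSupport hcsf).restrict _
  have e1 := m1.eLpNorm_eq_integral_rpow_norm (by
    simp only [ne_eq, ENNReal.coe_eq_zero]; intro h
    rw [h] at hQn; simp at hQn; linarith) ENNReal.coe_ne_top
  have e2 := m2.eLpNorm_eq_integral_rpow_norm (by norm_num) (by norm_num)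
  have hall := hgns.trans (mul_le_mul_right h2 _)
  rw [e1, e2, ← hc] at hall
  set X := ∫ x, ‖ψ x‖ ^ (Qn : ENNReal).toReal with hX
  set Y := ∫ x in Ω, ‖fderiv ℝ ψ x‖ ^ (2 : ENNReal).toReal with hY
  have hX0 : 0 ≤ X := integral_nonneg fun x => by positivity
  have hY0 : 0 ≤ Y := integral_nonneg fun x => by positivity
  have hreal : X ^ Q⁻¹ ≤ K1 * Y ^ (2:ℝ)⁻¹ := by
    have := ENNReal.toReal_mono (by
      apply ENNReal.mul_ne_top ENNReal.coe_ne_top (ENNReal.mul_ne_top ENNReal.ofReal_ne_top hVt)) hall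
    rw [ENNReal.toReal_mul, ENNReal.toReal_mul, ENNReal.toReal_ofReal (by positivity),
      ENNReal.toReal_ofReal (by positivity)] at this
    simp only [ENNReal.coe_toReal, ENNReal.toReal_ofNat, hQn] at this
    calc _ ≤ _ := this
      _ = _ := by rw [hK1]; ring
  set Z := ∫ x in Ω, sqn (grad ψ x) with hZ
  have hZ0 : 0 ≤ Z := integral_nonneg fun x => sqn_nonneg _
  have hYZ : Y ≤ 2 * Z := by
    rw [hY, hZ, ← integral_const_mul]
    apply integral_mono_of_nonneg
    · exact ae_of_all _ fun x => by positivity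
    · exact ((sqn_int hψ).integrableOn).const_mul _
    · refine ae_of_all _ fun x => ?_
      have := fderiv_norm_sq_le ψ x
      simpa using this
  have hXX : ∫ x, |ψ x| ^ Q = X := by
    rw [hX]; simp [hQn]
  rw [hXX]
  have s1 : X = (X ^ Q⁻¹) ^ Q := by rw [← Real.rpow_mul hX0, inv_mul_cancel₀ hQ0.ne', Real.rpow_one]
  calc X = (X ^ Q⁻¹) ^ Q := s1
    _ ≤ (K1 * (2 * Z) ^ (2:ℝ)⁻¹) ^ Q := by
        apply Real.rpow_le_rpow (by positivity) _ hQ0.le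
        refine hreal.trans ?_
        gcongr
    _ = (K1 * 2 ^ (1 / 2 : ℝ)) ^ Q * Z ^ (Q / 2) := by
        rw [Real.mul_rpow (by norm_num) hZ0, ← mul_assoc, Real.mul_rpow (by positivity) (by positivity),
          ← Real.rpow_mul hZ0]
        congr 2 <;> norm_num
        ring_nf

section
variable {k p : ℝ} {Ω : Set (ℝ × ℝ)} {q : ℝ × ℝ → ℝ}

lemma Dat.ct_th (D : Dat k p Ω q) {v : ℝ × ℝ → ℝ} (hc : ContinuousOn v (closure Ω))
    (h1 : ContDiffOn ℝ 1 v Ω) (hfr : ∀ x ∈ frontier Ω, v x ≤ 0) {δ : ℝ} (hδ : 0 < δ) :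
    CT Ω (Ω.indicator fun x => th δ (v x)) ∧
      ∀ x, grad (Ω.indicator fun x => th δ (v x)) x
        = Ω.indicator (fun x => th' δ (v x) • grad v x) x := by
  set C := closure Ω ∩ v ⁻¹' Ici δ with hC
  have hCc : IsCompact C := by
    have : IsClosed C := hc.preimage_isClosed_of_isClosed isClosed_closure isClosed_Ici
    exact D.cpt.of_isClosed_subset this inter_subset_left
  refine zext_th D.ho Subset.rfl hCc h1 hδ ?_ ?_
  · intro x hx hxC
    by_contra h
    push Not at h
    exact hxC ⟨subset_closure hx, h.le⟩
  · intro x hx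
    by_contra h
    have : x ∈ frontier Ω := by rw [D.ho.frontier_eq]; exact ⟨hx.1, h⟩
    have h2 := hfr x this
    have h3 : δ ≤ v x := hx.2
    linarith

lemma Dat.ell (D : Dat k p Ω q) : ∃ κ > 0, ∀ x ∈ Ω, ∀ a, κ * sqn a ≤ KHform k x a a := by
  obtain ⟨R, hR⟩ := D.hb.exists_norm_le
  have hk := D.hk
  refine ⟨k ^ 2 / (k ^ 2 + 2 * R ^ 2), by positivity, ?_⟩
  intro x hx a
  apply KH_ge D.hk
  have h := hR x hx
  have h1 := (norm_fst_le x).trans h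
  have h2 := (norm_snd_le x).trans h
  rw [Real.norm_eq_abs] at h1 h2
  nlinarith [sq_abs x.1, sq_abs x.2, abs_nonneg x.1, abs_nonneg x.2]

lemma Dat.qbd (D : Dat k p Ω q) : ∃ m > 0, ∃ M > 0, ∀ x ∈ closure Ω, m ≤ q x ∧ q x ≤ M := by
  have hne : (closure Ω).Nonempty := D.hc.nonempty.closure
  obtain ⟨a, ha, ha'⟩ := D.cpt.exists_isMinOn hne D.hqc
  obtain ⟨b, hb, hb'⟩ := D.cpt.exists_isMaxOn hne D.hqc
  exact ⟨q a, D.hq3 a ha, q b, D.hq3 b hb, fun x hx => ⟨ha' hx, hb' hx⟩⟩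

/-- energy of truncation -/
lemma Dat.sqn_th_le (D : Dat k p Ω q) {κ : ℝ} (hκ : 0 < κ)
    (hell : ∀ x ∈ Ω, ∀ a, κ * sqn a ≤ KHform k x a a) {v : ℝ × ℝ → ℝ} (hv : MemH k Ω v)
    {δ : ℝ} (hδ : 0 < δ) :
    ∫ x in Ω, sqn (grad (Ω.indicator fun x => th δ (v x)) x) ≤ κ⁻¹ * Bi k Ω v v := by
  obtain ⟨h1, h2⟩ := D.ct_th hv.1 hv.2.1 (fun x hx => (hv.2.2.1 x hx).le) hδ
  unfold Bi
  rw [← integral_const_mul]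
  refine setIntegral_mono_on (sqn_int h1).integrableOn (hv.2.2.2.const_mul _) D.ho.measurableSet ?_
  intro x hx
  rw [h2, indicator_of_mem hx]
  have := hell x hx (grad v x)
  rw [← div_eq_inv_mul, le_div_iff₀ hκ]
  have e : sqn (th' δ (v x) • grad v x) = th' δ (v x) ^ 2 * sqn (grad v x) := by
    unfold sqn; simp only [Prod.smul_fst, Prod.smul_snd, smul_eq_mul]; ring
  rw [e]
  have h3 := th'_nonneg hδ (v x)
  have h4 := th'_le_one (δ := δ) (v x)
  have h5 : th' δ (v x) ^ 2 ≤ 1 := by nlinarith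
  have h6 := sqn_nonneg (grad v x)
  nlinarith [mul_le_mul_of_nonneg_right h5 (mul_nonneg hκ.le h6)]

lemma Dat.Nl_le (D : Dat k p Ω q) {ε : ℝ} (hL : 0 < Real.log (1 / ε)) :
    ∃ K ≥ 0, ∀ v, MemH k Ω v → Nl p ε q Ω v ≤ K * Bi k Ω v v ^ ((p + 1) / 2) := by
  obtain ⟨κ, hκ, hell⟩ := D.ell
  obtain ⟨m, hm, M, hM, hq⟩ := D.qbd
  have hp := D.hp
  obtain ⟨K, hK, hsob⟩ := sob D.ho D.hb (Q := p + 1) (by linarith)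
  refine ⟨K * (κ⁻¹) ^ ((p + 1) / 2), by positivity, ?_⟩
  intro v hv
  set δ := m * Real.log (1 / ε) / 2 with hδd
  have hδ : 0 < δ := by positivity
  obtain ⟨h1, h2⟩ := D.ct_th hv.1 hv.2.1 (fun x hx => (hv.2.2.1 x hx).le) hδ
  set ψ := Ω.indicator fun x => th δ (v x) with hψ
  have hB := Bi_self_nonneg k Ω v
  calc Nl p ε q Ω v ≤ ∫ x in Ω, |ψ x| ^ (p + 1) := by
        unfold Nl
        refine setIntegral_mono_on (D.int_of_cont (D.pw_cont hv.1 ε (by linarith))) ?_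
          D.ho.measurableSet ?_
        · apply D.int_of_cont
          exact (h1.1.continuous.abs.rpow_const (fun x => Or.inr (by linarith))).continuousOn
        · intro x hx
          have hqx := (hq x (subset_closure hx)).1
          apply Real.rpow_le_rpow (pPart_nonneg _) _ (by linarith)
          have e : ψ x = th δ (v x) := by rw [hψ, indicator_of_mem hx]
          rw [e, abs_of_nonneg (th_nonneg hδ _)]
          apply max_le _ (th_nonneg hδ _)
          refine le_trans ?_ (th_ge hδ _)
          rw [hδd]
          nlinarith
    _ ≤ ∫ x, |ψ x| ^ (p + 1) := by
        apply setIntegral_le_integral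
        · have hc : Continuous fun x => |ψ x| ^ (p + 1) :=
            h1.1.continuous.abs.rpow_const (fun x => Or.inr (by linarith))
          obtain ⟨_, C, _, hC, h0⟩ := h1
          apply hc.integrable_of_hasCompactSupport
          refine HasCompactSupport.intro hC fun x hx => ?_
          rw [h0 x hx, abs_zero, Real.zero_rpow (by linarith)]
        · exact ae_of_all _ fun x => by positivity
    _ ≤ K * (∫ x in Ω, sqn (grad ψ x)) ^ ((p + 1) / 2) := hsob ψ h1
    _ ≤ K * (κ⁻¹ * Bi k Ω v v) ^ ((p + 1) / 2) := by
        apply mul_le_mul_of_nonneg_left _ hK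
        apply Real.rpow_le_rpow (integral_nonneg fun x => sqn_nonneg _) _ (by linarith)
        exact D.sqn_th_le hκ hell hv hδ
    _ = _ := by rw [Real.mul_rpow (by positivity) hB]; ring

lemma Dat.Bi_amgm (D : Dat k p Ω q) {f g : ℝ × ℝ → ℝ} (hf : MemH k Ω f) (hg : MemH k Ω g)
    {θ : ℝ} (hθ : 0 < θ) : 2 * |Bi k Ω f g| ≤ θ * Bi k Ω f f + θ⁻¹ * Bi k Ω g g := by
  have h1 := D.Bi_lin hf hg θ 1
  have h2 := D.Bi_lin hf hg θ (-1)
  have h3 := Bi_self_nonneg k Ω (fun y => θ * f y + 1 * g y)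
  have h4 := Bi_self_nonneg k Ω (fun y => θ * f y + (-1) * g y)
  rw [h1] at h3
  rw [h2] at h4
  have e : θ * (θ * Bi k Ω f f + θ⁻¹ * Bi k Ω g g) = θ ^ 2 * Bi k Ω f f + Bi k Ω g g := by
    field_simp
  have : 0 ≤ θ * (θ * Bi k Ω f f + θ⁻¹ * Bi k Ω g g - 2 * |Bi k Ω f g|) := by
    rw [mul_sub, e]
    rcases abs_cases (Bi k Ω f g) with ⟨ha, _⟩ | ⟨ha, _⟩ <;> rw [ha] <;> nlinarith
  have := nonneg_of_mul_nonneg_right this hθ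
  linarith

lemma Dat.path_cont (D : Dat k p Ω q) {γ : ℝ → ℝ × ℝ → ℝ}
    (hm : ∀ t ∈ Icc (0:ℝ) 1, MemH k Ω (γ t))
    (hc : ∀ t ∈ Icc (0:ℝ) 1, ∀ δ > 0, ∃ η > 0, ∀ s ∈ Icc (0:ℝ) 1, |s - t| < η →
      (∫ x in Ω, KHform k x (grad (fun y => γ s y - γ t y) x)
        (grad (fun y => γ s y - γ t y) x)) < δ) :
    ContinuousOn (fun t => Bi k Ω (γ t) (γ t)) (Icc 0 1) := by
  rw [Metric.continuousOn_iff]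
  intro t ht δ hδ
  have hE := Bi_self_nonneg k Ω (γ t)
  set E := Bi k Ω (γ t) (γ t) with hEd
  set θ := δ / (2 * (E + 1)) with hθd
  have hθ : 0 < θ := by positivity
  obtain ⟨η, hη, h⟩ := hc t ht (δ / (2 * (θ⁻¹ + 1))) (by positivity)
  refine ⟨η, hη, fun s hs hst => ?_⟩
  rw [Real.dist_eq] at hst ⊢
  have hd := h s hs hst
  have hmd : MemH k Ω (fun y => γ s y - γ t y) := by
    have := D.memH_lin (hm s hs) (hm t ht) 1 (-1)
    have e : (fun y => γ s y - γ t y) = fun y => 1 * γ s y + (-1) * γ t y := by ext y; ring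
    rw [e]; exact this
  have hlin := D.Bi_lin (hm t ht) hmd 1 1
  have e : (fun y => 1 * γ t y + 1 * (γ s y - γ t y)) = γ s := by ext y; ring
  rw [e, ← hEd] at hlin
  have ham := D.Bi_amgm (hm t ht) hmd hθ
  have hF := Bi_self_nonneg k Ω (fun y => γ s y - γ t y)
  change Bi k Ω (fun y => γ s y - γ t y) (fun y => γ s y - γ t y) < _ at hd
  rw [← hEd] at ham
  set F := Bi k Ω (fun y => γ s y - γ t y) (fun y => γ s y - γ t y)
  set G := Bi k Ω (γ t) (fun y => γ s y - γ t y)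
  rw [hlin]
  have k1 : θ * E < δ / 2 := by
    rw [hθd, div_mul_eq_mul_div, div_lt_iff₀ (by positivity)]
    nlinarith
  have k2 : (θ⁻¹ + 1) * F < δ / 2 := by
    rw [lt_div_iff₀ (by positivity)] at hd
    linarith
  rw [abs_lt]
  have a1 := neg_abs_le G
  have a2 := le_abs_self G
  constructor <;> nlinarith

lemma Dat.ceps_pos (D : Dat k p Ω q) {ε : ℝ} (hε : 0 < ε) (hL : 0 < Real.log (1 / ε))
    {v : ℝ × ℝ → ℝ} (hv : MemH k Ω v) (hneg : Ieps k p ε q Ω v < 0) : 0 < ceps k p q Ω ε := by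
  obtain ⟨K, hK, hN⟩ := D.Nl_le hL
  have hp := D.hp
  set a := 1 / ((p + 1) * ε ^ 2) with ha
  have ha0 : 0 < a := by positivity
  -- threshold
  obtain ⟨ρ, hρ, hρ1⟩ : ∃ ρ > 0, ∀ e, 0 ≤ e → e ≤ ρ → a * (K * e ^ ((p + 1) / 2)) ≤ e / 4 := by
    refine ⟨(1 / (4 * (a * K + 1))) ^ (1 / ((p - 1) / 2)), by positivity, ?_⟩
    intro e he0 he
    have h1 : e ^ ((p - 1) / 2) ≤ 1 / (4 * (a * K + 1)) := by
      have := Real.rpow_le_rpow he0 he (z := (p - 1) / 2) (by linarith)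
      rwa [← Real.rpow_mul (by positivity), one_div_mul_cancel (by linarith), Real.rpow_one] at this
    have h2 : e ^ ((p + 1) / 2) = e * e ^ ((p - 1) / 2) := by
      rw [show (p + 1) / 2 = 1 + (p - 1) / 2 by ring, Real.rpow_add' he0 (by linarith), Real.rpow_one]
    rw [h2]
    have h3 : a * K * (1 / (4 * (a * K + 1))) ≤ 1 / 4 := by
      rw [mul_one_div, div_le_div_iff₀ (by positivity) (by norm_num)]; nlinarith
    have h4 : a * K * e ^ ((p - 1) / 2) ≤ 1 / 4 :=
      (mul_le_mul_of_nonneg_left h1 (by positivity)).trans h3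
    nlinarith [mul_le_mul_of_nonneg_left h4 he0]
  have hI : ∀ v, MemH k Ω v → Bi k Ω v v ≤ ρ → Bi k Ω v v / 4 ≤ Ieps k p ε q Ω v := by
    intro v hv h
    rw [Ieps_eq, ← ha]
    have := hρ1 _ (Bi_self_nonneg k Ω v) h
    have := mul_le_mul_of_nonneg_left (hN v hv) ha0.le
    linarith
  have hIle : ∀ v, Ieps k p ε q Ω v ≤ (1 / 2) * Bi k Ω v v := by
    intro v; rw [Ieps_eq, ← ha]
    have := mul_nonneg ha0.le (Nl_nonneg p ε q Ω v)
    linarith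
  have : ρ / 4 ≤ ceps k p q Ω ε := by
    unfold ceps
    apply le_csInf
    · -- nonempty
      have hz : MemH k Ω (fun _ => (0:ℝ)) := by
        have := D.memH_lin hv hv 0 0
        simpa using this
      refine ⟨_, fun t y => t * v y, fun t _ => ?_, ?_, ?_, ?_, rfl⟩
      · have := D.memH_lin hv hv t 0
        simpa using this
      · intro t ht δ hδ
        have hE := Bi_self_nonneg k Ω v
        refine ⟨min 1 (δ / (2 * Bi k Ω v v + 1)), by positivity, ?_⟩
        intro s hs hst
        have hst1 := lt_of_lt_of_le hst (min_le_left _ _)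
        have hst2 := lt_of_lt_of_le hst (min_le_right _ _)
        rw [lt_div_iff₀ (by positivity)] at hst2
        have := D.Bi_lin_le hv hv (s - t) 0
        have e : (fun y => s * v y - t * v y) = fun y => (s - t) * v y + 0 * v y := by ext y; ring
        rw [e]
        refine lt_of_le_of_lt this ?_
        have h1 : (s - t) ^ 2 ≤ |s - t| := by
          rw [← sq_abs]; nlinarith [abs_nonneg (s - t)]
        nlinarith [mul_le_mul_of_nonneg_right h1 hE, abs_nonneg (s - t)]
      · ext y; simp
      · simpa using hneg
    · rintro c ⟨γ, hm, hc, h0, h1, rfl⟩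
      have hcont := D.path_cont hm hc
      have hE0 : Bi k Ω (γ 0) (γ 0) = 0 := by
        rw [h0]; unfold Bi; simp [grad_const, KH_zero_left]
      have hE1 : ρ < Bi k Ω (γ 1) (γ 1) := by
        by_contra h
        push Not at h
        have := hI _ (hm 1 (by simp)) h
        linarith [Bi_self_nonneg k Ω (γ 1)]
      obtain ⟨t, ht, het⟩ : ∃ t ∈ Icc (0:ℝ) 1, Bi k Ω (γ t) (γ t) = ρ := by
        have := intermediate_value_Icc (zero_le_one) hcont
        have hmem : ρ ∈ Icc (Bi k Ω (γ 0) (γ 0)) (Bi k Ω (γ 1) (γ 1)) := ⟨by rw [hE0]; exact hρ.le, hE1.le⟩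
        exact this hmem
      obtain ⟨B, hB⟩ := (isCompact_Icc.image_of_continuousOn hcont).bddAbove
      have hbdd : BddAbove ((fun t => Ieps k p ε q Ω (γ t)) '' Icc (0:ℝ) 1) := by
        refine ⟨(1 / 2) * B, ?_⟩
        rintro _ ⟨s, hs, rfl⟩
        have h2 := hB ⟨s, hs, rfl⟩
        simp only at h2
        have := hIle (γ s)
        simp only
        linarith
      refine le_trans ?_ (le_csSup hbdd ⟨t, ht, rfl⟩)
      have := hI _ (hm t ht) het.le
      rw [het] at this
      exact this
  linarith
end

section
variable {k p : ℝ} {Ω : Set (ℝ × ℝ)} {q : ℝ × ℝ → ℝ}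

lemma zero_of_int {U : Set (ℝ × ℝ)} (hU : IsOpen U) {f : ℝ × ℝ → ℝ} (hf : ContinuousOn f U)
    (h0 : ∀ x ∈ U, 0 ≤ f x) (hi : IntegrableOn f U) (hz : ∫ x in U, f x = 0) : ∀ x ∈ U, f x = 0 := by
  have h1 : 0 ≤ᵐ[volume.restrict U] f := by
    filter_upwards [ae_restrict_mem hU.measurableSet] with x hx using h0 x hx
  have h2 := (integral_eq_zero_iff_of_nonneg_ae h1 hi).1 hz
  have := Measure.eqOn_open_of_ae_eq h2 hU hf continuousOn_const
  exact fun x hx => this hx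

lemma frontier_ne {Ω : Set (ℝ × ℝ)} (ho : IsOpen Ω) (hn : Ω.Nonempty) (hb : Bornology.IsBounded Ω) :
    (frontier Ω).Nonempty := by
  by_contra h
  rw [not_nonempty_iff_eq_empty] at h
  have hcl : IsClopen Ω := isClopen_iff_frontier_eq_empty.2 h
  rcases isClopen_iff.1 hcl with h1 | h1
  · exact hn.ne_empty h1
  · rw [h1] at hb
    exact NormedSpace.unbounded_univ ℝ (ℝ × ℝ) hb

lemma fderiv_zero_of_grad {f : ℝ × ℝ → ℝ} {x : ℝ × ℝ} (h : grad f x = 0) : fderiv ℝ f x = 0 := by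
  have := fderiv_norm_sq_le f x
  rw [h] at this
  simp only [sqn, Prod.fst_zero, Prod.snd_zero] at this
  rw [← norm_eq_zero]
  have h0 := norm_nonneg (fderiv ℝ f x)
  nlinarith

lemma Dat.grad_zero_of_KH (D : Dat k p Ω q) {x a : ℝ × ℝ} (hx : x ∈ Ω) (h : KHform k x a a = 0) :
    a = 0 := by
  obtain ⟨κ, hκ, hell⟩ := D.ell
  have := hell x hx a
  rw [h] at this
  have h2 := sqn_nonneg a
  have h3 : sqn a = 0 := by nlinarith
  unfold sqn at h3
  ext
  · simp; nlinarith [sq_nonneg a.1, sq_nonneg a.2]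
  · simp; nlinarith [sq_nonneg a.1, sq_nonneg a.2]

lemma Dat.core_ne (D : Dat k p Ω q) {ε : ℝ} {u : ℝ × ℝ → ℝ} (hu : IsMPSolution k p ε q Ω u)
    (hpos : 0 < ceps k p q Ω ε) : (vcore q Ω ε u).Nonempty := by
  by_contra hne
  rw [not_nonempty_iff_eq_empty] at hne
  have hp := D.hp
  obtain ⟨hs, hm, hI⟩ := hu
  have hpp : ∀ x ∈ Ω, pPart (u x - q x * Real.log (1 / ε)) = 0 := by
    intro x hx
    apply max_eq_right
    by_contra h
    push Not at h
    have : x ∈ vcore q Ω ε u := ⟨hx, by linarith⟩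
    rw [hne] at this; exact this
  have ht : ∀ ψ, CT Ω ψ → ∫ x in Ω, KHform k x (grad u x) (grad ψ x) = 0 := by
    intro ψ hψ
    rw [(D.test hs hψ).1, setIntegral_congr_fun (g := fun _ => (0:ℝ)) D.ho.measurableSet]
    · simp
    · intro x hx
      simp only [hpp x hx]
      rw [Real.zero_rpow (by linarith)]; ring
  have hKc : ContinuousOn (fun x => KHform k x (grad u x) (grad u x)) Ω :=
    KH_cont D.hk (grad_cont D.ho hm.2.1) (grad_cont D.ho hm.2.1)
  have key : ∀ σ : ℝ, σ = 1 ∨ σ = -1 → ∀ x ∈ Ω, 0 < σ * u x → grad u x = 0 := by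
    intro σ hσ x hx hpos
    set δ := σ * u x / 2 with hδ
    have hδ0 : 0 < δ := by positivity
    have hσ0 : σ ≠ 0 := by rcases hσ with h | h <;> rw [h] <;> norm_num
    obtain ⟨c1, c2⟩ := D.ct_th (v := fun y => σ * u y) (continuousOn_const.mul hm.1)
      (contDiffOn_const.mul hm.2.1) (fun x hx => by simp [hm.2.2.1 x hx]) hδ0
    have e := ht _ c1
    have e2 : ∀ y ∈ Ω, KHform k y (grad u y) (grad (Ω.indicator fun x => th δ (σ * u x)) y)
        = σ * (th' δ (σ * u y) * KHform k y (grad u y) (grad u y)) := by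
      intro y hy
      rw [c2, indicator_of_mem hy, grad_smul (diffAt_of D.ho hm.2.1 hy), KH_smul_right, KH_smul_right]
      ring
    rw [setIntegral_congr_fun D.ho.measurableSet e2, integral_const_mul] at e
    have e3 := (mul_eq_zero.1 e).resolve_left hσ0
    have hcont : ContinuousOn (fun y => th' δ (σ * u y) * KHform k y (grad u y) (grad u y)) Ω :=
      ((th'_cont hδ0).comp_continuousOn (continuousOn_const.mul hm.2.1.continuousOn)).mul hKc
    have e4 := zero_of_int D.ho hcont
      (fun y _ => mul_nonneg (th'_nonneg hδ0 _) (KH_nonneg _ _)) (by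
        refine Integrable.mono' hm.2.2.2 (hcont.aestronglyMeasurable D.ho.measurableSet) ?_
        refine ae_of_all _ fun y => ?_
        rw [Real.norm_eq_abs, abs_of_nonneg (mul_nonneg (th'_nonneg hδ0 _) (KH_nonneg _ _))]
        exact mul_le_of_le_one_left (KH_nonneg _ _) (th'_le_one _)) e3 x hx
    have h5 := (mul_eq_zero.1 e4).resolve_left (th'_pos hδ0 (by rw [hδ]; linarith)).ne'
    exact D.grad_zero_of_KH hx h5
  have hfd : EqOn (fderiv ℝ fun y => u y * u y) 0 Ω := by
    intro x hx
    have hd := diffAt_of D.ho hm.2.1 hx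
    rw [fderiv_fun_mul hd hd]
    by_cases h : u x = 0
    · simp [h]
    · have : grad u x = 0 := by
        rcases lt_or_gt_of_ne h with h | h
        · exact key (-1) (Or.inr rfl) x hx (by linarith)
        · exact key 1 (Or.inl rfl) x hx (by linarith)
      rw [fderiv_zero_of_grad this]; simp
  obtain ⟨a, ha⟩ := D.ho.exists_is_const_of_fderiv_eq_zero D.hc.isPreconnected
    (fun x hx => ((diffAt_of D.ho hm.2.1 hx).mul (diffAt_of D.ho hm.2.1 hx)).differentiableWithinAt) hfd
  obtain ⟨b, hb⟩ := frontier_ne D.ho D.hc.nonempty D.hb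
  have hcl : ∀ x ∈ closure Ω, u x * u x = a := by
    have : EqOn (fun y => u y * u y) (fun _ => a) (closure Ω) :=
      EqOn.of_subset_closure (s := Ω) (fun x hx => ha x hx) (hm.1.mul hm.1) continuousOn_const
        subset_closure Subset.rfl
    exact this
  have ha0 : a = 0 := by
    rw [← hcl b (frontier_subset_closure hb), hm.2.2.1 b hb]; simp
  have hu0 : ∀ x ∈ Ω, u x = 0 := by
    intro x hx
    have := hcl x (subset_closure hx)
    rw [ha0] at this
    simpa using this
  have hI0 : Ieps k p ε q Ω u = 0 := by
    rw [Ieps_eq]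
    have h1 : Bi k Ω u u = 0 := by
      unfold Bi
      rw [setIntegral_congr_fun (g := fun _ => (0:ℝ)) D.ho.measurableSet]
      · simp
      · intro x hx
        have : grad u x = 0 := by
          rw [grad_congr (g := fun _ => 0), grad_const]
          filter_upwards [D.ho.mem_nhds hx] with y hy using hu0 y hy
        simp only [this, KH_zero_left]
    have h2 : Nl p ε q Ω u = 0 := by
      unfold Nl
      rw [setIntegral_congr_fun (g := fun _ => (0:ℝ)) D.ho.measurableSet]
      · simp
      · intro x hx; simp only [hpp x hx]; exact Real.zero_rpow (by linarith)
    rw [h1, h2]; simp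
  linarith
end


def pt (y : ℝ × ℝ) (ρ φ : ℝ) : ℝ × ℝ := (y.1 + ρ * Real.cos φ, y.2 + ρ * Real.sin φ)

lemma pt_cont (y : ℝ × ℝ) : Continuous fun z : ℝ × ℝ => pt y z.1 z.2 := by
  unfold pt; fun_prop

lemma pt_cont1 (y : ℝ × ℝ) (φ : ℝ) : Continuous fun ρ => pt y ρ φ := by
  unfold pt; fun_prop

lemma pt_cont2 (y : ℝ × ℝ) (ρ : ℝ) : Continuous fun φ => pt y ρ φ := by
  unfold pt; fun_prop

lemma polar_lint {F : ℝ × ℝ → ℝ} (hF : Continuous F) (y : ℝ × ℝ) :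
    ∫⁻ x, ENNReal.ofReal (F x) = ∫⁻ ρ in Ioi (0:ℝ), ∫⁻ φ in Ioo (-π) π,
      ENNReal.ofReal ρ * ENNReal.ofReal (F (pt y ρ φ)) := by
  rw [← lintegral_add_left_eq_self _ y, ← lintegral_comp_polarCoord_symm]
  rw [polarCoord_target, Measure.volume_eq_prod, ← Measure.prod_restrict, lintegral_prod]
  · rfl
  · apply Measurable.aemeasurable
    have h1 : Measurable fun z : ℝ × ℝ => ENNReal.ofReal (F (pt y z.1 z.2)) :=
      (hF.comp (pt_cont y)).measurable.ennreal_ofReal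
    have h2 : Measurable fun z : ℝ × ℝ => ENNReal.ofReal z.1 := measurable_fst.ennreal_ofReal
    exact h2.mul h1

lemma polar_lint2 {F : ℝ × ℝ → ℝ} (hF : Continuous F) (y : ℝ × ℝ) :
    ∫⁻ x, ENNReal.ofReal (F x) = ∫⁻ φ in Ioo (-π) π, ∫⁻ ρ in Ioi (0:ℝ),
      ENNReal.ofReal ρ * ENNReal.ofReal (F (pt y ρ φ)) := by
  rw [polar_lint hF y, lintegral_lintegral_swap]
  apply Measurable.aemeasurable
  have h1 : Measurable fun z : ℝ × ℝ => ENNReal.ofReal (F (pt y z.1 z.2)) :=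
    (hF.comp (pt_cont y)).measurable.ennreal_ofReal
  have h2 : Measurable fun z : ℝ × ℝ => ENNReal.ofReal z.1 := measurable_fst.ennreal_ofReal
  exact h2.mul h1

lemma ofReal_int_le {h : ℝ → ℝ} {a b : ℝ} (hab : a ≤ b) (hc : ContinuousOn h (Icc a b))
    (h0 : ∀ t ∈ Icc a b, 0 ≤ h t) :
    ENNReal.ofReal (∫ t in a..b, h t) = ∫⁻ t in Ioo a b, ENNReal.ofReal (h t) := by
  rw [intervalIntegral.integral_of_le hab, ← restrict_Ioo_eq_restrict_Ioc,
    ofReal_integral_eq_lintegral_ofReal]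
  · exact (hc.integrableOn_compact isCompact_Icc).mono_set Ioo_subset_Icc_self
  · filter_upwards [ae_restrict_mem measurableSet_Ioo] with t ht using h0 t (Ioo_subset_Icc_self ht)

/-- sector lower bound, abstract form -/
lemma polar_sector {F : ℝ × ℝ → ℝ} (hF : Continuous F) (h0 : ∀ x, 0 ≤ F x) (hi : Integrable F)
    (y : ℝ × ℝ) {r1 r2 α β m : ℝ} (hr1 : 0 < r1) (hr : r1 ≤ r2) (hα : -π ≤ α) (hβ : β ≤ π)
    (hαβ : α ≤ β)
    (h : ∀ φ ∈ Ioo α β, m ≤ ∫ ρ in r1..r2, ρ * F (pt y ρ φ)) : (β - α) * m ≤ ∫ x, F x := by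
  have e := polar_lint2 hF y
  rw [← ofReal_integral_eq_lintegral_ofReal hi (ae_of_all _ h0)] at e
  have hI0 : 0 ≤ ∫ x, F x := integral_nonneg h0
  rw [← ENNReal.ofReal_le_ofReal_iff hI0, e, ENNReal.ofReal_mul (by linarith)]
  calc ENNReal.ofReal (β - α) * ENNReal.ofReal m = ∫⁻ φ in Ioo α β, ENNReal.ofReal m := by
        rw [setLIntegral_const, Real.volume_Ioo, mul_comm]
    _ ≤ ∫⁻ φ in Ioo α β, ∫⁻ ρ in Ioi (0:ℝ), ENNReal.ofReal ρ * ENNReal.ofReal (F (pt y ρ φ)) := by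
        apply setLIntegral_mono' measurableSet_Ioo
        intro φ hφ
        refine (ENNReal.ofReal_le_ofReal (h φ hφ)).trans ?_
        rw [ofReal_int_le hr (by
          have := (hF.comp (pt_cont1 y φ)); exact (continuous_id.mul this).continuousOn)
          (fun t ht => mul_nonneg (hr1.le.trans ht.1) (h0 _))]
        refine le_trans ?_ (lintegral_mono_set (s := Ioo r1 r2) (fun t ht => hr1.trans ht.1))
        apply setLIntegral_mono' measurableSet_Ioo
        intro t ht
        rw [ENNReal.ofReal_mul (hr1.le.trans ht.1.le)]
    _ ≤ _ := lintegral_mono_set (Ioo_subset_Ioo hα hβ)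

/-- good radius -/
lemma polar_radius {F : ℝ × ℝ → ℝ} (hF : Continuous F) (h0 : ∀ x, 0 ≤ F x) (hi : Integrable F)
    (y : ℝ × ℝ) {r1 r2 m : ℝ} (hr1 : 0 < r1) (hr : r1 < r2)
    (hm : ∫ x, F x < m * Real.log (r2 / r1)) :
    ∃ ρ ∈ Ioo r1 r2, ∫ φ in (-π)..π, ρ ^ 2 * F (pt y ρ φ) < m := by
  by_contra hcon
  push Not at hcon
  apply absurd hm
  push Not
  have e := polar_lint hF y
  rw [← ofReal_integral_eq_lintegral_ofReal hi (ae_of_all _ h0)] at e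
  have hI0 : 0 ≤ ∫ x, F x := integral_nonneg h0
  by_cases hm0 : m ≤ 0
  · have : 0 ≤ Real.log (r2 / r1) := Real.log_nonneg (by rw [le_div_iff₀ hr1]; linarith)
    nlinarith
  push Not at hm0
  rw [← ENNReal.ofReal_le_ofReal_iff hI0, e]
  have hlog : m * Real.log (r2 / r1) = ∫ ρ in r1..r2, m * ρ⁻¹ := by
    rw [intervalIntegral.integral_const_mul, integral_inv_of_pos hr1 (hr1.trans hr)]
  rw [hlog, ofReal_int_le (h := fun ρ => m * ρ⁻¹) hr.le (continuousOn_const.mul (continuousOn_id.inv₀ (fun t ht =>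
      (hr1.trans_le ht.1).ne'))) (fun t ht => mul_nonneg hm0.le (inv_nonneg.2 (hr1.le.trans ht.1)))]
  refine le_trans ?_ (lintegral_mono_set (s := Ioo r1 r2) (fun t ht => hr1.trans ht.1))
  apply setLIntegral_mono' measurableSet_Ioo
  intro ρ hρ
  have hρ0 : 0 < ρ := hr1.trans hρ.1
  have h1 := hcon ρ hρ
  have hc : Continuous fun φ => ρ ^ 2 * F (pt y ρ φ) :=
    continuous_const.mul (hF.comp (pt_cont2 y ρ))
  rw [intervalIntegral.integral_const_mul] at h1
  have h2 : m * ρ⁻¹ ≤ ∫ φ in (-π)..π, ρ * F (pt y ρ φ) := by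
    rw [intervalIntegral.integral_const_mul, ← div_eq_mul_inv, div_le_iff₀ hρ0]
    nlinarith
  refine (ENNReal.ofReal_le_ofReal h2).trans ?_
  rw [ofReal_int_le (h := fun φ => ρ * F (pt y ρ φ)) (by linarith [Real.pi_pos]) (continuous_const.mul (hF.comp (pt_cont2 y ρ))).continuousOn
    (fun t ht => mul_nonneg hρ0.le (h0 _))]
  apply setLIntegral_mono' measurableSet_Ioo
  intro t ht
  rw [ENNReal.ofReal_mul hρ0.le]

lemma radial1 {g g' G : ℝ → ℝ} {r1 r2 D0 : ℝ} (hr1 : 0 < r1) (hr : r1 < r2)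
    (hg : ∀ t ∈ Icc r1 r2, HasDerivAt g (g' t) t) (hg' : ContinuousOn g' (Icc r1 r2))
    (hG : ContinuousOn G (Icc r1 r2)) (hle : ∀ t ∈ Icc r1 r2, g' t ^ 2 ≤ G t)
    (hD : 0 ≤ D0) (hD0 : D0 ≤ |g r2 - g r1|) :
    D0 ^ 2 / Real.log (r2 / r1) ≤ ∫ t in r1..r2, t * G t := by
  have hu : uIcc r1 r2 = Icc r1 r2 := uIcc_of_le hr.le
  have hii : IntervalIntegrable g' volume r1 r2 := (hu ▸ hg').intervalIntegrable
  have hft : ∫ t in r1..r2, g' t = g r2 - g r1 :=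
    intervalIntegral.integral_eq_sub_of_hasDerivAt (fun t ht => hg t (hu ▸ ht)) hii
  have hl : 0 < Real.log (r2 / r1) := Real.log_pos (by rw [lt_div_iff₀ hr1]; linarith)
  set l := Real.log (r2 / r1) with hld
  have hlog : l = ∫ t in r1..r2, t⁻¹ := by rw [integral_inv_of_pos hr1 (hr1.trans hr)]
  set s := (if 0 ≤ g r2 - g r1 then (1:ℝ) else -1) * (D0 / l) with hs
  have hss : s ^ 2 = (D0 / l) ^ 2 := by rw [hs]; split_ifs <;> ring
  have hsm : s * (g r2 - g r1) ≥ D0 / l * D0 := by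
    have h0 : 0 ≤ D0 / l := by positivity
    have : s * (g r2 - g r1) = D0 / l * |g r2 - g r1| := by
      rw [hs]; split_ifs with h
      · rw [abs_of_nonneg h]; ring
      · push Not at h; rw [abs_of_neg h]; ring
    rw [this]; exact mul_le_mul_of_nonneg_left hD0 h0
  have hinv : ContinuousOn (fun t : ℝ => t⁻¹) (Icc r1 r2) :=
    continuousOn_id.inv₀ (fun t ht => (hr1.trans_le ht.1).ne')
  have i1 : IntervalIntegrable (fun t => t * G t) volume r1 r2 :=
    (hu ▸ (continuousOn_id.mul hG) : ContinuousOn (fun t => t * G t) (uIcc r1 r2)).intervalIntegrable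
  have i2 : IntervalIntegrable (fun t : ℝ => t⁻¹) volume r1 r2 := (hu ▸ hinv).intervalIntegrable
  have hmono : ∫ t in r1..r2, (2 * s) * g' t ≤ ∫ t in r1..r2, (t * G t + s ^ 2 * t⁻¹) := by
    apply intervalIntegral.integral_mono_on hr.le (hii.const_mul _) (i1.add (i2.const_mul _))
    intro t ht
    have ht0 : 0 < t := hr1.trans_le ht.1
    have h1 := hle t ht
    have h2 : 0 ≤ t * (g' t - s * t⁻¹) ^ 2 := by positivity
    have h3 : t * (g' t - s * t⁻¹) ^ 2 = t * g' t ^ 2 - 2 * s * g' t + s ^ 2 * t⁻¹ := by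
      field_simp; ring
    nlinarith
  rw [intervalIntegral.integral_const_mul, hft, intervalIntegral.integral_add i1 (i2.const_mul _),
    intervalIntegral.integral_const_mul, ← hlog, hss] at hmono
  have e1 : (D0 / l) ^ 2 * l = D0 ^ 2 / l := by field_simp
  have e2 : D0 / l * D0 = D0 ^ 2 / l := by ring
  rw [e1] at hmono
  rw [e2] at hsm
  linarith

lemma ang1 {g g' G : ℝ → ℝ} {a b : ℝ} (hab : a ≤ b)
    (ha : -π ≤ a) (hb : b ≤ π)
    (hg : ∀ t, HasDerivAt g (g' t) t) (hg' : Continuous g')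
    (hG : Continuous G) (hle : ∀ t, g' t ^ 2 ≤ G t) :
    (g b - g a) ^ 2 ≤ 2 * π * ∫ t in (-π)..π, G t := by
  have hft : ∫ t in a..b, g' t = g b - g a :=
    intervalIntegral.integral_eq_sub_of_hasDerivAt (fun t _ => hg t) (hg'.intervalIntegrable _ _)
  have hG0 : ∀ t, 0 ≤ G t := fun t => (sq_nonneg _).trans (hle t)
  set s := (g b - g a) / (2 * π) with hs
  have hpi := Real.pi_pos
  have hmono : ∫ t in a..b, (2 * s) * g' t ≤ ∫ t in a..b, (G t + s ^ 2) := by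
    apply intervalIntegral.integral_mono_on hab ((hg'.intervalIntegrable _ _).const_mul _)
      ((hG.add continuous_const).intervalIntegrable _ _)
    intro t _
    change 2 * s * g' t ≤ G t + s ^ 2
    nlinarith [hle t, sq_nonneg (g' t - s)]
  have h2 : ∫ t in a..b, (G t + s ^ 2) ≤ ∫ t in (-π)..π, (G t + s ^ 2) := by
    apply intervalIntegral.integral_mono_interval ha hab hb
    · exact ae_of_all _ fun t => add_nonneg (hG0 t) (sq_nonneg _)
    · exact (hG.add continuous_const).intervalIntegrable _ _
  have h2' : ∫ t in (-π)..π, (G t + s ^ 2) = (∫ t in (-π)..π, G t) + (π - (-π)) • s ^ 2 := by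
    rw [intervalIntegral.integral_add (hG.intervalIntegrable _ _) (by simp),
      intervalIntegral.integral_const]
  rw [h2'] at h2
  rw [intervalIntegral.integral_const_mul, hft] at hmono
  have h3 : 2 * s * (g b - g a) ≤ (∫ t in (-π)..π, G t) + (2 * π) * s ^ 2 := by
    have := hmono.trans h2
    simp only [smul_eq_mul] at this
    linarith
  have e1 : 2 * s * (g b - g a) = 2 * ((g b - g a) ^ 2 / (2 * π)) := by rw [hs]; ring
  have e2 : (2 * π) * s ^ 2 = (g b - g a) ^ 2 / (2 * π) := by rw [hs]; field_simp
  rw [e1, e2] at h3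
  have h4 : (g b - g a) ^ 2 / (2 * π) ≤ ∫ t in (-π)..π, G t := by linarith
  rw [div_le_iff₀ (by positivity)] at h4
  linarith

lemma fderiv_apply_grad (g : ℝ × ℝ → ℝ) (x y : ℝ × ℝ) :
    fderiv ℝ g x y = y.1 * (grad g x).1 + y.2 * (grad g x).2 := by
  have : y = y.1 • ((1:ℝ), (0:ℝ)) + y.2 • ((0:ℝ), (1:ℝ)) := by
    ext <;> simp
  conv_lhs => rw [this]
  rw [map_add, map_smul, map_smul]; rfl

lemma deriv_rad {g : ℝ × ℝ → ℝ} {y : ℝ × ℝ} {ρ φ : ℝ} (h : DifferentiableAt ℝ g (pt y ρ φ)) :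
    HasDerivAt (fun r => g (pt y r φ))
      (Real.cos φ * (grad g (pt y ρ φ)).1 + Real.sin φ * (grad g (pt y ρ φ)).2) ρ := by
  have h1 : HasDerivAt (fun r => pt y r φ) (Real.cos φ, Real.sin φ) ρ := by
    unfold pt
    apply HasDerivAt.prodMk
    · simpa using ((hasDerivAt_id ρ).mul_const (Real.cos φ)).const_add y.1
    · simpa using ((hasDerivAt_id ρ).mul_const (Real.sin φ)).const_add y.2
  have := h.hasFDerivAt.comp_hasDerivAt ρ h1
  rw [fderiv_apply_grad] at this
  exact this

lemma deriv_ang {g : ℝ × ℝ → ℝ} {y : ℝ × ℝ} {ρ φ : ℝ} (h : DifferentiableAt ℝ g (pt y ρ φ)) :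
    HasDerivAt (fun t => g (pt y ρ t))
      (-(ρ * Real.sin φ) * (grad g (pt y ρ φ)).1 + ρ * Real.cos φ * (grad g (pt y ρ φ)).2) φ := by
  have h1 : HasDerivAt (fun t => pt y ρ t) (-(ρ * Real.sin φ), ρ * Real.cos φ) φ := by
    unfold pt
    apply HasDerivAt.prodMk
    · simpa using ((Real.hasDerivAt_cos φ).const_mul ρ).const_add y.1
    · simpa using ((Real.hasDerivAt_sin φ).const_mul ρ).const_add y.2
  have := h.hasFDerivAt.comp_hasDerivAt φ h1
  rw [fderiv_apply_grad] at this
  exact this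

lemma rad_sq_le (φ : ℝ) (a : ℝ × ℝ) : (Real.cos φ * a.1 + Real.sin φ * a.2) ^ 2 ≤ sqn a := by
  unfold sqn
  have := Real.sin_sq_add_cos_sq φ
  have h : a.1 ^ 2 + a.2 ^ 2 - (Real.cos φ * a.1 + Real.sin φ * a.2) ^ 2
      = (Real.sin φ * a.1 - Real.cos φ * a.2) ^ 2 := by
    have e : a.1 ^ 2 + a.2 ^ 2 = (Real.sin φ ^ 2 + Real.cos φ ^ 2) * (a.1 ^ 2 + a.2 ^ 2) := by
      rw [this, one_mul]
    rw [e]; ring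
  nlinarith [sq_nonneg (Real.sin φ * a.1 - Real.cos φ * a.2)]

lemma ang_sq_le (ρ φ : ℝ) (a : ℝ × ℝ) :
    (-(ρ * Real.sin φ) * a.1 + ρ * Real.cos φ * a.2) ^ 2 ≤ ρ ^ 2 * sqn a := by
  unfold sqn
  have := Real.sin_sq_add_cos_sq φ
  have h : ρ ^ 2 * (a.1 ^ 2 + a.2 ^ 2) - (-(ρ * Real.sin φ) * a.1 + ρ * Real.cos φ * a.2) ^ 2
      = (ρ * (Real.cos φ * a.1 + Real.sin φ * a.2)) ^ 2 := by
    have e : a.1 ^ 2 + a.2 ^ 2 = (Real.sin φ ^ 2 + Real.cos φ ^ 2) * (a.1 ^ 2 + a.2 ^ 2) := by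
      rw [this, one_mul]
    rw [e]; ring
  nlinarith [sq_nonneg (ρ * (Real.cos φ * a.1 + Real.sin φ * a.2))]

/-- sector energy bound -/
lemma sector_bound {g F : ℝ × ℝ → ℝ} (hF : Continuous F) (h0 : ∀ x, 0 ≤ F x) (hi : Integrable F)
    (y : ℝ × ℝ) {r1 r2 α β D0 : ℝ} (hr1 : 0 < r1) (hr : r1 < r2) (hα : -π ≤ α) (hβ : β ≤ π)
    (hαβ : α ≤ β) {U : Set (ℝ × ℝ)} (hU : IsOpen U) (hg : ContDiffOn ℝ 1 g U)
    (hin : ∀ φ ∈ Ioo α β, ∀ ρ ∈ Icc r1 r2, pt y ρ φ ∈ U)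
    (hle : ∀ φ ∈ Ioo α β, ∀ ρ ∈ Icc r1 r2, sqn (grad g (pt y ρ φ)) ≤ F (pt y ρ φ))
    (hD : 0 ≤ D0) (hD0 : ∀ φ ∈ Ioo α β, D0 ≤ |g (pt y r2 φ) - g (pt y r1 φ)|) :
    (β - α) * (D0 ^ 2 / Real.log (r2 / r1)) ≤ ∫ x, F x := by
  apply polar_sector hF h0 hi y hr1 hr.le hα hβ hαβ
  intro φ hφ
  have hgc : ContinuousOn (fun ρ => grad g (pt y ρ φ)) (Icc r1 r2) :=
    (grad_cont hU hg).comp (pt_cont1 y φ).continuousOn (fun ρ hρ => hin φ hφ ρ hρ)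
  refine radial1 (g := fun ρ => g (pt y ρ φ)) (G := fun ρ => F (pt y ρ φ)) hr1 hr
    (fun t ht => deriv_rad (diffAt_of hU hg (hin φ hφ t ht))) ?_
    (hF.comp (pt_cont1 y φ)).continuousOn ?_ hD (hD0 φ hφ)
  · exact (continuousOn_const.mul (continuous_fst.comp_continuousOn hgc)).add
      (continuousOn_const.mul (continuous_snd.comp_continuousOn hgc))
  · intro t ht
    exact (rad_sq_le φ _).trans (hle φ hφ t ht)

/-- oscillation on a circle -/
lemma circle_osc {g : ℝ × ℝ → ℝ} (hg : ContDiff ℝ 1 g) (y : ℝ × ℝ) (ρ : ℝ) {a b : ℝ}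
    (ha : a ∈ Icc (-π) π) (hb : b ∈ Icc (-π) π) :
    (g (pt y ρ b) - g (pt y ρ a)) ^ 2
      ≤ 2 * π * ∫ t in (-π)..π, ρ ^ 2 * sqn (grad g (pt y ρ t)) := by
  have hgc : Continuous (grad g) := by
    have h := hg.continuous_fderiv (by norm_num)
    exact Continuous.prodMk (h.clm_apply continuous_const) (h.clm_apply continuous_const)
  have hgc2 : Continuous (fun t => grad g (pt y ρ t)) := hgc.comp (pt_cont2 y ρ)
  have c1 := continuous_fst.comp hgc2
  have c2 := continuous_snd.comp hgc2
  have hd := fun t => deriv_ang (y := y) (ρ := ρ) (φ := t) ((hg.differentiable (by norm_num)) (pt y ρ t))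
  have k1 : Continuous fun t => -(ρ * Real.sin t) * (grad g (pt y ρ t)).1
      + ρ * Real.cos t * (grad g (pt y ρ t)).2 :=
    ((by fun_prop : Continuous fun t => -(ρ * Real.sin t)).mul c1).add
      ((by fun_prop : Continuous fun t => ρ * Real.cos t).mul c2)
  have k2 : Continuous fun t => ρ ^ 2 * sqn (grad g (pt y ρ t)) := by
    unfold sqn; exact continuous_const.mul ((c1.pow 2).add (c2.pow 2))
  rcases le_total a b with h | h
  · exact ang1 h ha.1 hb.2 hd k1 k2 (fun t => ang_sq_le ρ t _)
  · have := ang1 h hb.1 ha.2 hd k1 k2 (fun t => ang_sq_le ρ t _)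
    calc _ = (g (pt y ρ a) - g (pt y ρ b)) ^ 2 := by ring
      _ ≤ _ := this


lemma vol_ball (y : ℝ × ℝ) (r : ℝ) (hr : 0 ≤ r) : volume.real (Metric.ball y r) = 4 * r ^ 2 := by
  have : Metric.ball y r = Metric.ball y.1 r ×ˢ Metric.ball y.2 r := by
    rw [ball_prod_same]
  rw [this, measureReal_def, Measure.volume_eq_prod, Measure.prod_prod, ENNReal.toReal_mul,
    Real.volume_ball, Real.volume_ball, ENNReal.toReal_ofReal (by linarith)]
  ring

lemma ball_int (y : ℝ × ℝ) {r s : ℝ} (hr : 0 < r) (hs : 0 < s) :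
    ∫ x in Metric.ball y r, 4 / (s ^ 2 + ‖x - y‖ ^ 2) = 16 * Real.log ((s ^ 2 + r ^ 2) / s ^ 2) := by
  set h : ℝ → ℝ := (Iio r).indicator fun t => 4 / (s ^ 2 + t ^ 2) with hh
  have e1 : ∫ x in Metric.ball y r, 4 / (s ^ 2 + ‖x - y‖ ^ 2) = ∫ x, h ‖x - y‖ := by
    rw [← integral_indicator measurableSet_ball]
    refine integral_congr_ae (ae_of_all _ fun x => ?_)
    by_cases hx : ‖x - y‖ < r
    · simp [hh, indicator, Metric.mem_ball, dist_eq_norm, hx]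
    · simp [hh, indicator, Metric.mem_ball, dist_eq_norm, hx]
  rw [e1, integral_sub_right_eq_self (fun x => h ‖x‖) y, integral_fun_norm_addHaar, vol_ball _ _ zero_le_one]
  have hfr : Module.finrank ℝ (ℝ × ℝ) = 2 := by simp
  rw [hfr]
  have e2 : ∫ t in Ioi (0:ℝ), t ^ (2 - 1) • h t = ∫ t in (0:ℝ)..r, 4 * t / (s ^ 2 + t ^ 2) := by
    rw [intervalIntegral.integral_of_le hr.le, ← restrict_Ioo_eq_restrict_Ioc,
      ← integral_indicator measurableSet_Ioi, ← integral_indicator measurableSet_Ioo]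
    congr 1; ext t
    by_cases h0 : 0 < t <;> by_cases h1 : t < r <;>
      simp [indicator, h0, h1, hh]
    ring
  have e3 : ∫ t in (0:ℝ)..r, 4 * t / (s ^ 2 + t ^ 2)
      = 2 * Real.log (s ^ 2 + r ^ 2) - 2 * Real.log (s ^ 2 + 0 ^ 2) := by
    apply intervalIntegral.integral_eq_sub_of_hasDerivAt (f := fun t => 2 * Real.log (s ^ 2 + t ^ 2))
    · intro t _
      have hpos : 0 < s ^ 2 + t ^ 2 := by positivity
      have h1 : HasDerivAt (fun t : ℝ => s ^ 2 + t ^ 2) (2 * t) t := by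
        simpa using (hasDerivAt_pow 2 t).const_add (s ^ 2)
      have := (h1.log hpos.ne').const_mul 2
      refine this.congr_deriv ?_; rw [mul_div_assoc', ← mul_assoc]; norm_num
    · apply Continuous.intervalIntegrable
      apply Continuous.div (by fun_prop) (by fun_prop)
      intro t; positivity
  rw [e2, e3, Real.log_div (by positivity) (by positivity)]
  norm_num
  ring

section
variable {k p : ℝ} {Ω : Set (ℝ × ℝ)} {q : ℝ × ℝ → ℝ}

lemma euc_in {Ω : Set (ℝ × ℝ)} (ho : IsOpen Ω) {y : ℝ × ℝ} (hy : y ∈ Ω) :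
    ∃ r > 0, ∀ x, sqn (x - y) ≤ r ^ 2 → x ∈ Ω := by
  obtain ⟨r, hr, h⟩ := Metric.isOpen_iff.1 ho y hy
  refine ⟨r / 2, by positivity, fun x hx => h ?_⟩
  rw [Metric.mem_ball, dist_eq_norm, Prod.norm_def]
  unfold sqn at hx
  rw [max_lt_iff, Real.norm_eq_abs, Real.norm_eq_abs]
  have a1 : (x - y).1 ^ 2 ≤ (r / 2) ^ 2 := by nlinarith [sq_nonneg (x - y).2]
  have a2 : (x - y).2 ^ 2 ≤ (r / 2) ^ 2 := by nlinarith [sq_nonneg (x - y).1]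
  have b1 := abs_le_of_sq_le_sq a1 (by positivity)
  have b2 := abs_le_of_sq_le_sq a2 (by positivity)
  constructor <;> linarith

lemma norm_sq_le_sqn (a : ℝ × ℝ) : ‖a‖ ^ 2 ≤ sqn a := by
  unfold sqn
  rw [Prod.norm_def, Real.norm_eq_abs, Real.norm_eq_abs]
  rcases max_cases |a.1| |a.2| with ⟨h, _⟩ | ⟨h, _⟩ <;> rw [h, sq_abs] <;> nlinarith [sq_nonneg a.1, sq_nonneg a.2]

lemma sqn_le_norm_sq (a : ℝ × ℝ) : sqn a ≤ 2 * ‖a‖ ^ 2 := by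
  unfold sqn
  have h1 := norm_fst_le a
  have h2 := norm_snd_le a
  rw [Real.norm_eq_abs] at h1 h2
  nlinarith [sq_abs a.1, sq_abs a.2, abs_nonneg a.1, abs_nonneg a.2]

set_option maxHeartbeats 2000000 in
lemma Dat.upper (D : Dat k p Ω q) : ∃ C > 0, ∃ L0 ≥ (1:ℝ), ∀ ε > 0, L0 ≤ Real.log (1 / ε) →
    (∃ v, MemH k Ω v ∧ Ieps k p ε q Ω v < 0) ∧ ceps k p q Ω ε ≤ C * Real.log (1 / ε) := by
  obtain ⟨y, hy⟩ := D.hc.nonempty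
  obtain ⟨r, hr, hin⟩ := euc_in D.ho hy
  obtain ⟨m, hm, Mq, hMq, hq⟩ := D.qbd
  have hp := D.hp
  set M := Mq + 1 with hM
  have hM0 : 0 < M := by linarith
  refine ⟨24 * M ^ 2, by positivity, 3 + 24 * M ^ 2 * (p + 1) / r ^ 2 , by
    have : 0 ≤ 24 * M ^ 2 * (p + 1) / r ^ 2 := by positivity
    linarith, ?_⟩
  intro ε hε hL0
  set L := Real.log (1 / ε) with hL
  have hA0 : 0 ≤ 24 * M ^ 2 * (p + 1) / r ^ 2 := by positivity
  have hL3 : 3 ≤ L := by linarith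
  set s := ε * r with hs
  have hs0 : 0 < s := by positivity
  have hden : ∀ x, 0 < s ^ 2 + sqn (x - y) := fun x => by
    have := sqn_nonneg (x - y); positivity
  set f : ℝ × ℝ → ℝ := fun x => Real.log (r ^ 2) - Real.log (s ^ 2 + sqn (x - y)) with hf
  have hfc : ContDiff ℝ 1 f := by
    have : ContDiff ℝ 1 fun x : ℝ × ℝ => s ^ 2 + sqn (x - y) := by unfold sqn; fun_prop
    exact contDiff_const.sub (this.log fun x => (hden x).ne')
  set C := {x : ℝ × ℝ | sqn (x - y) ≤ r ^ 2} with hC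
  have hsc : Continuous fun x : ℝ × ℝ => sqn (x - y) := by unfold sqn; fun_prop
  have hCc : IsCompact C := by
    refine Metric.isCompact_of_isClosed_isBounded (isClosed_le hsc continuous_const) ?_
    exact D.hb.subset (fun x hx => hin x hx)
  obtain ⟨c1, c2⟩ := zext_th D.ho Subset.rfl hCc (w := f) hfc.contDiffOn (δ := 1) one_pos (by
    intro x _ hx
    have hx' : r ^ 2 < sqn (x - y) := not_le.1 hx
    have : Real.log (r ^ 2) ≤ Real.log (s ^ 2 + sqn (x - y)) :=
      Real.log_le_log (by positivity) (by nlinarith)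
    simp only [hf]; linarith) (fun x hx => hin x hx)
  set ψ := Ω.indicator fun x => th 1 (f x) with hψ
  have hgf : ∀ x, sqn (grad f x) ≤ 4 / (s ^ 2 + sqn (x - y)) := by
    intro x
    have hd : DifferentiableAt ℝ (fun x => s ^ 2 + sqn (x - y)) x := by unfold sqn; fun_prop
    have e : grad f x = -((s ^ 2 + sqn (x - y))⁻¹ • grad (fun x => s ^ 2 + sqn (x - y)) x) := by
      have h1 : grad f x = grad (fun _ => Real.log (r ^ 2)) x
          - grad (fun x => Real.log (s ^ 2 + sqn (x - y))) x :=
        grad_sub (by fun_prop) (hd.log (hden x).ne')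
      rw [h1, grad_const, grad_comp (Real.hasDerivAt_log (hden x).ne') hd, zero_sub]
    have e2 : grad (fun x => s ^ 2 + sqn (x - y)) x = (2 * (x - y).1, 2 * (x - y).2) := by
      have h1 : HasFDerivAt (fun x : ℝ × ℝ => s ^ 2 + ((x.1 - y.1) ^ 2 + (x.2 - y.2) ^ 2))
          (((2 : ℕ) * (x.1 - y.1) ^ (2 - 1)) • ContinuousLinearMap.fst ℝ ℝ ℝ
          + ((2 : ℕ) * (x.2 - y.2) ^ (2 - 1)) • ContinuousLinearMap.snd ℝ ℝ ℝ) x := by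
        apply HasFDerivAt.const_add
        apply HasFDerivAt.add
        · simpa using ((hasFDerivAt_fst (𝕜 := ℝ) (p := x)).sub_const y.1).pow 2
        · simpa using ((hasFDerivAt_snd (𝕜 := ℝ) (p := x)).sub_const y.2).pow 2
      unfold grad
      have h2 : (fun x : ℝ × ℝ => s ^ 2 + sqn (x - y)) =
        fun x : ℝ × ℝ => s ^ 2 + ((x.1 - y.1) ^ 2 + (x.2 - y.2) ^ 2) := by ext x; simp [sqn]
      rw [h2, h1.fderiv]; simp
    rw [e, e2]
    have e3 : sqn (-((s ^ 2 + sqn (x - y))⁻¹ • ((2 * (x - y).1, 2 * (x - y).2) : ℝ × ℝ)))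
        = 4 * sqn (x - y) / (s ^ 2 + sqn (x - y)) ^ 2 := by
      generalize hg : s ^ 2 + sqn (x - y) = g
      have : g ≠ 0 := by rw [← hg]; exact (hden x).ne'
      unfold sqn; simp only [Prod.fst_neg, Prod.snd_neg, Prod.smul_fst, Prod.smul_snd, smul_eq_mul]
      field_simp; ring
    rw [e3, div_le_div_iff₀ (by have := hden x; positivity) (hden x)]
    have := hden x
    nlinarith [sq_nonneg s, mul_nonneg (sq_nonneg s) this.le]
  have hmem : MemH k Ω ψ := D.memH_CT c1
  have hlog2 : Real.log 2 ≤ 1 := by linarith [Real.log_two_lt_d9]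
  have hLe : Real.log ((s ^ 2 + r ^ 2) / s ^ 2) ≤ 3 * L := by
    have e : (s ^ 2 + r ^ 2) / s ^ 2 = 1 + (1 / ε) ^ 2 := by
      rw [hs]; field_simp
    have h1 : 1 ≤ 1 / ε := by
      by_contra h
      push Not at h
      have := Real.log_nonpos (by positivity) h.le
      linarith
    rw [e]
    calc Real.log (1 + (1 / ε) ^ 2) ≤ Real.log (2 * (1 / ε) ^ 2) := by
          apply Real.log_le_log (by positivity); nlinarith
      _ = Real.log 2 + 2 * L := by
          rw [Real.log_mul (by norm_num) (by positivity), Real.log_pow]; push_cast; rfl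
      _ ≤ 3 * L := by linarith
  have hE : Bi k Ω ψ ψ ≤ 48 * L := by
    have hib : IntegrableOn (fun x => 4 / (s ^ 2 + ‖x - y‖ ^ 2)) (Metric.ball y r) := by
      have hc : Continuous fun x : ℝ × ℝ => 4 / (s ^ 2 + ‖x - y‖ ^ 2) := by
        apply Continuous.div (by fun_prop) (by fun_prop)
        intro x; positivity
      exact (hc.continuousOn.integrableOn_compact (isCompact_closedBall y r)).mono_set
        Metric.ball_subset_closedBall
    calc Bi k Ω ψ ψ ≤ ∫ x in Ω, (Metric.ball y r).indicator (fun x => 4 / (s ^ 2 + ‖x - y‖ ^ 2)) x := by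
          unfold Bi
          refine setIntegral_mono_on hmem.2.2.2 ?_ D.ho.measurableSet ?_
          · exact ((integrable_indicator_iff measurableSet_ball).2 hib).integrableOn
          · intro x hx
            rw [c2, indicator_of_mem hx, KH_smul_left, KH_smul_right]
            by_cases hb : x ∈ Metric.ball y r
            · rw [indicator_of_mem hb]
              have t1 := th'_nonneg one_pos (f x)
              have t2 := th'_le_one (δ := 1) (f x)
              have t3 := KH_nonneg (k := k) x (grad f x)
              have t4 := (KH_le D.hk x (grad f x)).trans (hgf x)
              have t5 : 4 / (s ^ 2 + sqn (x - y)) ≤ 4 / (s ^ 2 + ‖x - y‖ ^ 2) := by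
                apply div_le_div_of_nonneg_left (by norm_num) (by positivity)
                linarith [norm_sq_le_sqn (x - y)]
              refine le_trans ?_ (t4.trans t5)
              have t6 : th' 1 (f x) * (th' 1 (f x) * KHform k x (grad f x) (grad f x)) ≤
                  1 * (1 * KHform k x (grad f x) (grad f x)) := by gcongr
              linarith
            · rw [indicator_of_notMem hb]
              have : f x ≤ 1 := by
                rw [Metric.mem_ball, dist_eq_norm, not_lt] at hb
                have h1 : r ^ 2 ≤ sqn (x - y) := le_trans (by nlinarith [norm_nonneg (x - y)]) (norm_sq_le_sqn _)
                have : Real.log (r ^ 2) ≤ Real.log (s ^ 2 + sqn (x - y)) :=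
                  Real.log_le_log (by positivity) (by nlinarith)
                simp only [hf]; linarith
              rw [th'_zero one_pos this]; simp
      _ ≤ ∫ x, (Metric.ball y r).indicator (fun x => 4 / (s ^ 2 + ‖x - y‖ ^ 2)) x := by
          apply setIntegral_le_integral ((integrable_indicator_iff measurableSet_ball).2 hib)
          refine ae_of_all _ fun x => ?_
          apply indicator_nonneg; intro x _; positivity
      _ = 16 * Real.log ((s ^ 2 + r ^ 2) / s ^ 2) := by
          rw [integral_indicator measurableSet_ball, ball_int y hr hs0]
      _ ≤ 48 * L := by linarith
  -- final test function
  have hvm : MemH k Ω (fun x => M * ψ x) := by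
    have := D.memH_lin hmem hmem M 0
    simpa using this
  have hBi : Bi k Ω (fun x => M * ψ x) (fun x => M * ψ x) = M ^ 2 * Bi k Ω ψ ψ := by
    have := D.Bi_lin hmem hmem M 0
    simpa using this
  have hBv : Bi k Ω (fun x => M * ψ x) (fun x => M * ψ x) ≤ 48 * M ^ 2 * L := by
    rw [hBi]; nlinarith [sq_nonneg M, mul_le_mul_of_nonneg_left hE (sq_nonneg M)]
  have hN : L ^ (p + 1) * s ^ 2 ≤ Nl p ε q Ω (fun x => M * ψ x) := by
    have hsub : Metric.ball y (s / 2) ⊆ Ω := by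
      intro x hx
      rw [Metric.mem_ball, dist_eq_norm] at hx
      apply hin
      have h1 := sqn_le_norm_sq (x - y)
      have hε1 : s ≤ r := by
        rw [hs]
        have : ε ≤ 1 := by
          by_contra h
          push Not at h
          have := Real.log_nonpos (x := 1 / ε) (by positivity) (by rw [div_le_one hε]; exact h.le)
          linarith
        nlinarith
      nlinarith [norm_nonneg (x - y)]
    unfold Nl
    calc L ^ (p + 1) * s ^ 2 = ∫ x in Metric.ball y (s / 2), L ^ (p + 1) := by
          rw [setIntegral_const, vol_ball _ _ (by positivity), smul_eq_mul]; ring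
      _ ≤ ∫ x in Metric.ball y (s / 2), pPart (M * ψ x - q x * L) ^ (p + 1) := by
          have hInt := D.int_of_cont (D.pw_cont hvm.1 ε (s := p + 1) (by linarith))
          refine setIntegral_mono_on (integrableOn_const (by exact measure_ball_lt_top.ne)) (hInt.mono_set hsub) measurableSet_ball ?_
          intro x hx
          apply Real.rpow_le_rpow (by linarith) _ (by linarith)
          refine le_trans ?_ (le_max_left _ _)
          have hxΩ := hsub hx
          rw [Metric.mem_ball, dist_eq_norm] at hx
          have h1 := sqn_le_norm_sq (x - y)
          have h2 : s ^ 2 + sqn (x - y) ≤ 2 * s ^ 2 := by nlinarith [norm_nonneg (x - y)]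
          have h3 : 2 * L - 1 ≤ f x := by
            have h4 : Real.log (s ^ 2 + sqn (x - y)) ≤ Real.log (2 * s ^ 2) := Real.log_le_log (hden x) h2
            have h5 : Real.log (2 * s ^ 2) = Real.log 2 + 2 * (-L + Real.log r) := by
              rw [Real.log_mul (by norm_num) (by positivity), Real.log_pow, hs,
                Real.log_mul hε.ne' hr.ne', hL, one_div, Real.log_inv]
              push_cast; ring
            have h6 : Real.log (r ^ 2) = 2 * Real.log r := by rw [Real.log_pow]; push_cast; ring
            simp only [hf]; linarith
          have h7 := th_ge one_pos (f x)
          have h8 : ψ x = th 1 (f x) := by rw [hψ, indicator_of_mem hxΩ]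
          have h9 : L ≤ ψ x := by rw [h8]; linarith
          have h10 := (hq x (subset_closure hxΩ)).2
          nlinarith
      _ ≤ _ := by
          apply setIntegral_mono_set (D.int_of_cont (D.pw_cont hvm.1 ε (s := p + 1) (by linarith)))
          · exact ae_of_all _ fun x => Real.rpow_nonneg (pPart_nonneg _) _
          · exact hsub.eventuallyLE
  have hneg : Ieps k p ε q Ω (fun x => M * ψ x) < 0 := by
    rw [Ieps_eq]
    have h1 : (1 / ((p + 1) * ε ^ 2)) * (L ^ (p + 1) * s ^ 2) = L ^ (p + 1) * r ^ 2 / (p + 1) := by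
      rw [hs]; field_simp
    have h2 := mul_le_mul_of_nonneg_left hN (show 0 ≤ 1 / ((p + 1) * ε ^ 2) by positivity)
    rw [h1] at h2
    have h3 : L * L ≤ L ^ (p + 1) := by
      rw [Real.rpow_add (by linarith), Real.rpow_one]
      have : L ≤ L ^ p := by
        conv_lhs => rw [← Real.rpow_one L]
        exact Real.rpow_le_rpow_of_exponent_le (by linarith) hp.le
      nlinarith
    have h4 : 24 * M ^ 2 * L < L * L * r ^ 2 / (p + 1) := by
      have h5 : 24 * M ^ 2 * (p + 1) / r ^ 2 < L := by linarith
      rw [div_lt_iff₀ (by positivity)] at h5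
      rw [lt_div_iff₀ (by positivity)]
      nlinarith
    have h6 : L * L * r ^ 2 / (p + 1) ≤ L ^ (p + 1) * r ^ 2 / (p + 1) := by gcongr
    linarith
  refine ⟨⟨_, hvm, hneg⟩, ?_⟩
  have hIle : ∀ τ ∈ Icc (0:ℝ) 1, Ieps k p ε q Ω (fun x => τ * (M * ψ x)) ≤ 24 * M ^ 2 * L := by
    intro τ hτ
    rw [Ieps_eq]
    have h1 : Bi k Ω (fun x => τ * (M * ψ x)) (fun x => τ * (M * ψ x))
        = τ ^ 2 * Bi k Ω (fun x => M * ψ x) (fun x => M * ψ x) := by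
      have := D.Bi_lin hvm hvm τ 0
      simpa using this
    rw [h1]
    have h2 := Bi_self_nonneg k Ω (fun x => M * ψ x)
    have h3 := mul_nonneg (show 0 ≤ 1 / ((p + 1) * ε ^ 2) by positivity) (Nl_nonneg p ε q Ω (fun x => τ * (M * ψ x)))
    have h4 : τ ^ 2 ≤ 1 := by nlinarith [hτ.1, hτ.2]
    have h5 := mul_le_mul_of_nonneg_right h4 h2
    linarith
  refine D.path (by linarith) hvm hvm (S := 0) le_rfl hIle ?_ ?_
  · intro s' hs'
    have : s' = 0 := le_antisymm hs'.2 hs'.1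
    have h := hIle 1 (by simp)
    simpa [this] using h
  · simpa using hneg
end

section
variable {k p : ℝ} {Ω : Set (ℝ × ℝ)} {q : ℝ × ℝ → ℝ}

lemma pw_diff {p w t : ℝ} (hp : 1 < p) (hw : 0 ≤ w) (ht : 0 ≤ t) (h : t ≤ w) :
    w ^ (p + 1) - (p + 1) * (w ^ p * (w - t)) ≤ t ^ (p + 1) := by
  rcases hw.eq_or_lt with h0 | h0
  · have : t = 0 := by linarith
    subst this; rw [← h0, Real.zero_rpow (by linarith)]; simp
  have h1 : 0 ≤ t / w := by positivity
  have b := one_add_mul_self_le_rpow_one_add (s := t / w - 1) (by linarith) (p := p + 1) (by linarith)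
  have e : t ^ (p + 1) = w ^ (p + 1) * (1 + (t / w - 1)) ^ (p + 1) := by
    rw [← Real.mul_rpow hw (by linarith)]; congr 1; field_simp; ring
  have e2 : w ^ (p + 1) = w ^ p * w := by rw [Real.rpow_add h0, Real.rpow_one]
  have h2 : 0 ≤ w ^ (p + 1) := by positivity
  have h3 := mul_le_mul_of_nonneg_left b h2
  rw [e]
  refine le_trans (le_of_eq ?_) h3
  rw [e2]; field_simp; ring

lemma s_bound {p s : ℝ} (hp : 1 < p) (hs : 0 ≤ s) :
    s ^ 2 / 2 - s ^ (p + 1) / (p + 1) ≤ 1 / 2 - 1 / (p + 1) := by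
  have b := one_add_mul_self_le_rpow_one_add (s := s ^ 2 - 1) (by nlinarith [sq_nonneg s]) (p := (p + 1) / 2) (by linarith)
  have e : (1 + (s ^ 2 - 1)) ^ ((p + 1) / 2) = s ^ (p + 1) := by
    rw [add_sub_cancel, ← Real.rpow_natCast, ← Real.rpow_mul hs]; congr 1; push_cast; ring
  rw [e] at b
  have hp1 : 0 < p + 1 := by linarith
  have : (1 + (p + 1) / 2 * (s ^ 2 - 1)) / (p + 1) ≤ s ^ (p + 1) / (p + 1) := by gcongr
  have e2 : (1 + (p + 1) / 2 * (s ^ 2 - 1)) / (p + 1) = 1 / (p + 1) + (s ^ 2 - 1) / 2 := by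
    field_simp
  linarith

def wf (q : ℝ × ℝ → ℝ) (ε : ℝ) (u : ℝ × ℝ → ℝ) : ℝ × ℝ → ℝ := fun y => u y - q y * Real.log (1 / ε)

def vB (q : ℝ × ℝ → ℝ) (ε : ℝ) (u : ℝ × ℝ → ℝ) (B : Set (ℝ × ℝ)) (δ : ℝ) : ℝ × ℝ → ℝ :=
  B.indicator fun x => th δ (wf q ε u x)

def XB (p : ℝ) (q : ℝ × ℝ → ℝ) (ε : ℝ) (u : ℝ × ℝ → ℝ) (Ω B : Set (ℝ × ℝ)) (δ : ℝ) : ℝ :=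
  ∫ x in Ω, (1 / ε ^ 2) * pPart (u x - q x * Real.log (1 / ε)) ^ p * vB q ε u B δ x

def aB (p : ℝ) (q : ℝ × ℝ → ℝ) (ε : ℝ) (u : ℝ × ℝ → ℝ) (Ω B : Set (ℝ × ℝ)) : ℝ :=
  ∫ x in Ω, B.indicator (fun x => (1 / ε ^ 2) * pPart (u x - q x * Real.log (1 / ε)) ^ (p + 1)) x

def PB (p : ℝ) (q : ℝ × ℝ → ℝ) (ε : ℝ) (u : ℝ × ℝ → ℝ) (Ω : Set (ℝ × ℝ)) : ℝ :=
  ∫ x in Ω, (1 / ε ^ 2) * pPart (u x - q x * Real.log (1 / ε)) ^ p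

lemma Dat.wf_cont (D : Dat k p Ω q) {ε : ℝ} {u : ℝ × ℝ → ℝ} (hm : MemH k Ω u) :
    ContinuousOn (wf q ε u) (closure Ω) := hm.1.sub (D.hqc.mul continuousOn_const)

lemma Dat.wf_c1 (D : Dat k p Ω q) {ε : ℝ} {u : ℝ × ℝ → ℝ} (hm : MemH k Ω u) :
    ContDiffOn ℝ 1 (wf q ε u) Ω := hm.2.1.sub (D.q1.mul contDiffOn_const)

lemma Dat.wf_fr (D : Dat k p Ω q) {ε : ℝ} (hL : 0 < Real.log (1 / ε)) {u : ℝ × ℝ → ℝ} (hm : MemH k Ω u) :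
    ∀ x ∈ frontier Ω, wf q ε u x < 0 := by
  intro x hx
  unfold wf
  rw [hm.2.2.1 x hx]
  have := D.hq3 x (frontier_subset_closure hx)
  have := mul_pos this hL
  linarith

lemma mem_vcore_iff {ε : ℝ} {u : ℝ × ℝ → ℝ} {x : ℝ × ℝ} :
    x ∈ vcore q Ω ε u ↔ x ∈ Ω ∧ 0 < wf q ε u x := by
  change (x ∈ Ω ∧ q x * Real.log (1 / ε) < u x) ↔ _
  unfold wf; rw [sub_pos]

lemma Dat.vcore_open (D : Dat k p Ω q) {ε : ℝ} {u : ℝ × ℝ → ℝ} (hm : MemH k Ω u) :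
    IsOpen (vcore q Ω ε u) := by
  have : vcore q Ω ε u = Ω ∩ wf q ε u ⁻¹' Ioi 0 := by
    ext x; rw [mem_vcore_iff]; rfl
  rw [this]
  exact ((D.wf_cont hm).mono subset_closure).isOpen_inter_preimage D.ho isOpen_Ioi

lemma Dat.vB_ct (D : Dat k p Ω q) {ε : ℝ} (hL : 0 < Real.log (1 / ε)) {u : ℝ × ℝ → ℝ}
    (hm : MemH k Ω u) {B1 B2 : Set (ℝ × ℝ)} (h1 : IsOpen B1) (h2 : IsOpen B2) (hd : Disjoint B1 B2)
    (hU : B1 ∪ B2 = vcore q Ω ε u) {δ : ℝ} (hδ : 0 < δ) :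
    CT Ω (vB q ε u B1 δ) ∧ ∀ x, grad (vB q ε u B1 δ) x
        = B1.indicator (fun x => th' δ (wf q ε u x) • grad (wf q ε u) x) x := by
  have hsub : B1 ⊆ Ω := fun x hx => (mem_vcore_iff.1 (hU ▸ Or.inl hx : x ∈ vcore q Ω ε u)).1
  refine zext_th h1 hsub (C := (closure Ω ∩ wf q ε u ⁻¹' Ici δ) \ B2) ?_ ((D.wf_c1 hm).mono hsub) hδ ?_ ?_
  · have : IsClosed (closure Ω ∩ wf q ε u ⁻¹' Ici δ) :=
      (D.wf_cont hm).preimage_isClosed_of_isClosed isClosed_closure isClosed_Ici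
    exact (D.cpt.of_isClosed_subset this inter_subset_left).diff h2
  · intro x hx hxC
    by_contra h
    push Not at h
    exact hxC ⟨⟨subset_closure (hsub hx), h.le⟩, fun h' => disjoint_left.1 hd hx h'⟩
  · rintro x ⟨⟨hx1, hx2⟩, hx3⟩
    have hx2 : δ ≤ wf q ε u x := hx2
    have hxΩ : x ∈ Ω := by
      by_contra h
      have := D.wf_fr hL hm x (by rw [D.ho.frontier_eq]; exact ⟨hx1, h⟩)
      linarith
    have : x ∈ vcore q Ω ε u := mem_vcore_iff.2 ⟨hxΩ, by linarith⟩
    rw [← hU] at this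
    exact this.resolve_right hx3

lemma Dat.vB_facts (D : Dat k p Ω q) {ε : ℝ} (hL : 0 < Real.log (1 / ε)) {u : ℝ × ℝ → ℝ}
    (hu : IsMPSolution k p ε q Ω u) {B1 B2 : Set (ℝ × ℝ)} (h1 : IsOpen B1) (h2 : IsOpen B2)
    (hd : Disjoint B1 B2) (hU : B1 ∪ B2 = vcore q Ω ε u) {δ : ℝ} (hδ : 0 < δ) :
    Bi k Ω (vB q ε u B1 δ) (vB q ε u B1 δ) ≤ XB p q ε u Ω B1 δ ∧
    XB p q ε u Ω B1 δ ≤ aB p q ε u Ω B1 ∧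
    aB p q ε u Ω B1 - 2 * δ * PB p q ε u Ω ≤ XB p q ε u Ω B1 δ ∧
    aB p q ε u Ω B1 - (p + 1) * (2 * δ * PB p q ε u Ω) ≤
      (1 / ε ^ 2) * ∫ x in Ω, vB q ε u B1 δ x ^ (p + 1) := by
  have hp := D.hp
  have hm := hu.2.1
  obtain ⟨c, cg⟩ := D.vB_ct hL hm h1 h2 hd hU hδ
  have t := (D.test hu.1 c).2
  have hsub : B1 ⊆ Ω := fun x hx => (mem_vcore_iff.1 (hU ▸ Or.inl hx : x ∈ vcore q Ω ε u)).1
  have cX : IntegrableOn (fun x => (1 / ε ^ 2) * pPart (u x - q x * Real.log (1 / ε)) ^ p * vB q ε u B1 δ x) Ω :=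
    D.int_of_cont ((continuousOn_const.mul (D.pw_cont hm.1 ε (by linarith))).mul c.1.continuous.continuousOn)
  have ca : IntegrableOn (B1.indicator (fun x => (1 / ε ^ 2) * pPart (u x - q x * Real.log (1 / ε)) ^ (p + 1))) Ω :=
    (D.int_of_cont (continuousOn_const.mul (D.pw_cont hm.1 ε (by linarith)))).indicator h1.measurableSet
  have cP : IntegrableOn (fun x => (1 / ε ^ 2) * pPart (u x - q x * Real.log (1 / ε)) ^ p) Ω :=
    D.int_of_cont (continuousOn_const.mul (D.pw_cont hm.1 ε (by linarith)))
  have cb : IntegrableOn (fun x => vB q ε u B1 δ x ^ (p + 1)) Ω :=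
    D.int_of_cont (c.1.continuous.rpow_const (fun _ => Or.inr (by linarith))).continuousOn
  have hw : ∀ x ∈ B1, pPart (wf q ε u x) = wf q ε u x := fun x hx =>
    max_eq_left (mem_vcore_iff.1 (hU ▸ Or.inl hx : x ∈ vcore q Ω ε u)).2.le
  have hwp : ∀ x ∈ B1, 0 < wf q ε u x := fun x hx =>
    (mem_vcore_iff.1 (hU ▸ Or.inl hx : x ∈ vcore q Ω ε u)).2
  have hε2 : 0 ≤ 1 / ε ^ 2 := by positivity
  refine ⟨?_, ?_, ?_, ?_⟩
  · unfold XB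
    rw [← t]
    refine setIntegral_mono_on (D.memH_CT c).2.2.2 (D.int_KH_CT (D.wf_c1 hm) c) D.ho.measurableSet ?_
    intro x hx
    change _ ≤ KHform k x (grad (wf q ε u) x) _
    rw [cg]
    by_cases hxB : x ∈ B1
    · rw [indicator_of_mem hxB, KH_smul_left, KH_smul_right]
      have := th'_nonneg hδ (wf q ε u x)
      have h3 := KH_nonneg (k := k) x (grad (wf q ε u) x)
      exact mul_le_of_le_one_left (mul_nonneg this h3) (th'_le_one _)
    · rw [indicator_of_notMem hxB, KH_zero_left, KH_zero_right]
  · refine setIntegral_mono_on cX ca D.ho.measurableSet ?_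
    intro x hx
    change 1 / ε ^ 2 * pPart (wf q ε u x) ^ p * vB q ε u B1 δ x ≤ B1.indicator (fun x => 1 / ε ^ 2 * pPart (wf q ε u x) ^ (p + 1)) x
    unfold vB
    by_cases hxB : x ∈ B1
    · rw [indicator_of_mem hxB, indicator_of_mem hxB]
      have h3 := th_le hδ (wf q ε u x)
      have := hwp x hxB
      rw [hw x hxB] at h3 ⊢
      rw [Real.rpow_add this, Real.rpow_one, mul_assoc]
      gcongr
    · rw [indicator_of_notMem hxB, indicator_of_notMem hxB]; simp
  · unfold aB PB XB
    rw [← integral_const_mul, ← integral_sub ca (cP.const_mul _)]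
    refine setIntegral_mono_on (ca.sub (cP.const_mul _)) cX D.ho.measurableSet ?_
    intro x hx
    change B1.indicator (fun x => 1 / ε ^ 2 * pPart (wf q ε u x) ^ (p + 1)) x - 2 * δ * (1 / ε ^ 2 * pPart (wf q ε u x) ^ p) ≤ 1 / ε ^ 2 * pPart (wf q ε u x) ^ p * vB q ε u B1 δ x
    have hz : 0 ≤ 1 / ε ^ 2 * pPart (wf q ε u x) ^ p := mul_nonneg hε2 (Real.rpow_nonneg (pPart_nonneg _) _)
    unfold vB
    by_cases hxB : x ∈ B1
    · rw [indicator_of_mem hxB, indicator_of_mem hxB]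
      have h3 := th_lip hδ (wf q ε u x)
      have := hwp x hxB
      rw [hw x hxB] at h3 hz ⊢
      rw [Real.rpow_add this, Real.rpow_one]
      have := mul_le_mul_of_nonneg_left h3 hz
      linarith
    · rw [indicator_of_notMem hxB, indicator_of_notMem hxB]
      have := mul_nonneg (show 0 ≤ 2 * δ by linarith) hz
      linarith
  · unfold aB PB
    rw [← integral_const_mul, ← integral_const_mul, ← integral_const_mul,
      ← integral_sub ca ((cP.const_mul _).const_mul _)]
    refine setIntegral_mono_on (ca.sub ((cP.const_mul _).const_mul _)) (cb.const_mul _) D.ho.measurableSet ?_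
    intro x hx
    change B1.indicator (fun x => 1 / ε ^ 2 * pPart (wf q ε u x) ^ (p + 1)) x - (p + 1) * (2 * δ * (1 / ε ^ 2 * pPart (wf q ε u x) ^ p)) ≤ 1 / ε ^ 2 * vB q ε u B1 δ x ^ (p + 1)
    have hz : 0 ≤ 1 / ε ^ 2 * pPart (wf q ε u x) ^ p := mul_nonneg hε2 (Real.rpow_nonneg (pPart_nonneg _) _)
    unfold vB
    by_cases hxB : x ∈ B1
    · rw [indicator_of_mem hxB, indicator_of_mem hxB]
      have h3 := th_lip hδ (wf q ε u x)
      have h4 := th_le hδ (wf q ε u x)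
      have := hwp x hxB
      rw [hw x hxB] at h3 h4 hz ⊢
      have h5 := pw_diff hp this.le (th_nonneg hδ _) h4
      have h6 := mul_le_mul_of_nonneg_left h5 hε2
      have h7 := mul_le_mul_of_nonneg_left (mul_le_mul_of_nonneg_left h3 hz) (show 0 ≤ p + 1 by linarith)
      refine le_trans ?_ h6
      linarith
    · rw [indicator_of_notMem hxB, indicator_of_notMem hxB, Real.zero_rpow (by linarith)]
      have := mul_nonneg (show 0 ≤ p + 1 by linarith) (mul_nonneg (show 0 ≤ 2 * δ by linarith) hz)
      linarith
end

section
variable {k p : ℝ} {Ω : Set (ℝ × ℝ)} {q : ℝ × ℝ → ℝ}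

lemma Dat.E_s (D : Dat k p Ω q) {ε : ℝ} (hL : 0 < Real.log (1 / ε)) {u : ℝ × ℝ → ℝ}
    (hu : IsMPSolution k p ε q Ω u) {B1 B2 : Set (ℝ × ℝ)} (h1 : IsOpen B1) (h2 : IsOpen B2)
    (hd : Disjoint B1 B2) (hU : B1 ∪ B2 = vcore q Ω ε u) {δ : ℝ} (hδ : 0 < δ) (s : ℝ) :
    MemH k Ω (fun y => u y + ((s - 1) * vB q ε u B1 δ y + (-1) * vB q ε u B2 δ y)) ∧
    Bi k Ω (fun y => u y + ((s - 1) * vB q ε u B1 δ y + (-1) * vB q ε u B2 δ y))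
      (fun y => u y + ((s - 1) * vB q ε u B1 δ y + (-1) * vB q ε u B2 δ y))
      ≤ Bi k Ω u u + (s ^ 2 - 1) * XB p q ε u Ω B1 δ - XB p q ε u Ω B2 δ := by
  have hp := D.hp
  have hm := hu.2.1
  obtain ⟨c1, g1⟩ := D.vB_ct hL hm h1 h2 hd hU hδ
  obtain ⟨c2, g2⟩ := D.vB_ct hL hm h2 h1 hd.symm (by rw [union_comm]; exact hU) hδ
  have y1 := (D.vB_facts hL hu h1 h2 hd hU hδ).1
  have y2 := (D.vB_facts hL hu h2 h1 hd.symm (by rw [union_comm]; exact hU) hδ).1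
  set v1 := vB q ε u B1 δ with hv1
  set v2 := vB q ε u B2 δ with hv2
  have hm1 := D.memH_CT c1
  have hm2 := D.memH_CT c2
  have b12 : Bi k Ω v1 v2 = 0 := by
    unfold Bi
    rw [setIntegral_congr_fun (g := fun _ => (0:ℝ)) D.ho.measurableSet]
    · simp
    · intro x hx
      simp only []
      rw [g1, g2]
      by_cases hx1 : x ∈ B1
      · rw [indicator_of_notMem (disjoint_left.1 hd hx1), KH_zero_right]
      · rw [indicator_of_notMem hx1, KH_zero_left]
  set g : ℝ × ℝ → ℝ := fun y => (s - 1) * v1 y + (-1) * v2 y with hg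
  have cg : CT Ω g := by
    obtain ⟨d1, C1, i1, k1, z1⟩ := c1
    obtain ⟨d2, C2, i2, k2, z2⟩ := c2
    refine ⟨(contDiff_const.mul d1).add (contDiff_const.mul d2), C1 ∪ C2, union_subset i1 i2, k1.union k2, ?_⟩
    intro x hx
    have ha : x ∉ C1 := fun h => hx (Or.inl h)
    have hb : x ∉ C2 := fun h => hx (Or.inr h)
    simp [hg, z1 x ha, z2 x hb]
  have hmg := D.memH_CT cg
  have bg : Bi k Ω g g = (s - 1) ^ 2 * Bi k Ω v1 v1 + Bi k Ω v2 v2 := by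
    rw [hg, D.Bi_lin hm1 hm2 (s - 1) (-1), b12]; ring
  have bu : Bi k Ω u g = (s - 1) * XB p q ε u Ω B1 δ - XB p q ε u Ω B2 δ := by
    unfold Bi
    rw [(D.test hu.1 cg).1]
    unfold XB
    have cX : ∀ v, CT Ω v → IntegrableOn (fun x => (1 / ε ^ 2) * pPart (u x - q x * Real.log (1 / ε)) ^ p * v x) Ω :=
      fun v c => D.int_of_cont ((continuousOn_const.mul (D.pw_cont hm.1 ε (by linarith))).mul c.1.continuous.continuousOn)
    rw [← integral_const_mul, ← integral_sub ((cX v1 c1).const_mul _) (cX v2 c2)]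
    refine setIntegral_congr_fun D.ho.measurableSet fun x hx => ?_
    simp only [hg]; ring
  have hmm := D.memH_lin hm hmg 1 1
  have hbb := D.Bi_lin hm hmg 1 1
  simp only [one_mul] at hmm hbb
  refine ⟨hmm, ?_⟩
  rw [hbb, bu, bg]
  have := mul_le_mul_of_nonneg_left y1 (sq_nonneg (s - 1))
  nlinarith

lemma Dat.a_sum (D : Dat k p Ω q) {ε : ℝ} {u : ℝ × ℝ → ℝ}
    (hm : MemH k Ω u) {B1 B2 : Set (ℝ × ℝ)} (h1 : IsOpen B1) (h2 : IsOpen B2)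
    (hd : Disjoint B1 B2) (hU : B1 ∪ B2 = vcore q Ω ε u) :
    aB p q ε u Ω B1 + aB p q ε u Ω B2 = (1 / ε ^ 2) * Nl p ε q Ω u := by
  have hp := D.hp
  have ci : IntegrableOn (fun x => (1 / ε ^ 2) * pPart (u x - q x * Real.log (1 / ε)) ^ (p + 1)) Ω :=
    (D.int_of_cont (continuousOn_const.mul (D.pw_cont hm.1 ε (s := p + 1) (by linarith))))
  unfold aB Nl
  rw [← integral_add (ci.indicator h1.measurableSet) (ci.indicator h2.measurableSet), ← integral_const_mul]
  refine setIntegral_congr_fun D.ho.measurableSet fun x hx => ?_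
  by_cases hx1 : x ∈ B1
  · simp [indicator_of_mem hx1, indicator_of_notMem (disjoint_left.1 hd hx1)]
  · by_cases hx2 : x ∈ B2
    · simp [indicator_of_mem hx2, indicator_of_notMem hx1]
    · simp only [indicator_of_notMem hx2, indicator_of_notMem hx1]
      have hx3 : x ∉ vcore q Ω ε u := by rw [← hU]; exact fun h => h.elim hx1 hx2
      have : pPart (u x - q x * Real.log (1 / ε)) = 0 := by
        apply max_eq_right
        by_contra h
        push Not at h
        exact hx3 (mem_vcore_iff.2 ⟨hx, h⟩)
      rw [this, Real.zero_rpow (by linarith)]; simp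

lemma Dat.a_pos (D : Dat k p Ω q) {ε : ℝ} (hε : 0 < ε) {u : ℝ × ℝ → ℝ}
    (hm : MemH k Ω u) {B : Set (ℝ × ℝ)} (h1 : IsOpen B) (hB : B ⊆ vcore q Ω ε u) (hne : B.Nonempty) :
    0 < aB p q ε u Ω B := by
  have hp := D.hp
  have hsub : B ⊆ Ω := fun x hx => (hB hx).1
  have hc : ContinuousOn (fun x => (1 / ε ^ 2) * pPart (u x - q x * Real.log (1 / ε)) ^ (p + 1)) (closure Ω) :=
    continuousOn_const.mul (D.pw_cont hm.1 ε (by linarith))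
  have h0 : ∀ x, 0 ≤ (1 / ε ^ 2) * pPart (u x - q x * Real.log (1 / ε)) ^ (p + 1) := fun x =>
    mul_nonneg (by positivity) (Real.rpow_nonneg (pPart_nonneg _) _)
  unfold aB
  rw [setIntegral_indicator h1.measurableSet, inter_eq_self_of_subset_right hsub]
  refine lt_of_le_of_ne (integral_nonneg h0) (fun he => ?_)
  obtain ⟨x, hx⟩ := hne
  have := zero_of_int h1 (hc.mono (hsub.trans subset_closure)) (fun x _ => h0 x)
    ((D.int_of_cont hc).mono_set hsub) he.symm x hx
  have hw := (mem_vcore_iff.1 (hB hx)).2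
  have : 0 < (1 / ε ^ 2) * pPart (u x - q x * Real.log (1 / ε)) ^ (p + 1) := by
    have : 0 < pPart (u x - q x * Real.log (1 / ε)) := lt_max_of_lt_left hw
    positivity
  linarith

lemma Dat.N_s (D : Dat k p Ω q) {ε : ℝ} (hL : 0 < Real.log (1 / ε)) {u : ℝ × ℝ → ℝ}
    (hu : IsMPSolution k p ε q Ω u) {B1 B2 : Set (ℝ × ℝ)} (h1 : IsOpen B1) (h2 : IsOpen B2)
    (hd : Disjoint B1 B2) (hU : B1 ∪ B2 = vcore q Ω ε u) {δ : ℝ} (hδ : 0 < δ) {s : ℝ} (hs : 0 ≤ s) :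
    s ^ (p + 1) * ∫ x in Ω, vB q ε u B1 δ x ^ (p + 1) ≤
      Nl p ε q Ω (fun y => u y + ((s - 1) * vB q ε u B1 δ y + (-1) * vB q ε u B2 δ y)) := by
  have hp := D.hp
  have hm := hu.2.1
  obtain ⟨c1, -⟩ := D.vB_ct hL hm h1 h2 hd hU hδ
  have hmm := (D.E_s hL hu h1 h2 hd hU hδ s).1
  unfold Nl
  rw [← integral_const_mul]
  refine setIntegral_mono_on (D.int_of_cont (continuousOn_const.mul
    (c1.1.continuous.rpow_const (fun _ => Or.inr (by linarith))).continuousOn))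
    (D.int_of_cont (D.pw_cont hmm.1 ε (by linarith))) D.ho.measurableSet ?_
  intro x hx
  by_cases hx1 : x ∈ B1
  · have e2 : vB q ε u B2 δ x = 0 := indicator_of_notMem (disjoint_left.1 hd hx1) _
    have e1 : vB q ε u B1 δ x = th δ (wf q ε u x) := indicator_of_mem hx1 _
    have hw : 0 < wf q ε u x := (mem_vcore_iff.1 (hU ▸ Or.inl hx1 : x ∈ vcore q Ω ε u)).2
    have h3 := th_le hδ (wf q ε u x)
    have h4 := th_nonneg hδ (wf q ε u x)
    rw [show pPart (wf q ε u x) = wf q ε u x from max_eq_left hw.le] at h3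
    simp only [e1, e2]
    rw [← Real.mul_rpow hs h4]
    apply Real.rpow_le_rpow (by positivity) _ (by linarith)
    refine le_trans ?_ (le_max_left _ _)
    unfold wf at h3 h4 ⊢
    linarith
  · have e1 : vB q ε u B1 δ x = 0 := indicator_of_notMem hx1 _
    rw [e1, Real.zero_rpow (by linarith), mul_zero]
    exact Real.rpow_nonneg (pPart_nonneg _) _

lemma pow_win {p : ℝ} (hp : 1 < p) (A B : ℝ) (b : ℝ) (hb : 0 < b) :
    ∃ S ≥ (0:ℝ), A + S ^ 2 * B - b * S ^ (p + 1) < 0 := by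
  have h1 : Tendsto (fun S : ℝ => b * S ^ (p - 1)) atTop atTop :=
    (tendsto_rpow_atTop (by linarith)).const_mul_atTop hb
  obtain ⟨S, hS1, hS⟩ := ((h1.eventually_gt_atTop (|A| + |B|)).and (eventually_ge_atTop 1)).exists
  refine ⟨S, by linarith, ?_⟩
  have e : b * S ^ (p + 1) = (b * S ^ (p - 1)) * S ^ 2 := by
    rw [mul_assoc, ← Real.rpow_natCast S 2, ← Real.rpow_add (by linarith)]; congr 2; push_cast; ring
  rw [e]
  have hS2 : 1 ≤ S ^ 2 := by nlinarith
  have := mul_lt_mul_of_pos_right hS1 (show 0 < S ^ 2 by positivity)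
  nlinarith [le_abs_self A, le_abs_self B, abs_nonneg A, mul_le_mul_of_nonneg_right (le_abs_self B) (show 0 ≤ S ^ 2 by positivity),
    mul_le_mul_of_nonneg_left hS2 (abs_nonneg A)]

lemma Dat.PB_nonneg (p : ℝ) (q : ℝ × ℝ → ℝ) (ε : ℝ) (u : ℝ × ℝ → ℝ) (Ω : Set (ℝ × ℝ)) : 0 ≤ PB p q ε u Ω :=
  integral_nonneg fun _ => mul_nonneg (by positivity) (Real.rpow_nonneg (pPart_nonneg _) _)

set_option maxHeartbeats 1000000 in
lemma Dat.conn (D : Dat k p Ω q) {ε : ℝ} (hε : 0 < ε) (hL : 0 < Real.log (1 / ε)) {u : ℝ × ℝ → ℝ}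
    (hu : IsMPSolution k p ε q Ω u) {B1 B2 : Set (ℝ × ℝ)} (h1 : IsOpen B1) (h2 : IsOpen B2)
    (hd : Disjoint B1 B2) (hU : B1 ∪ B2 = vcore q Ω ε u) (n1 : B1.Nonempty) (n2 : B2.Nonempty) :
    False := by
  have hp := D.hp
  have hm := hu.2.1
  have hU' : B2 ∪ B1 = vcore q Ω ε u := by rw [union_comm]; exact hU
  have a1p := D.a_pos hε hm h1 (hU ▸ subset_union_left) n1
  have a2p := D.a_pos hε hm h2 (hU ▸ subset_union_right) n2
  have asum := D.a_sum hm h1 h2 hd hU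
  set a1 := aB p q ε u Ω B1 with ha1
  set a2 := aB p q ε u Ω B2 with ha2
  have hP := Dat.PB_nonneg p q ε u Ω
  set P := PB p q ε u Ω with hPdef
  set E := Bi k Ω u u with hE
  have hIu : ceps k p q Ω ε = (1 / 2) * E - (a1 + a2) / (p + 1) := by
    rw [← hu.2.2, Ieps_eq, asum]
    congr 1; field_simp
  obtain ⟨S, hS0, hS⟩ := pow_win hp (E / 2) (a1 / 2) (a1 / (2 * (p + 1))) (by positivity)
  set θ := 1 / 2 - 1 / (p + 1) with hθ
  have hθ0 : 0 < θ := by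
    rw [hθ, sub_pos]
    exact one_div_lt_one_div_of_lt (by norm_num) (by linarith)
  have hS' : 0 ≤ S ^ (p + 1) := Real.rpow_nonneg hS0 _
  -- choose δ
  obtain ⟨δ, hδ, hδ1, hδ2⟩ : ∃ δ > 0, 2 * δ * P * (1 + S ^ (p + 1)) ≤ a2 * θ / 2 ∧
      (p + 1) * (2 * δ * P) ≤ a1 / 2 := by
    set K := 2 * P * (1 + S ^ (p + 1)) + (p + 1) * (2 * P) + 1 with hK
    have hK1 : 0 ≤ 2 * P * (1 + S ^ (p + 1)) := by positivity
    have hK2 : 0 ≤ (p + 1) * (2 * P) := by positivity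
    have hKp : 0 < K := by linarith
    have hmin : 0 < min (a2 * θ / 2) (a1 / 2) := by
      apply lt_min <;> positivity
    refine ⟨min (a2 * θ / 2) (a1 / 2) / K, by positivity, ?_, ?_⟩
    · have : min (a2 * θ / 2) (a1 / 2) / K * (2 * P * (1 + S ^ (p + 1))) ≤ min (a2 * θ / 2) (a1 / 2) / K * K := by
        gcongr; linarith
      rw [div_mul_cancel₀ _ hKp.ne'] at this
      have := this.trans (min_le_left _ _)
      linarith
    · have : min (a2 * θ / 2) (a1 / 2) / K * ((p + 1) * (2 * P)) ≤ min (a2 * θ / 2) (a1 / 2) / K * K := by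
        gcongr; linarith
      rw [div_mul_cancel₀ _ hKp.ne'] at this
      have := this.trans (min_le_right _ _)
      linarith
  have hδP : 0 ≤ 2 * δ * P := by positivity
  obtain ⟨-, x1le, x1ge, b1ge⟩ := D.vB_facts hL hu h1 h2 hd hU hδ
  obtain ⟨-, x2le, x2ge, -⟩ := D.vB_facts hL hu h2 h1 hd.symm hU' hδ
  set X1 := XB p q ε u Ω B1 δ
  set X2 := XB p q ε u Ω B2 δ
  set b1 := (1 / ε ^ 2) * ∫ x in Ω, vB q ε u B1 δ x ^ (p + 1) with hb1
  -- upper bound for all s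
  have hIs : ∀ s, 0 ≤ s → Ieps k p ε q Ω (fun y => u y + ((s - 1) * vB q ε u B1 δ y + (-1) * vB q ε u B2 δ y))
      ≤ (1 / 2) * (E + (s ^ 2 - 1) * X1 - X2) - b1 * s ^ (p + 1) / (p + 1) := by
    intro s hs
    rw [Ieps_eq]
    have e1 := (D.E_s hL hu h1 h2 hd hU hδ s).2
    have e2 := mul_le_mul_of_nonneg_left (D.N_s hL hu h1 h2 hd hU hδ hs) (show 0 ≤ 1 / ((p + 1) * ε ^ 2) by positivity)
    have e3 : 1 / ((p + 1) * ε ^ 2) * (s ^ (p + 1) * ∫ x in Ω, vB q ε u B1 δ x ^ (p + 1)) = b1 * s ^ (p + 1) / (p + 1) := by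
      rw [hb1]; field_simp
    rw [e3] at e2
    linarith
  have hM : ∀ s ∈ Icc (0:ℝ) S, Ieps k p ε q Ω (fun y => u y + ((s - 1) * vB q ε u B1 δ y + (-1) * vB q ε u B2 δ y))
      ≤ ceps k p q Ω ε - a2 * θ / 2 := by
    intro s hs
    refine (hIs s hs.1).trans ?_
    rw [hIu]
    have hsp : 0 ≤ s ^ (p + 1) := Real.rpow_nonneg hs.1 _
    have hsS : s ^ (p + 1) ≤ S ^ (p + 1) := Real.rpow_le_rpow hs.1 hs.2 (by linarith)
    have t1 : a1 * s ^ (p + 1) / (p + 1) - 2 * δ * P * S ^ (p + 1) ≤ b1 * s ^ (p + 1) / (p + 1) := by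
      have t2 : (a1 - (p + 1) * (2 * δ * P)) * s ^ (p + 1) / (p + 1) ≤ b1 * s ^ (p + 1) / (p + 1) := by gcongr
      have t3 : (a1 - (p + 1) * (2 * δ * P)) * s ^ (p + 1) / (p + 1) = a1 * s ^ (p + 1) / (p + 1) - 2 * δ * P * s ^ (p + 1) := by
        field_simp
      have t4 : 2 * δ * P * s ^ (p + 1) ≤ 2 * δ * P * S ^ (p + 1) := by gcongr
      linarith
    have t5 := mul_le_mul_of_nonneg_left (s_bound hp hs.1) a1p.le
    have t6 : s ^ 2 * X1 ≤ s ^ 2 * a1 := by gcongr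
    have t7 : a1 * (s ^ 2 / 2 - s ^ (p + 1) / (p + 1)) = s ^ 2 * a1 / 2 - a1 * s ^ (p + 1) / (p + 1) := by ring
    have t8 : (a1 + a2) / (p + 1) = a1 * (1 / (p + 1)) + a2 * (1 / (p + 1)) := by ring
    rw [t7] at t5
    rw [t8]
    have t9 : a2 * θ = a2 / 2 - a2 * (1 / (p + 1)) := by rw [hθ]; ring
    nlinarith
  have hfun : ∀ s : ℝ, (fun y => (u y + ((0 - 1) * vB q ε u B1 δ y + (-1) * vB q ε u B2 δ y)) + s * vB q ε u B1 δ y)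
      = fun y => u y + ((s - 1) * vB q ε u B1 δ y + (-1) * vB q ε u B2 δ y) := by
    intro s; ext y; ring
  have hv0 := (D.E_s hL hu h1 h2 hd hU hδ 0)
  have hv1 := D.memH_CT (D.vB_ct hL hm h1 h2 hd hU hδ).1
  have := D.path hL.le hv0.1 hv1 hS0 (M := ceps k p q Ω ε - a2 * θ / 2) ?_ ?_ ?_
  · have : 0 < a2 * θ / 2 := by positivity
    linarith
  · intro τ hτ
    have b := D.Bi_lin hv0.1 hv0.1 τ 0
    simp only [zero_mul, add_zero] at b
    rw [Ieps_eq, b]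
    have hn := mul_nonneg (show 0 ≤ 1 / ((p + 1) * ε ^ 2) by positivity) (Nl_nonneg p ε q Ω (fun y => τ * (u y + ((0 - 1) * vB q ε u B1 δ y + (-1) * vB q ε u B2 δ y))))
    have hn0 := Bi_self_nonneg k Ω (fun y => u y + ((0 - 1) * vB q ε u B1 δ y + (-1) * vB q ε u B2 δ y))
    have hτ2 : τ ^ 2 ≤ 1 := by nlinarith [hτ.1, hτ.2]
    have h5 := mul_le_mul_of_nonneg_right hτ2 hn0
    have h6 := hv0.2
    rw [hIu]
    have t8 : (a1 + a2) / (p + 1) = a1 / 2 - a1 * θ + (a2 / 2 - a2 * θ) := by rw [hθ]; ring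
    rw [t8]
    have h7 : 2 * δ * P ≤ a2 * θ / 2 := by nlinarith [mul_nonneg hδP hS']
    have h8 : 0 < a1 * θ := by positivity
    norm_num at h5 h6 hn ⊢
    nlinarith
  · intro s hs
    rw [hfun]; exact hM s hs
  · rw [hfun]
    refine (hIs S hS0).trans_lt ?_
    have b1' : a1 / 2 ≤ b1 := by linarith
    have t1 : a1 / 2 * S ^ (p + 1) / (p + 1) ≤ b1 * S ^ (p + 1) / (p + 1) := by gcongr
    have t2 : a1 / 2 * S ^ (p + 1) / (p + 1) = a1 / (2 * (p + 1)) * S ^ (p + 1) := by field_simp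
    have t3 : S ^ 2 * X1 ≤ S ^ 2 * a1 := by gcongr
    have x1n : 0 ≤ X1 := by linarith [show 0 ≤ a1 - 2 * δ * P by nlinarith]
    have x2n : 0 ≤ X2 := by
      have := (D.vB_facts hL hu h2 h1 hd.symm hU' hδ).1
      exact (Bi_self_nonneg _ _ _).trans this
    linarith

lemma Dat.connected (D : Dat k p Ω q) {ε : ℝ} (hε : 0 < ε) (hL : 0 < Real.log (1 / ε)) {u : ℝ × ℝ → ℝ}
    (hu : IsMPSolution k p ε q Ω u) (hpos : 0 < ceps k p q Ω ε) : IsConnected (vcore q Ω ε u) := by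
  refine ⟨D.core_ne hu hpos, ?_⟩
  have hA := D.vcore_open (ε := ε) hu.2.1
  rw [isPreconnected_iff_subset_of_disjoint]
  intro U V hU hV hs hd
  by_contra hcon
  push Not at hcon
  obtain ⟨x, hx, hxV⟩ := not_subset.1 hcon.1
  obtain ⟨y, hy, hyV⟩ := not_subset.1 hcon.2
  refine D.conn hε hL hu (hA.inter hU) (hA.inter hV) ?_ ?_ ⟨y, hy, (hs hy).resolve_right hyV⟩
    ⟨x, hx, (hs hx).resolve_left hxV⟩
  · rw [disjoint_left]
    rintro z ⟨h1, h2⟩ ⟨_, h3⟩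
    have : z ∈ vcore q Ω ε u ∩ (U ∩ V) := ⟨h1, h2, h3⟩
    rw [hd] at this; exact this
  · rw [← inter_union_distrib_left]; exact inter_eq_left.2 hs

/-- the capacity test function -/
lemma Dat.low_energy (D : Dat k p Ω q) {ε : ℝ} (hε : 0 < ε) (hL : 0 < Real.log (1 / ε)) {u : ℝ × ℝ → ℝ}
    (hu : IsMPSolution k p ε q Ω u) : ∃ v, MemH k Ω v ∧ Bi k Ω v v ≤ 2 * ceps k p q Ω ε + 1 ∧
      ∀ x ∈ vcore q Ω ε u, q x * Real.log (1 / ε) ≤ v x := by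
  have hp := D.hp
  have hm := hu.2.1
  have hA := D.vcore_open (ε := ε) hu.2.1
  have hU : vcore q Ω ε u ∪ ∅ = vcore q Ω ε u := union_empty _
  have hd : Disjoint (vcore q Ω ε u) ∅ := disjoint_bot_right
  have hP := Dat.PB_nonneg p q ε u Ω
  set P := PB p q ε u Ω with hPdef
  set δ := 1 / (2 * (P + 1)) with hδd
  have hδ : 0 < δ := by positivity
  obtain ⟨-, -, x1ge, -⟩ := D.vB_facts hL hu hA isOpen_empty hd hU hδ
  obtain ⟨y2, -, -, -⟩ := D.vB_facts hL hu isOpen_empty hA hd.symm (by rw [union_comm]; exact hU) hδ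
  have e := D.E_s hL hu hA isOpen_empty hd hU hδ 0
  have asum := D.a_sum hm hA isOpen_empty hd hU
  have a0 : aB p q ε u Ω ∅ = 0 := by unfold aB; simp
  have hIu : ceps k p q Ω ε = (1 / 2) * Bi k Ω u u - aB p q ε u Ω (vcore q Ω ε u) / (p + 1) := by
    rw [← hu.2.2, Ieps_eq, ← add_zero (aB p q ε u Ω (vcore q Ω ε u)), ← a0, asum]
    congr 1; field_simp
  refine ⟨_, e.1, ?_, ?_⟩
  · have h1 := e.2
    have h2 := (Bi_self_nonneg _ _ _).trans y2
    have an : 0 ≤ aB p q ε u Ω (vcore q Ω ε u) := by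
      rw [a0, add_zero] at asum; rw [asum]; exact mul_nonneg (by positivity) (Nl_nonneg _ _ _ _ _)
    have h3 : aB p q ε u Ω (vcore q Ω ε u) / (p + 1) ≤ aB p q ε u Ω (vcore q Ω ε u) / 2 := by
      gcongr; linarith
    have h4 : 2 * δ * P ≤ 1 := by
      rw [hδd]
      have : 2 * (1 / (2 * (P + 1))) * P = P / (P + 1) := by field_simp
      rw [this, div_le_one (by linarith)]; linarith
    norm_num at h1 ⊢
    linarith
  · intro x hx
    have e1 : vB q ε u (vcore q Ω ε u) δ x = th δ (wf q ε u x) := indicator_of_mem hx _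
    have e2 : vB q ε u ∅ δ x = 0 := by simp [vB]
    have hw := (mem_vcore_iff.1 hx).2
    have h3 := th_le hδ (wf q ε u x)
    rw [show pPart (wf q ε u x) = wf q ε u x from max_eq_left hw.le] at h3
    rw [e1, e2]
    unfold wf at h3 ⊢
    linarith
end


lemma dE_cont (y : ℝ × ℝ) : Continuous fun x => dE y x := by
  unfold dE; fun_prop

lemma dE_nonneg (y x : ℝ × ℝ) : 0 ≤ dE y x := Real.sqrt_nonneg _

lemma dE_self (y : ℝ × ℝ) : dE y y = 0 := by simp [dE]

lemma dE_comm (y x : ℝ × ℝ) : dE y x = dE x y := by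
  unfold dE; congr 1; ring

lemma dE_pos {y x : ℝ × ℝ} (h : y ≠ x) : 0 < dE y x := by
  apply Real.sqrt_pos.2
  by_contra hc
  push Not at hc
  apply h
  ext
  · nlinarith [sq_nonneg (y.1 - x.1), sq_nonneg (y.2 - x.2)]
  · nlinarith [sq_nonneg (y.1 - x.1), sq_nonneg (y.2 - x.2)]

lemma exists_pt (y x : ℝ × ℝ) : ∃ φ ∈ Icc (-π) π, x = pt y (dE y x) φ := by
  set z : ℂ := ⟨x.1 - y.1, x.2 - y.2⟩ with hz
  have hn : ‖z‖ = dE y x := by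
    rw [Complex.norm_def, Complex.normSq_apply]; unfold dE; congr 1; simp [hz]; ring
  refine ⟨z.arg, ⟨(Complex.neg_pi_lt_arg z).le, Complex.arg_le_pi z⟩, ?_⟩
  have h1 := Complex.norm_mul_cos_arg z
  have h2 := Complex.norm_mul_sin_arg z
  rw [hn] at h1 h2
  unfold pt
  rw [h1, h2]
  simp [hz]

lemma meets_A {A : Set (ℝ × ℝ)} (hA : IsPreconnected A) {a0 a1 : ℝ × ℝ} (h0 : a0 ∈ A) (h1 : a1 ∈ A)
    {ρ : ℝ} (hρ0 : 0 ≤ ρ) (hρ : ρ ≤ dE a0 a1) : ∃ x ∈ A, dE a0 x = ρ := by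
  have := hA.intermediate_value h0 h1 (dE_cont a0).continuousOn
  simp only [dE_self] at this
  obtain ⟨x, hx, e⟩ := this ⟨hρ0, hρ⟩
  exact ⟨x, hx, e⟩

lemma dE_ball_bdd (y : ℝ × ℝ) (ρ : ℝ) : IsCompact {x | dE y x ≤ ρ} := by
  refine Metric.isCompact_of_isClosed_isBounded (isClosed_le (dE_cont y) continuous_const) ?_
  refine (Metric.isBounded_closedBall (x := y) (r := ρ)).subset ?_
  intro x hx
  rw [Metric.mem_closedBall, dist_eq_norm, Prod.norm_def]
  have hx : dE y x ≤ ρ := hx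
  refine le_trans ?_ hx
  unfold dE
  apply max_le <;> rw [Real.norm_eq_abs] <;> apply Real.abs_le_sqrt <;> simp <;> nlinarith [sq_nonneg (x.1 - y.1), sq_nonneg (x.2 - y.2)]

lemma meets_compl {Ω : Set (ℝ × ℝ)} (ho : IsOpen Ω) (hs : SimplyConnectedSpace ↥Ω) {a0 b : ℝ × ℝ}
    (hb : b ∉ Ω) {ρ : ℝ} (hρ : dE a0 b < ρ) : ∃ x ∉ Ω, dE a0 x = ρ := by
  by_contra hcon
  push Not at hcon
  have hF := noHole_of_simplyConnected Ω ho hs ({x | dE a0 x ≤ ρ} \ Ω) ((dE_ball_bdd a0 ρ).diff ho)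
    disjoint_sdiff_left (by
      have : Ω ∪ ({x | dE a0 x ≤ ρ} \ Ω) = Ω ∪ {x | dE a0 x < ρ} := by
        ext x
        constructor
        · rintro (h | ⟨h, h'⟩)
          · exact Or.inl h
          · exact Or.inr (show dE a0 x < ρ from lt_of_le_of_ne h (hcon x h'))
        · rintro (h | h)
          · exact Or.inl h
          · by_cases hx : x ∈ Ω
            · exact Or.inl hx
            · exact Or.inr ⟨show dE a0 x ≤ ρ from le_of_lt h, hx⟩
      rw [this]
      exact ho.union (isOpen_lt (dE_cont a0) continuous_const))
  have : b ∈ ({x | dE a0 x ≤ ρ} \ Ω) := ⟨hρ.le, hb⟩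
  rw [hF] at this; exact this

lemma circ_osc {g : ℝ × ℝ → ℝ} (hg : ContDiff ℝ 1 g) (y : ℝ × ℝ) {ρ : ℝ} {x : ℝ × ℝ} (hx : dE y x = ρ)
    (h : ∫ φ in (-π)..π, ρ ^ 2 * sqn (grad g (pt y ρ φ)) < 1 / (32 * π)) :
    ∀ φ ∈ Icc (-π) π, |g (pt y ρ φ) - g x| ≤ 1 / 4 := by
  intro φ hφ
  obtain ⟨a, ha, e⟩ := exists_pt y x
  rw [hx] at e
  have := circle_osc hg y ρ ha hφ
  rw [← e] at this
  apply abs_le_of_sq_le_sq _ (by norm_num)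
  have h2 : 2 * π * ∫ φ in (-π)..π, ρ ^ 2 * sqn (grad g (pt y ρ φ)) ≤ 2 * π * (1 / (32 * π)) := by
    have := Real.pi_pos
    gcongr
  have h3 : 2 * π * (1 / (32 * π)) = 1 / 16 := by field_simp; norm_num
  linarith

lemma capacity {Ω A : Set (ℝ × ℝ)} (ho : IsOpen Ω) (hs : SimplyConnectedSpace ↥Ω) (hA : IsPreconnected A)
    {g : ℝ × ℝ → ℝ} (hg : CT Ω g) (hgA : ∀ x ∈ A, 1 ≤ g x) {G : ℝ} (hG0 : 0 < G)
    (hG : ∫ x, sqn (grad g x) ≤ G) (hG1 : G < Real.log 2 / (32 * π)) (hG2 : 4 * Real.exp (-(π / (2 * G))) < 1)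
    {a0 a1 b : ℝ × ℝ} (h0 : a0 ∈ A) (h1 : a1 ∈ A) (hb : b ∉ Ω) :
    dE a0 a1 ≤ 4 * Real.exp (-(π / (2 * G))) * dE a0 b := by
  have hpi := Real.pi_pos
  obtain ⟨hg1, C, hCΩ, hCc, hgz⟩ := id hg
  have hgo : ∀ x ∉ Ω, g x = 0 := fun x hx => hgz x fun h => hx (hCΩ h)
  have hne : a0 ≠ b := by
    rintro rfl
    have := hgA _ h0
    rw [hgo _ hb] at this; norm_num at this
  by_cases h01 : a0 = a1
  · rw [← h01, dE_self]; have := dE_nonneg a0 b; positivity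
  set d := dE a0 a1 with hd
  set D := dE a0 b with hD
  have hd0 : 0 < d := dE_pos h01
  have hD0 : 0 < D := dE_pos hne
  set τ := min d D with hτ
  have hτ0 : 0 < τ := lt_min hd0 hD0
  have hFc : Continuous fun x => sqn (grad g x) := by
    have := CT_grad_cont hg
    unfold sqn; fun_prop
  have hF0 : ∀ x, 0 ≤ sqn (grad g x) := fun x => sqn_nonneg _
  have hFi := sqn_int hg
  have hm : ∫ x, sqn (grad g x) < 1 / (32 * π) * Real.log 2 := by
    have : 1 / (32 * π) * Real.log 2 = Real.log 2 / (32 * π) := by ring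
    linarith
  obtain ⟨ρ1, ⟨l1, u1⟩, i1⟩ := polar_radius hFc hF0 hFi a0 (r1 := τ / 2) (r2 := τ) (m := 1 / (32 * π)) (by positivity)
    (by linarith) (by rw [show τ / (τ / 2) = 2 by field_simp]; exact hm)
  obtain ⟨ρ2, ⟨l2, u2⟩, i2⟩ := polar_radius hFc hF0 hFi a0 (r1 := D) (r2 := 2 * D) (m := 1 / (32 * π)) hD0
    (by linarith) (by rw [show 2 * D / D = 2 by field_simp]; exact hm)
  have hτd : τ ≤ d := min_le_left _ _
  have hτD : τ ≤ D := min_le_right _ _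
  have hρ1 : 0 < ρ1 := by linarith
  obtain ⟨x1, hx1, e1⟩ := meets_A hA h0 h1 hρ1.le (by linarith)
  obtain ⟨x2, hx2, e2⟩ := meets_compl ho hs hb l2
  have o1 := circ_osc hg1 a0 e1 i1
  have o2 := circ_osc hg1 a0 e2 i2
  have g1 := hgA x1 hx1
  have g2 := hgo x2 hx2
  have sb := sector_bound (g := g) hFc hF0 hFi a0 (r1 := ρ1) (r2 := ρ2) (α := -π) (β := π) (D0 := 1 / 2) hρ1
    (by linarith) le_rfl le_rfl (by linarith) isOpen_univ hg1.contDiffOn (fun _ _ _ _ => mem_univ _)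
    (fun _ _ _ _ => le_rfl) (by norm_num) (by
      intro φ hφ
      have a := abs_le.1 (o1 φ (Ioo_subset_Icc_self hφ))
      have b := abs_le.1 (o2 φ (Ioo_subset_Icc_self hφ))
      rw [abs_sub_comm]
      refine le_trans ?_ (le_abs_self _)
      linarith [a.1, a.2, b.1, b.2])
  have hl0 : 0 < Real.log (ρ2 / ρ1) := Real.log_pos (by rw [lt_div_iff₀ hρ1]; linarith)
  have hl : Real.log (ρ2 / ρ1) ≤ Real.log (4 * D / τ) := by
    apply Real.log_le_log (by have : 0 < ρ2 := by linarith
                              positivity)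
    rw [div_le_div_iff₀ hρ1 hτ0]
    nlinarith
  have hk : π / (2 * G) ≤ Real.log (4 * D / τ) := by
    refine le_trans ?_ hl
    have : (π - -π) * ((1 / 2) ^ 2 / Real.log (ρ2 / ρ1)) ≤ G := sb.trans hG
    have e : (π - -π) * ((1 / 2) ^ 2 / Real.log (ρ2 / ρ1)) = π / 2 / Real.log (ρ2 / ρ1) := by ring
    rw [e, div_le_iff₀ hl0] at this
    rw [div_le_iff₀ (by positivity)]
    linarith
  have hex : τ ≤ 4 * Real.exp (-(π / (2 * G))) * D := by
    have h4 : Real.exp (π / (2 * G)) ≤ 4 * D / τ := by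
      rw [← Real.exp_log (show 0 < 4 * D / τ by positivity)]
      exact Real.exp_le_exp.2 hk
    rw [le_div_iff₀ hτ0] at h4
    rw [Real.exp_neg]
    have := Real.exp_pos (π / (2 * G))
    rw [show 4 * (Real.exp (π / (2 * G)))⁻¹ * D = (4 * D) / Real.exp (π / (2 * G)) by field_simp, le_div_iff₀ this]
    linarith
  have hlt : τ < D := by
    refine hex.trans_lt ?_
    nlinarith
  have : τ = d := by
    rw [hτ]; apply min_eq_left
    by_contra h
    push Not at h
    rw [hτ, min_eq_right h.le] at hlt
    linarith
  rw [← this]; exact hex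

section
variable {k p : ℝ} {Ω : Set (ℝ × ℝ)} {q : ℝ × ℝ → ℝ}

lemma Dat.cap_fun (D : Dat k p Ω q) : ∃ C > 0, ∃ L0 ≥ (1:ℝ), ∀ ε > 0, L0 ≤ Real.log (1 / ε) →
    ∀ u, IsMPSolution k p ε q Ω u → 0 < ceps k p q Ω ε ∧
    ∃ g, CT Ω g ∧ (∀ x ∈ vcore q Ω ε u, 1 ≤ g x) ∧ ∫ x, sqn (grad g x) ≤ C / Real.log (1 / ε) := by
  obtain ⟨C, hC, L0, hL0, hup⟩ := D.upper
  obtain ⟨κ, hκ, hell⟩ := D.ell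
  obtain ⟨m, hm, M, hM, hq⟩ := D.qbd
  refine ⟨4 / m ^ 2 * (κ⁻¹ * (2 * C + 1)), by positivity, L0, hL0, ?_⟩
  intro ε hε hL u hu
  obtain ⟨⟨v', hv', hneg⟩, hce⟩ := hup ε hε hL
  set L := Real.log (1 / ε) with hLd
  have hL1 : 1 ≤ L := by linarith
  have hLp : 0 < Real.log (1 / ε) := by linarith
  refine ⟨D.ceps_pos hε hLp hv' hneg, ?_⟩
  obtain ⟨v, hv, hE, hvA⟩ := D.low_energy hε hLp hu
  set δ := m * L / 4 with hδ
  have hδ0 : 0 < δ := by positivity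
  obtain ⟨c, cg⟩ := D.ct_th hv.1 hv.2.1 (fun x hx => (hv.2.2.1 x hx).le) hδ0
  have hs := D.sqn_th_le hκ hell hv hδ0
  set T := Ω.indicator fun x => th δ (v x) with hT
  refine ⟨fun x => 2 / (m * L) * T x, ?_, ?_, ?_⟩
  · obtain ⟨d, S, i, c, z⟩ := c
    exact ⟨contDiff_const.mul d, S, i, c, fun x hx => by simp [z x hx]⟩
  · intro x hx
    have hxΩ := hx.1
    have h1 := hvA x hx
    have h2 := (hq x (subset_closure hxΩ)).1
    have h3 := th_ge hδ0 (v x)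
    have h4 : T x = th δ (v x) := indicator_of_mem hxΩ _
    simp only [h4]
    have h5 : m * L ≤ q x * L := by gcongr
    have h6 : m * L / 2 ≤ th δ (v x) := by
      rw [hδ] at h3 ⊢; linarith
    calc (1:ℝ) = 2 / (m * L) * (m * L / 2) := by field_simp
      _ ≤ _ := by gcongr
  · obtain ⟨S, hS1, hS2, hz, hgz⟩ := CT_grad_zero c
    have e : ∀ x, sqn (grad (fun x => 2 / (m * L) * T x) x) = (4 / (m * L) ^ 2) * sqn (grad T x) := by
      intro x
      rw [grad_smul (c.1.differentiable (by norm_num) x)]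
      unfold sqn; simp only [Prod.smul_fst, Prod.smul_snd, smul_eq_mul]; ring
    simp_rw [e]
    rw [integral_const_mul]
    have e2 : ∫ x, sqn (grad T x) = ∫ x in Ω, sqn (grad T x) := by
      symm; apply setIntegral_eq_integral_of_forall_compl_eq_zero
      intro x hx
      rw [hgz x fun h => hx (hS1 h)]; simp [sqn]
    rw [e2]
    have h1 : κ⁻¹ * Bi k Ω v v ≤ κ⁻¹ * ((2 * C + 1) * L) := by
      gcongr
      nlinarith
    calc 4 / (m * L) ^ 2 * ∫ x in Ω, sqn (grad T x) ≤ 4 / (m * L) ^ 2 * (κ⁻¹ * ((2 * C + 1) * L)) := by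
          gcongr; exact hs.trans h1
      _ = 4 / m ^ 2 * (κ⁻¹ * (2 * C + 1)) / L := by field_simp
end

section
variable {k p : ℝ} {Ω : Set (ℝ × ℝ)} {q : ℝ × ℝ → ℝ}

lemma Dat.hole_sub (D : Dat k p Ω q) {A F : Set (ℝ × ℝ)} (hA : A ⊆ Ω) (hF : IsCompact F)
    (hU : IsOpen (A ∪ F)) : A ∪ F ⊆ Ω := by
  have h := noHole_of_simplyConnected Ω D.ho D.hsc (F \ Ω) (hF.diff D.ho) disjoint_sdiff_left (by
    have : Ω ∪ F \ Ω = Ω ∪ (A ∪ F) := by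
      ext x; simp only [mem_union, Set.mem_sdiff]; constructor
      · rintro (h | h)
        · exact Or.inl h
        · exact Or.inr (Or.inr h.1)
      · rintro (h | h | h)
        · exact Or.inl h
        · exact Or.inl (hA h)
        · by_cases hx : x ∈ Ω
          · exact Or.inl hx
          · exact Or.inr ⟨h, hx⟩
    rw [this]; exact D.ho.union hU)
  exact union_subset hA (sdiff_eq_empty.1 h)

lemma Dat.hole_zero (D : Dat k p Ω q) {ε : ℝ} {u : ℝ × ℝ → ℝ}
    (hu : IsMPSolution k p ε q Ω u) {F : Set (ℝ × ℝ)} (hF : IsCompact F)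
    (hd : Disjoint F (vcore q Ω ε u)) (hU : IsOpen (vcore q Ω ε u ∪ F)) :
    ∀ x ∈ vcore q Ω ε u ∪ F, 0 ≤ wf q ε u x := by
  have hm := hu.2.1
  have hUΩ := D.hole_sub (fun x hx => hx.1) hF hU
  set U := vcore q Ω ε u ∪ F with hUd
  set w := wf q ε u with hw
  have hw1 : ContDiffOn ℝ 1 w U := (D.wf_c1 hm).mono hUΩ
  have key : ∀ δ > 0, ∀ x ∈ U, - w x ≤ δ := by
    intro δ hδ
    set C := {x ∈ F | δ ≤ - w x} with hC
    have hFU : F ⊆ U := subset_union_right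
    have hCc : IsCompact C := by
      have hc : ContinuousOn (fun x => - w x) F := (hw1.continuousOn.mono hFU).neg
      have : IsClosed (F ∩ (fun x => - w x) ⁻¹' Ici δ) := hc.preimage_isClosed_of_isClosed hF.isClosed isClosed_Ici
      exact hF.of_isClosed_subset this inter_subset_left
    have hCU : C ⊆ U := fun x hx => hFU hx.1
    obtain ⟨c, cg⟩ := zext_th (w := fun x => - w x) hU hUΩ hCc hw1.neg hδ (by
      intro x hx hxC
      rcases hx with hx | hx
      · have := (mem_vcore_iff.1 hx).2
        simp only [hw]; linarith
      · by_contra h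
        push Not at h
        exact hxC ⟨hx, h.le⟩) hCU
    set ψ := U.indicator fun x => th δ (- w x) with hψ
    have ht := (D.test hu.1 c).2
    have hR : ∫ x in Ω, (1 / ε ^ 2) * pPart (u x - q x * Real.log (1 / ε)) ^ p * ψ x = 0 := by
      rw [setIntegral_congr_fun (g := fun _ => (0:ℝ)) D.ho.measurableSet]
      · simp
      · intro x hx
        simp only []
        by_cases h : 0 < w x
        · have : ψ x = 0 := by
            by_cases hxU : x ∈ U
            · rw [hψ, indicator_of_mem hxU]; exact th_zero (by linarith)
            · exact indicator_of_notMem hxU _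
          rw [this, mul_zero]
        · have : pPart (u x - q x * Real.log (1 / ε)) = 0 := max_eq_right (not_lt.1 h)
          rw [this, Real.zero_rpow (by linarith [D.hp])]; simp
    rw [hR] at ht
    have hi := D.int_KH_CT (f := w) (D.wf_c1 hm) c
    set h := fun x => th' δ (- w x) * KHform k x (grad w x) (grad w x) with hh
    have e : ∀ x, KHform k x (grad w x) (grad ψ x) = - U.indicator h x := by
      intro x
      rw [cg]
      by_cases hx : x ∈ U
      · rw [indicator_of_mem hx, indicator_of_mem hx, KH_smul_right, grad_neg,
          show -grad w x = (-1:ℝ) • grad w x by simp, KH_smul_right]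
        simp only [hh]; ring
      · rw [indicator_of_notMem hx, indicator_of_notMem hx, KH_zero_right]; simp
    have hi2 : IntegrableOn (U.indicator h) Ω := by
      have : U.indicator h = fun x => - KHform k x (grad w x) (grad ψ x) := by
        funext x; rw [e]; simp
      rw [this]; exact hi.neg
    have hi3 : IntegrableOn h U := by
      have h3 := hi2.mono_set hUΩ
      exact h3.congr_fun (fun x hx => indicator_of_mem hx _) hU.measurableSet
    have hz : ∫ x in U, h x = 0 := by
      have e1 : ∫ x in Ω, - U.indicator h x = 0 := by
        rw [← ht]; exact setIntegral_congr_fun D.ho.measurableSet fun x _ => (e x).symm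
      rw [integral_neg, setIntegral_indicator hU.measurableSet, inter_eq_self_of_subset_right hUΩ] at e1
      linarith
    have hcont : ContinuousOn h U := by
      refine ContinuousOn.mul ((th'_cont hδ).comp_continuousOn hw1.continuousOn.neg) ?_
      exact KH_cont D.hk (grad_cont hU hw1) (grad_cont hU hw1)
    have hz2 := zero_of_int hU hcont (fun x _ => mul_nonneg (th'_nonneg hδ _) (KH_nonneg _ _)) hi3 hz
    have hgz : ∀ x, grad ψ x = 0 := by
      intro x
      rw [cg]
      by_cases hx : x ∈ U
      · rw [indicator_of_mem hx, grad_neg]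
        rcases mul_eq_zero.1 (hz2 x hx) with h0 | h0
        · rw [h0]; simp
        · rw [D.grad_zero_of_KH (hUΩ hx) h0]; simp
      · exact indicator_of_notMem hx _
    have hconst := is_const_of_fderiv_eq_zero (c.1.differentiable (by norm_num))
      (fun x => fderiv_zero_of_grad (hgz x))
    obtain ⟨b, hb⟩ := frontier_ne D.ho D.hc.nonempty D.hb
    have hbU : b ∉ U := fun h => by
      have := hUΩ h
      rw [D.ho.frontier_eq] at hb; exact hb.2 this
    intro x hx
    by_contra hcon
    push Not at hcon
    have h1 := hconst x b
    rw [hψ, indicator_of_mem hx, indicator_of_notMem hbU] at h1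
    exact (th_pos hδ hcon).ne' h1
  intro x hx
  by_contra h
  push Not at h
  have := key (- w x / 2) (by linarith) x hx
  linarith

end


lemma zext_cont {U C : Set (ℝ × ℝ)} (hU : IsOpen U) (hC : IsCompact C) (hCU : C ⊆ U)
    {g : ℝ × ℝ → ℝ} (hg : ContinuousOn g U) (h0 : ∀ x ∈ U, x ∉ C → g x = 0) :
    Continuous (U.indicator g) ∧ HasCompactSupport (U.indicator g) := by
  have hz : ∀ x ∉ C, U.indicator g x = 0 := by
    intro x hx
    by_cases hxU : x ∈ U
    · rw [indicator_of_mem hxU]; exact h0 x hxU hx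
    · exact indicator_of_notMem hxU _
  refine ⟨?_, cs_of_zero hC hz⟩
  rw [continuous_iff_continuousAt]
  intro x
  by_cases hxU : x ∈ U
  · have : U.indicator g =ᶠ[𝓝 x] g := by
      filter_upwards [hU.mem_nhds hxU] with y hy using indicator_of_mem hy _
    exact (hg.continuousAt (hU.mem_nhds hxU)).congr this.symm
  · have : U.indicator g =ᶠ[𝓝 x] fun _ => 0 := by
      filter_upwards [hC.isClosed.isOpen_compl.mem_nhds fun h => hxU (hCU h)] with y hy using hz y hy
    exact continuousAt_const.congr this.symm

section
variable {k p : ℝ} {Ω : Set (ℝ × ℝ)} {q : ℝ × ℝ → ℝ}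

lemma Dat.log_cacc (D : Dat k p Ω q) {ε : ℝ} {u : ℝ × ℝ → ℝ}
    (hu : IsMPSolution k p ε q Ω u) {U : Set (ℝ × ℝ)} (hU : IsOpen U) (hUΩ : U ⊆ Ω)
    (hw0 : ∀ x ∈ U, 0 ≤ wf q ε u x) {χ : ℝ × ℝ → ℝ} (hχ : CT U χ)
    {κ : ℝ} (hell : ∀ x ∈ Ω, ∀ a, κ * sqn a ≤ KHform k x a a) {σ : ℝ} (hσ : 0 < σ) :
    ContDiffOn ℝ 1 (fun y => Real.log (wf q ε u y + σ)) U ∧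
    Continuous (U.indicator fun x => χ x ^ 2 * sqn (grad (fun y => Real.log (wf q ε u y + σ)) x)) ∧
    Integrable (U.indicator fun x => χ x ^ 2 * sqn (grad (fun y => Real.log (wf q ε u y + σ)) x)) ∧
    κ * ∫ x, (U.indicator fun x => χ x ^ 2 * sqn (grad (fun y => Real.log (wf q ε u y + σ)) x)) x
      ≤ 4 * ∫ x in Ω, KHform k x (grad χ x) (grad χ x) := by
  have hm := hu.2.1
  set w := wf q ε u with hw
  have hw1 : ContDiffOn ℝ 1 w U := (D.wf_c1 hm).mono hUΩ
  have hpos : ∀ x ∈ U, 0 < w x + σ := fun x hx => by linarith [hw0 x hx]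
  set f := fun y => Real.log (w y + σ) with hf
  have hf1 : ContDiffOn ℝ 1 f U := (hw1.add contDiffOn_const).log fun x hx => (hpos x hx).ne'
  obtain ⟨C, hCU, hC, hz, hgz⟩ := CT_grad_zero hχ
  have hχΩ : CT Ω χ := ⟨hχ.1, C, hCU.trans hUΩ, hC, hz⟩
  have hgc := grad_cont hU hf1
  have hsc : ContinuousOn (fun x => χ x ^ 2 * sqn (grad f x)) U := by
    refine (hχ.1.continuous.continuousOn.pow 2).mul ?_
    have : Continuous sqn := by unfold sqn; fun_prop
    exact this.comp_continuousOn hgc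
  obtain ⟨hFc, hFs⟩ := zext_cont hU hC hCU hsc (fun x hx hxC => by rw [hz x hxC]; simp)
  have hFi := hFc.integrable_of_hasCompactSupport hFs (μ := volume)
  refine ⟨hf1, hFc, hFi, ?_⟩
  set F := U.indicator fun x => χ x ^ 2 * sqn (grad f x) with hF
  set g := fun x => χ x ^ 2 * (w x + σ)⁻¹ with hg
  have hg1 : ContDiffOn ℝ 1 g U := (hχ.1.contDiffOn.pow 2).mul
    ((hw1.add contDiffOn_const).inv fun x hx => (hpos x hx).ne')
  obtain ⟨z1, z2, z3⟩ := zext_contDiff hU hC hg1 (fun x hx hxC => by simp [hg, hz x hxC]) hCU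
  set ψ := U.indicator g with hψ
  have hψ1 : CT Ω ψ := ⟨z1, C, hCU.trans hUΩ, hC, z2⟩
  have ht := (D.test hu.1 hψ1).2
  have hR : 0 ≤ ∫ x in Ω, (1 / ε ^ 2) * pPart (u x - q x * Real.log (1 / ε)) ^ p * ψ x := by
    refine integral_nonneg fun x => ?_
    refine mul_nonneg (mul_nonneg (by positivity) (Real.rpow_nonneg (pPart_nonneg _) _)) ?_
    exact indicator_nonneg (fun y hy => mul_nonneg (sq_nonneg _) (inv_nonneg.2 (hpos y hy).le)) x
  rw [← ht] at hR
  have hi := D.int_KH_CT (f := w) (D.wf_c1 hm) hψ1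
  have hi2 := D.int_KH_CT (f := χ) hχ.1.contDiffOn hχΩ
  have hpt : ∀ x ∈ Ω, KHform k x (grad w x) (grad ψ x) ≤
      - (κ / 2 * F x) + 2 * KHform k x (grad χ x) (grad χ x) := by
    intro x hx
    have hnn := KH_nonneg (k := k) x (grad χ x)
    by_cases hxU : x ∈ U
    · have hwd := diffAt_of hU hw1 hxU
      have hχd : DifferentiableAt ℝ χ x := hχ.1.differentiable (by norm_num) x
      have hp0 := hpos x hxU
      have g1 : grad f x = (w x + σ)⁻¹ • grad w x := by
        have := grad_comp (φ := fun t => Real.log (t + σ)) (f := w) (x := x)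
          ((Real.hasDerivAt_log hp0.ne').comp_add_const (w x) σ) hwd
        exact this
      have g2 : grad (fun y => (w y + σ)⁻¹) x = (-((w x + σ) ^ 2)⁻¹) • grad w x :=
        grad_comp (φ := fun t => (t + σ)⁻¹) (f := w) (x := x)
          ((hasDerivAt_inv hp0.ne').comp_add_const (w x) σ) hwd
      have g3 : grad (fun y => χ y ^ 2) x = (2 * χ x) • grad χ x := by
        have := grad_comp (φ := fun t => t ^ 2) (f := χ) (x := x) (hasDerivAt_pow 2 (χ x)) hχd
        simpa using this
      have g4 : grad g x = χ x ^ 2 • grad (fun y => (w y + σ)⁻¹) x + (w x + σ)⁻¹ • grad (fun y => χ y ^ 2) x :=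
        grad_mul (hχd.pow 2) ((hwd.add_const σ).inv hp0.ne')
      rw [z3, indicator_of_mem hxU, hF, indicator_of_mem hxU, g4, g2, g3]
      have ham := KH_amgm (k := k) x (χ x • grad f x) (grad χ x) (1 / 2) (by norm_num)
      have he := hell x hx (grad f x)
      have hab := (mul_le_mul_of_nonneg_left (le_abs_self (KHform k x (χ x • grad f x) (grad χ x))) zero_le_two).trans ham
      clear ham
      rw [show ((1:ℝ) / 2)⁻¹ = 2 by norm_num] at hab
      rw [g1] at *
      simp only [KH_add_right, KH_smul_left, KH_smul_right] at *
      have e2 : ((w x + σ) ^ 2)⁻¹ = (w x + σ)⁻¹ * (w x + σ)⁻¹ := by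
        rw [pow_two, mul_inv]
      rw [e2]
      have he2 := mul_le_mul_of_nonneg_left he (sq_nonneg (χ x))
      nlinarith
    · rw [z3, indicator_of_notMem hxU, KH_zero_right, hF, indicator_of_notMem hxU]
      linarith
  have hn : IntegrableOn (fun x => - (κ / 2 * F x)) Ω := (hFi.integrableOn.const_mul (κ / 2)).neg
  have hInt := setIntegral_mono_on hi (hn.add (hi2.const_mul 2)) D.ho.measurableSet hpt
  simp only [Pi.add_apply] at hInt
  rw [integral_add hn (hi2.const_mul 2), integral_neg,
    integral_const_mul, integral_const_mul] at hInt
  have e3 : ∫ x in Ω, F x = ∫ x, F x := by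
    apply setIntegral_eq_integral_of_forall_compl_eq_zero
    intro x hx
    exact indicator_of_notMem (fun h => hx (hUΩ h)) _
  rw [e3] at hInt
  have : 0 ≤ ∫ x in Ω, KHform k x (grad w x) (grad ψ x) := hR
  linarith
end


lemma pt_dist_le (z : ℝ × ℝ) {ρ : ℝ} (hρ : 0 ≤ ρ) (φ : ℝ) : dist (pt z ρ φ) z ≤ ρ := by
  unfold pt
  rw [Prod.dist_eq]
  refine max_le ?_ ?_
  · rw [Real.dist_eq]; simp only [add_sub_cancel_left, abs_mul, abs_of_nonneg hρ]
    exact mul_le_of_le_one_right hρ (Real.abs_cos_le_one φ)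
  · rw [Real.dist_eq]; simp only [add_sub_cancel_left, abs_mul, abs_of_nonneg hρ]
    exact mul_le_of_le_one_right hρ (Real.abs_sin_le_one φ)

lemma dE_lt {z a : ℝ × ℝ} {R : ℝ} (h : dist a z < R / 2) : dE z a < R := by
  rw [Prod.dist_eq, max_lt_iff, Real.dist_eq, Real.dist_eq] at h
  have hR : 0 < R := by linarith [abs_nonneg (a.1 - z.1), h.1]
  unfold dE
  rw [Real.sqrt_lt' hR]
  have h1 := sq_lt_sq' (by linarith [(abs_lt.1 h.1).1]) (abs_lt.1 h.1).2
  have h2 := sq_lt_sq' (by linarith [(abs_lt.1 h.2).1]) (abs_lt.1 h.2).2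
  nlinarith

section
variable {k p : ℝ} {Ω : Set (ℝ × ℝ)} {q : ℝ × ℝ → ℝ}

lemma Dat.noHole (D : Dat k p Ω q) {ε : ℝ} {u : ℝ × ℝ → ℝ}
    (hu : IsMPSolution k p ε q Ω u) : NoHole (vcore q Ω ε u) := by
  intro F hF hd hU
  have hm := hu.2.1
  have hw0 := D.hole_zero hu hF hd hU
  have hUΩ := D.hole_sub (fun x (hx : x ∈ vcore q Ω ε u) => hx.1) hF hU
  have hFU : F ⊆ vcore q Ω ε u ∪ F := subset_union_right
  have hAU : vcore q Ω ε u ⊆ vcore q Ω ε u ∪ F := subset_union_left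
  have hwF : ∀ x ∈ F, wf q ε u x = 0 := by
    intro x hx
    refine le_antisymm ?_ (hw0 x (hFU hx))
    by_contra h
    push Not at h
    exact disjoint_left.1 hd hx (mem_vcore_iff.2 ⟨hUΩ (hFU hx), h⟩)
  by_contra hne
  have hne' : F.Nonempty := nonempty_iff_ne_empty.2 hne
  have hcl : (F ∩ closure (vcore q Ω ε u)).Nonempty := by
    by_contra h
    rw [not_nonempty_iff_eq_empty] at h
    have hFo : IsOpen F := by
      have : F = (vcore q Ω ε u ∪ F) \ closure (vcore q Ω ε u) := by
        ext x
        constructor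
        · exact fun hx => ⟨Or.inr hx, fun hx2 => (h ▸ (⟨hx, hx2⟩ : x ∈ F ∩ closure (vcore q Ω ε u)) : x ∈ (∅ : Set (ℝ × ℝ)))⟩
        · rintro ⟨hx | hx, h2⟩
          · exact absurd (subset_closure hx) h2
          · exact hx
      rw [this]; exact hU.sdiff isClosed_closure
    rcases isClopen_iff.1 ⟨hF.isClosed, hFo⟩ with h1 | h1
    · exact hne h1
    · rw [h1] at hF; exact noncompact_univ (ℝ × ℝ) hF
  obtain ⟨z, hzF, hzA⟩ := hcl
  set U := vcore q Ω ε u ∪ F with hUd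
  have hw1 : ContDiffOn ℝ 1 (wf q ε u) U := (D.wf_c1 hm).mono hUΩ
  obtain ⟨κ, hκ, hell⟩ := D.ell
  obtain ⟨r, hr, hrU⟩ := Metric.isOpen_iff.1 hU z (hFU hzF)
  set R := r / 4 with hR
  have hR0 : 0 < R := by positivity
  have hball : Metric.closedBall z (2 * R) ⊆ U :=
    (Metric.closedBall_subset_ball (by rw [hR]; linarith)).trans hrU
  let χ : ContDiffBump z := ⟨R, 2 * R, hR0, by linarith⟩
  have hχ : CT U χ := by
    refine ⟨χ.contDiff, Metric.closedBall z (2 * R), hball, isCompact_closedBall _ _, fun x hx => ?_⟩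
    refine χ.zero_of_le_dist ?_
    rw [Metric.mem_closedBall, not_le] at hx
    exact hx.le
  obtain ⟨a, haA, haz⟩ := Metric.mem_closure_iff.1 hzA (R / 2) (by positivity)
  rw [dist_comm] at haz
  have hρR := dE_lt haz
  have hwa := (mem_vcore_iff.1 haA).2
  have haz' : z ≠ a := by
    rintro rfl
    rw [hwF z hzF] at hwa; exact lt_irrefl _ hwa
  have hρ0 := dE_pos haz'
  obtain ⟨φ0, hφ0, ha⟩ := exists_pt z a
  set ρ := dE z a with hρ
  have hcontA : ContinuousAt (fun φ => wf q ε u (pt z ρ φ)) φ0 := by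
    refine ContinuousAt.comp (g := wf q ε u) (f := fun φ => pt z ρ φ) ?_ (pt_cont2 z ρ).continuousAt
    rw [← ha]
    exact hw1.continuousOn.continuousAt (hU.mem_nhds (hAU haA))
  have hev : ∀ᶠ φ in 𝓝 φ0, wf q ε u a / 2 < wf q ε u (pt z ρ φ) := by
    refine hcontA.eventually (lt_mem_nhds ?_)
    simp only [← ha]; linarith
  obtain ⟨η, hη, hφ⟩ := Metric.eventually_nhds_iff.1 hev
  set c := wf q ε u a / 2 with hc
  have hc0 : 0 < c := by rw [hc]; linarith
  set α := max (φ0 - η) (-π) with hα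
  set β := min (φ0 + η) π with hβ
  have hαβ : α < β := by
    have := Real.pi_pos
    rw [hα, hβ, max_lt_iff, lt_min_iff, lt_min_iff]
    refine ⟨⟨by linarith, ?_⟩, ?_, by linarith⟩ <;> linarith [hφ0.1, hφ0.2]
  have hang : ∀ φ ∈ Ioo α β, c < wf q ε u (pt z ρ φ) := by
    intro φ h
    refine hφ ?_
    rw [Real.dist_eq, abs_lt]
    have h1 := le_max_left (φ0 - η) (-π)
    have h2 := min_le_left (φ0 + η) π
    constructor <;> linarith [h.1, h.2]
  -- Lipschitz bound at z
  obtain ⟨C1, hC1, hbig⟩ := (diffAt_of hU hw1 (hFU hzF)).isBigO_sub.exists_pos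
  obtain ⟨r0, hr0, hlip⟩ := Metric.eventually_nhds_iff.1 hbig.bound
  set M := κ⁻¹ * (4 * ∫ x in Ω, KHform k x (grad χ x) (grad χ x)) with hM
  set A := Real.log c - Real.log (C1 + 1) with hA
  set B := Real.log ρ with hB
  set t := 1 + 2 * |A| + |B| + |Real.log r0| + 8 * |M| / (β - α) with ht
  have hba : 0 < β - α := by linarith
  have hMn : 0 ≤ 8 * |M| / (β - α) := by positivity
  have ht1 : 1 ≤ t := by rw [ht]; linarith [abs_nonneg A, abs_nonneg B, abs_nonneg (Real.log r0)]
  have htA : 2 * |A| ≤ t := by rw [ht]; linarith [abs_nonneg A, abs_nonneg B, abs_nonneg (Real.log r0)]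
  have htB : |B| < t := by rw [ht]; linarith [abs_nonneg A, abs_nonneg B, abs_nonneg (Real.log r0)]
  have htr : |Real.log r0| < t := by rw [ht]; linarith [abs_nonneg A, abs_nonneg B, abs_nonneg (Real.log r0)]
  have htM : 8 * |M| / (β - α) < t := by rw [ht]; linarith [abs_nonneg A, abs_nonneg B, abs_nonneg (Real.log r0)]
  set σ := Real.exp (-t) with hσ
  have hσ0 : 0 < σ := Real.exp_pos _
  have hlogσ : Real.log σ = -t := Real.log_exp _
  have hσρ : σ < ρ := by
    rw [← Real.log_lt_log_iff hσ0 hρ0, hlogσ]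
    linarith [(abs_lt.1 htB).1]
  have hσr : σ < r0 := by
    rw [← Real.log_lt_log_iff hσ0 hr0, hlogσ]
    linarith [(abs_lt.1 htr).1]
  obtain ⟨f1, Fc, Fi, Fle⟩ := D.log_cacc hu hU hUΩ hw0 hχ hell hσ0
  have hD0 : t / 2 ≤ A + t := by linarith [neg_abs_le A]
  have hin0 : ∀ φ, ∀ s ∈ Icc σ ρ, pt z s φ ∈ Metric.closedBall z R := by
    intro φ s hs
    rw [Metric.mem_closedBall]
    exact (pt_dist_le z (hσ0.le.trans hs.1) φ).trans (hs.2.trans hρR.le)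
  have hRU : Metric.closedBall z R ⊆ U := (Metric.closedBall_subset_closedBall (by linarith)).trans hball
  have hsec := sector_bound (D0 := A + t) Fc (fun x => indicator_nonneg (fun y _ => mul_nonneg (sq_nonneg _) (sqn_nonneg _)) x) Fi z hσ0 hσρ
    (le_max_right _ _ : -π ≤ α) (min_le_right _ _ : β ≤ π) hαβ.le hU f1
    (fun φ _ s hs => hRU (hin0 φ s hs))
    (fun φ _ s hs => by
      rw [indicator_of_mem (hRU (hin0 φ s hs)), χ.one_of_mem_closedBall (hin0 φ s hs)]; simp)
    (by linarith)
    (fun φ h => by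
      refine le_trans ?_ (le_abs_self _)
      have h1 : Real.log c ≤ Real.log (wf q ε u (pt z ρ φ) + σ) :=
        Real.log_le_log hc0 (by linarith [hang φ h])
      have hd1 := pt_dist_le z hσ0.le φ
      have h2 := hlip (lt_of_le_of_lt hd1 hσr)
      rw [hwF z hzF, sub_zero, Real.norm_eq_abs, ← dist_eq_norm] at h2
      have h3 : wf q ε u (pt z σ φ) + σ ≤ (C1 + 1) * σ := by
        have := mul_le_mul_of_nonneg_left hd1 hC1.le
        linarith [le_abs_self (wf q ε u (pt z σ φ))]
      have h4 : Real.log (wf q ε u (pt z σ φ) + σ) ≤ Real.log ((C1 + 1) * σ) := by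
        refine Real.log_le_log ?_ h3
        have := hw0 _ (hRU (hin0 φ σ ⟨le_rfl, hσρ.le⟩))
        linarith
      rw [Real.log_mul (by positivity) hσ0.ne', hlogσ] at h4
      rw [hA]; linarith)
  rw [Real.log_div hρ0.ne' hσ0.ne', hlogσ] at hsec
  have hFM : ∫ x, (U.indicator fun x => χ x ^ 2 * sqn (grad (fun y => Real.log (wf q ε u y + σ)) x)) x ≤ M := by
    rw [hM, ← div_eq_inv_mul, le_div_iff₀ hκ, mul_comm]; exact Fle
  have hden : 0 < B - -t := by linarith [neg_abs_le B]
  have hden2 : B - -t ≤ 2 * t := by linarith [le_abs_self B]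
  have h8 : t / 8 ≤ (A + t) ^ 2 / (B - -t) := by
    rw [le_div_iff₀ hden]
    nlinarith
  have h9 := (mul_le_mul_of_nonneg_left h8 hba.le).trans (hsec.trans hFM)
  rw [div_lt_iff₀ hba] at htM
  linarith [le_abs_self M]

lemma Dat.simply (D : Dat k p Ω q) {ε : ℝ} (hε : 0 < ε) (hL : 0 < Real.log (1 / ε)) {u : ℝ × ℝ → ℝ}
    (hu : IsMPSolution k p ε q Ω u) (hpos : 0 < ceps k p q Ω ε) :
    IsConnected (vcore q Ω ε u) ∧ SimplyConnectedSpace ↥(vcore q Ω ε u) := by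
  have h := D.connected hε hL hu hpos
  exact ⟨h, simplyConnected_of_noHole _ (D.vcore_open hu.2.1) (D.hb.subset fun x hx => hx.1) h (D.noHole hu)⟩
end


lemma dE_eq_norm (a b : ℝ × ℝ) : dE a b = ‖(⟨a.1, a.2⟩ : ℂ) - ⟨b.1, b.2⟩‖ := by
  rw [Complex.norm_def, Complex.normSq_apply]
  unfold dE
  simp only [Complex.sub_re, Complex.sub_im]
  congr 1; ring

lemma dE_tri (a b c : ℝ × ℝ) : dE a c ≤ dE a b + dE b c := by
  simp only [dE_eq_norm]; exact norm_sub_le_norm_sub_add_norm_sub _ _ _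

lemma diam_dist {A B : Set (ℝ × ℝ)} {η : ℝ} (hη : 0 < η) (hA : A.Nonempty) (hB : B.Nonempty)
    (h : ∀ a ∈ A, ∀ a' ∈ A, ∀ b ∈ B, dE a a' ≤ η * dE a b) : diamE A ≤ 2 * η * distE A B := by
  obtain ⟨a0, ha0⟩ := hA
  obtain ⟨b0, hb0⟩ := hB
  refine csSup_le ⟨_, a0, ha0, a0, ha0, rfl⟩ ?_
  rintro _ ⟨a, ha, a', ha', rfl⟩
  have : dE a a' / (2 * η) ≤ distE A B := by
    refine le_csInf ⟨_, a0, ha0, b0, hb0, rfl⟩ ?_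
    rintro _ ⟨c, hc, b, hb, rfl⟩
    rw [div_le_iff₀ (by positivity)]
    have h1 := h c hc a ha b hb
    have h2 := h c hc a' ha' b hb
    have h3 := dE_tri a c a'
    rw [dE_comm a c] at h3
    linarith
  rw [div_le_iff₀ (by positivity)] at this
  linarith

lemma distE_nonneg (A B : Set (ℝ × ℝ)) : 0 ≤ distE A B := by
  apply Real.sInf_nonneg
  rintro _ ⟨a, _, b, _, rfl⟩
  exact dE_nonneg _ _

lemma diamE_nonneg (A : Set (ℝ × ℝ)) : 0 ≤ diamE A := by
  apply Real.sSup_nonneg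
  rintro _ ⟨a, _, b, _, rfl⟩
  exact dE_nonneg _ _

lemma distE_le {A B : Set (ℝ × ℝ)} {a b : ℝ × ℝ} (ha : a ∈ A) (hb : b ∈ B) : distE A B ≤ dE a b := by
  refine csInf_le ⟨0, ?_⟩ ⟨a, ha, b, hb, rfl⟩
  rintro _ ⟨a, _, b, _, rfl⟩
  exact dE_nonneg _ _

section
variable {k p : ℝ} {Ω : Set (ℝ × ℝ)} {q : ℝ × ℝ → ℝ}

lemma Dat.main (D : Dat k p Ω q) {u : ℝ → ℝ × ℝ → ℝ}
    (hu : ∀ ε ∈ Set.Ioo (0:ℝ) 1, IsMPSolution k p ε q Ω (u ε)) :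
    (∀ᶠ ε in 𝓝[>] (0:ℝ),
      IsConnected (vcore q Ω ε (u ε)) ∧ SimplyConnectedSpace ↥(vcore q Ω ε (u ε))) ∧
    Tendsto (fun ε => diamE (vcore q Ω ε (u ε)) / distE (vcore q Ω ε (u ε)) (frontier Ω))
      (𝓝[>] (0:ℝ)) (𝓝 0) ∧
    Tendsto (fun ε => diamE (vcore q Ω ε (u ε))) (𝓝[>] (0:ℝ)) (𝓝 0) := by
  obtain ⟨C, hC, L0, hL0, hcap⟩ := D.cap_fun
  have hlog : Tendsto (fun ε : ℝ => Real.log (1 / ε)) (𝓝[>] 0) atTop := by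
    simp only [one_div, Real.log_inv]
    exact tendsto_neg_atBot_atTop.comp Real.tendsto_log_nhdsGT_zero
  have hη : Tendsto (fun ε : ℝ => 4 * Real.exp (-(π / (2 * (C / Real.log (1 / ε)))))) (𝓝[>] 0) (𝓝 0) := by
    have h1 : Tendsto (fun ε : ℝ => π / (2 * C) * Real.log (1 / ε)) (𝓝[>] 0) atTop :=
      hlog.const_mul_atTop (by positivity)
    have h2 := (Real.tendsto_exp_neg_atTop_nhds_zero.comp h1).const_mul 4
    simp only [mul_zero] at h2
    refine h2.congr fun ε => ?_
    simp only [Function.comp]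
    congr 3
    by_cases h : Real.log (1 / ε) = 0
    · rw [h]; simp
    · field_simp
  have hG : Tendsto (fun ε : ℝ => C / Real.log (1 / ε)) (𝓝[>] 0) (𝓝 0) := hlog.const_div_atTop C
  have hfr := frontier_ne D.ho D.hc.nonempty D.hb
  have h01 : ∀ᶠ ε in 𝓝[>] (0:ℝ), ε ∈ Ioo (0:ℝ) 1 := Ioo_mem_nhdsGT one_pos
  have hl2 : 0 < Real.log 2 / (32 * π) := div_pos (Real.log_pos (by norm_num)) (by positivity)
  have hev : ∀ᶠ ε in 𝓝[>] (0:ℝ),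
      (IsConnected (vcore q Ω ε (u ε)) ∧ SimplyConnectedSpace ↥(vcore q Ω ε (u ε))) ∧
      diamE (vcore q Ω ε (u ε)) ≤ 2 * (4 * Real.exp (-(π / (2 * (C / Real.log (1 / ε)))))) *
        distE (vcore q Ω ε (u ε)) (frontier Ω) := by
    filter_upwards [h01, hlog.eventually_ge_atTop L0, hη.eventually (gt_mem_nhds one_pos),
      hG.eventually (gt_mem_nhds hl2)] with ε hε hL h1 h2
    have hsol := hu ε hε
    have hLp : 0 < Real.log (1 / ε) := by linarith
    obtain ⟨hpos, g, hg, hgA, hgi⟩ := hcap ε hε.1 hL _ hsol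
    have hcs := D.simply hε.1 hLp hsol hpos
    refine ⟨hcs, diam_dist (by positivity) hcs.1.nonempty hfr ?_⟩
    intro a ha a' ha' b hb
    refine capacity D.ho D.hsc hcs.1.isPreconnected hg hgA (by positivity) hgi h2 h1 ha ha' ?_
    rw [D.ho.frontier_eq] at hb; exact hb.2
  refine ⟨hev.mono fun ε h => h.1, ?_, ?_⟩
  · have h2 := hη.const_mul 2
    rw [mul_zero] at h2
    refine tendsto_of_tendsto_of_tendsto_of_le_of_le' tendsto_const_nhds h2
      (Eventually.of_forall fun ε => div_nonneg (diamE_nonneg _) (distE_nonneg _ _)) ?_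
    filter_upwards [hev] with ε h
    exact div_le_of_le_mul₀ (distE_nonneg _ _) (by positivity) h.2
  · obtain ⟨b, hb⟩ := hfr
    obtain ⟨M, hM⟩ := D.cpt.exists_bound_of_continuousOn (dE_cont b).continuousOn
    have h2 := (hη.const_mul 2).mul_const M
    rw [mul_zero, zero_mul] at h2
    refine tendsto_of_tendsto_of_tendsto_of_le_of_le' tendsto_const_nhds h2
      (Eventually.of_forall fun ε => diamE_nonneg _) ?_
    filter_upwards [hev] with ε h
    obtain ⟨a, ha⟩ := h.1.1.nonempty
    refine h.2.trans (mul_le_mul_of_nonneg_left ?_ (by positivity))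
    refine (distE_le ha hb).trans ?_
    rw [dE_comm]
    exact (le_abs_self _).trans (hM a (subset_closure ha.1))
end

/-- Proposition 3.2: for every sufficiently small `ε`, the vortex
core `A_ε = {x ∈ Ω : u_ε(x) > q(x) ln(1/ε)}` is connected and simply connected, and
`diam(A_ε)/dist(A_ε, ∂Ω) → 0`; in particular `diam(A_ε) → 0`. -/
theorem statement10 (k p : ℝ) (hk : 0 < k) (hp : 1 < p)
    (Ω : Set (ℝ × ℝ)) (hΩo : IsOpen Ω) (hΩc : IsConnected Ω)
    (hΩb : Bornology.IsBounded Ω) (hΩsc : SimplyConnectedSpace ↥Ω)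
    (q : ℝ × ℝ → ℝ) (hq1 : ContDiffOn ℝ 2 q Ω) (hq2 : ContDiffOn ℝ 1 q (closure Ω))
    (hq3 : ∀ x ∈ closure Ω, 0 < q x) (hq4 : ∀ x ∈ Ω, LH k q x = 0)
    (hmin : ∃ x0 ∈ closure Ω, x0.2 = 0 ∧ ∀ y ∈ closure Ω, Qfun k q x0 ≤ Qfun k q y)
    (u : ℝ → ℝ × ℝ → ℝ)
    (hu : ∀ ε ∈ Set.Ioo (0:ℝ) 1, IsMPSolution k p ε q Ω (u ε))
    :
    (∀ᶠ ε in 𝓝[>] (0:ℝ),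
      IsConnected (vcore q Ω ε (u ε)) ∧ SimplyConnectedSpace ↥(vcore q Ω ε (u ε))) ∧
    Tendsto (fun ε => diamE (vcore q Ω ε (u ε)) / distE (vcore q Ω ε (u ε)) (frontier Ω))
      (𝓝[>] (0:ℝ)) (𝓝 0) ∧
    Tendsto (fun ε => diamE (vcore q Ω ε (u ε))) (𝓝[>] (0:ℝ)) (𝓝 0) := by
  exact Dat.main ⟨hk, hp, hΩo, hΩc, hΩb, hΩsc, hq1, hq2.continuousOn, hq3, hq4⟩ hu
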